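/- Consider the Ising model on ℤ² with h = 0 in the phase transition regime β > β_c. There exists θ ∈ (0,∞), depending on β, such that lim_{n→∞} sup_{B ∈ ℱ̃_{C_{θ,n}}} sup_{A ∈ ℱ̃_{<0}, μ_{β,0}^+(A) > 0} | μ_{β,0}^+(B | A) − μ_{β,0}^+(B) | = 0, where C_θ := {(x,y) ∈ ℤ² : x ≥ 0, |y| ≤ e^{θx}}, C_{θ,n} := C_θ ∩ ([n,∞) × ℤ), ℱ̃_S denotes the σ-algebra on {−1,+1}^{ℤ²} generated by the spins at sites of S ⊆ ℤ², and ℱ̃_{<0} := ℱ̃_{(−∞,0)×{0}}. -/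

import Mathlib

open MeasureTheory Filter Topology ProbabilityTheory

noncomputable section

/-- Spin value of a Boolean spin: `true ↦ +1`, `false ↦ -1`. -/
def sval (b : Bool) : ℝ := if b then 1 else -1

/-- Two-dimensional spin configurations. -/
abbrev Cfg2 := ℤ × ℤ → Bool

/-- Two-sided sequences over an alphabet `A`. -/
abbrev ZSeq (A : Type*) := ℤ → A

/-- Pasts: index `k` corresponds to the coordinate `-(k+1)`. -/
abbrev Past (A : Type*) := ℕ → A

/-- The four nearest neighbours of a site of `ℤ²`. -/
def nbrs (x : ℤ × ℤ) : Finset (ℤ × ℤ) :=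
  {(x.1 + 1, x.2), (x.1 - 1, x.2), (x.1, x.2 + 1), (x.1, x.2 - 1)}

/-- Boltzmann weight
`exp(β[Σ_{{x,y}⊆Λ, x∼y} ω_x ω_y + Σ_{x∈Λ, y∉Λ, x∼y} ω_x σ_y] − h Σ_{x∈Λ} ω_x)`
(the sum over unordered pairs inside `Λ` is written as half the ordered sum). -/
def isingWeight (β h : ℝ) (Λ : Finset (ℤ × ℤ)) (σ ω : Cfg2) : ℝ :=
  Real.exp (β * ((∑ x ∈ Λ, ∑ y ∈ Λ.filter (fun y => y ∈ nbrs x),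
        sval (ω x) * sval (ω y)) / 2
      + ∑ x ∈ Λ, ∑ y ∈ (nbrs x).filter (fun y => y ∉ Λ), sval (ω x) * sval (σ y))
    - h * ∑ x ∈ Λ, sval (ω x))

/-- Fill in the values `τ` inside `Λ` and `σ` outside. -/
def fill (Λ : Finset (ℤ × ℤ)) (σ : Cfg2) (τ : ↥Λ → Bool) : Cfg2 :=
  fun x => if hx : x ∈ Λ then τ ⟨x, hx⟩ else σ x

/-- The finite-volume Ising measure in `Λ` with boundary condition `σ`, viewed as a measure on
the full configuration space, the spins outside `Λ` being frozen to `σ`. -/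
def isingFV (β h : ℝ) (Λ : Finset (ℤ × ℤ)) (σ : Cfg2) : Measure Cfg2 :=
  (∑ τ : ↥Λ → Bool, ENNReal.ofReal (isingWeight β h Λ σ (fill Λ σ τ)))⁻¹ •
    ∑ τ : ↥Λ → Bool,
      ENNReal.ofReal (isingWeight β h Λ σ (fill Λ σ τ)) • Measure.dirac (fill Λ σ τ)

/-- The box `[-n,n]²`. -/
def box (n : ℕ) : Finset (ℤ × ℤ) :=
  (Finset.Icc (-(n : ℤ)) (n : ℤ)) ×ˢ (Finset.Icc (-(n : ℤ)) (n : ℤ))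

/-- Convergence of a sequence of measures on a product space in the sense of convergence of the
measures of all finite-dimensional cylinder events; for probability measures on `{−1,+1}^ι`
this is exactly weak convergence. -/
def CylTendsto {ι A : Type*} [MeasurableSpace A] (μs : ℕ → Measure (ι → A))
    (μ : Measure (ι → A)) : Prop :=
  ∀ (s : Finset ι) (f : ι → A),
    Tendsto (fun n => μs n {η | ∀ i ∈ s, η i = f i}) atTop (𝓝 (μ {η | ∀ i ∈ s, η i = f i}))

/-- `μ` is the plus phase `μ_{β,h}^+`: the weak limit of the finite-volume Ising measures on
`[-n,n]²` with all-plus boundary conditions. -/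
def IsPlusPhase (β h : ℝ) (μ : Measure Cfg2) : Prop :=
  IsProbabilityMeasure μ ∧ CylTendsto (fun n => isingFV β h (box n) (fun _ => true)) μ

/-- `μ` is the minus phase `μ_{β,h}^-`. -/
def IsMinusPhase (β h : ℝ) (μ : Measure Cfg2) : Prop :=
  IsProbabilityMeasure μ ∧ CylTendsto (fun n => isingFV β h (box n) (fun _ => false)) μ

/-- The critical inverse temperature `β_c = ln(1+√2)/2`. -/
def betaCrit : ℝ := Real.log (1 + Real.sqrt 2) / 2

/-- Projection of a two-dimensional configuration onto the line `ℤ × {0}`. -/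
def lineProj (η : Cfg2) : ZSeq Bool := fun i => η (i, 0)

/-- The Schonmann projection of a measure on `{−1,+1}^{ℤ²}`. -/
def schonmann (μ : Measure Cfg2) : Measure (ZSeq Bool) := μ.map lineProj

/-- Restriction of a two-sided sequence to its strict past; index `k` is coordinate `-(k+1)`. -/
def restrictPast {A : Type*} (ω : ZSeq A) : Past A := fun k => ω (-(k + 1 : ℤ))

/-- The shift on two-sided sequences. -/
def shiftSeq {A : Type*} : ZSeq A → ZSeq A := fun ω i => ω (i + 1)

/-- The σ-algebra `ℱ_{<0}` generated by the coordinates of negative index. -/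
def pastSigma (A : Type*) [MeasurableSpace A] : MeasurableSpace (ZSeq A) :=
  MeasurableSpace.comap (fun ω : ZSeq A => restrictPast ω) inferInstance

/-- The σ-algebra generated by the coordinates in `S`. -/
def sigmaOn {ι A : Type*} [MeasurableSpace A] (S : Set ι) : MeasurableSpace (ι → A) :=
  MeasurableSpace.comap (fun ω : ι → A => S.restrict ω) inferInstance

/-- A g-function on the alphabet `A`: measurable, `[0,1]`-valued, normalized. -/
def IsGFunction {A : Type*} [Fintype A] [MeasurableSpace A] (P : A → Past A → ℝ) : Prop :=
  (∀ a, Measurable (P a)) ∧ ∀ ω, (∑ a : A, P a ω) = 1 ∧ ∀ a, P a ω ∈ Set.Icc (0 : ℝ) 1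

/-- `μ` is a translation-invariant g-measure consistent with the g-function `P`: for each `a`,
`ω ↦ P a (restrictPast ω)` is a version of the conditional probability `μ(X₀ = a | ℱ_{<0})`. -/
def IsGMeasure {A : Type*} [MeasurableSpace A] (μ : Measure (ZSeq A))
    (P : A → Past A → ℝ) : Prop :=
  IsProbabilityMeasure μ ∧ μ.map shiftSeq = μ ∧
    ∀ a : A, (fun ω => P a (restrictPast ω))
      =ᵐ[μ] μ[Set.indicator {ω : ZSeq A | ω 0 = a} (fun _ => (1 : ℝ)) | pastSigma A]

/-- The `k`-th variation of a g-function: the supremum of `|P a ω − P a σ|` over pasts agreeing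
on the coordinates `−k,…,−1`. -/
def varG {A : Type*} (P : A → Past A → ℝ) (k : ℕ) : ℝ :=
  sSup {d : ℝ | ∃ (a : A) (ω σ' : Past A), (∀ j < k, ω j = σ' j) ∧ d = |P a ω - P a σ'|}

/-- Elementary conditional probability `μ(B | A)`, as a real number. -/
def condProbR {X : Type*} [MeasurableSpace X] (μ : Measure X) (B A : Set X) : ℝ :=
  ((μ[|A]) B).toReal

/-- The event that `η_i = ω` (suitably reindexed) for `−n ≤ i ≤ −1` and `η_i = b`
for `−(n+l) ≤ i ≤ −(n+1)`. -/
def pastEvt (n l : ℕ) (b : Bool) (ω : Past Bool) : Set (ZSeq Bool) :=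
  {η | (∀ i : ℤ, -(n : ℤ) ≤ i → i ≤ -1 → η i = ω (i.natAbs - 1)) ∧
       (∀ i : ℤ, -((n : ℤ) + l) ≤ i → i ≤ -((n : ℤ) + 1) → η i = b)}

/-- The event that `η_i = b` for `−(n+l) ≤ i ≤ −n`. -/
def blockEvt (n l : ℕ) (b : Bool) : Set (ZSeq Bool) :=
  {η | ∀ i : ℤ, -((n : ℤ) + l) ≤ i → i ≤ -(n : ℤ) → η i = b}

/-- The event that `η_i = b` for `−n ≤ i ≤ −1`. -/
def allBlock (n : ℕ) (b : Bool) : Set (ZSeq Bool) :=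
  {η | ∀ i : ℤ, -(n : ℤ) ≤ i → i ≤ -1 → η i = b}

/-- `P` is the g-function `P^{+,b}` obtained from `ν` by conditioning on the symbol `b`
in the far past: `P(a|ω) = lim_n lim_l ν(η₀ = a | η = b on [−(n+l),−(n+1)], η = ω on [−n,−1])`,
both iterated limits being required to exist. -/
def IsCondG (ν : Measure (ZSeq Bool)) (b : Bool) (P : Bool → Past Bool → ℝ) : Prop :=
  ∀ (a : Bool) (ω : Past Bool), ∃ L : ℕ → ℝ,
    (∀ n, Tendsto (fun l => condProbR ν {η | η 0 = a} (pastEvt n l b ω)) atTop (𝓝 (L n))) ∧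
    Tendsto L atTop (𝓝 (P a ω))

/-- `ν'` is the iterated weak limit `lim_n lim_l ν( · | η = b on [−(n+l),−n])`. -/
def IsCondLimitMeasure (ν : Measure (ZSeq Bool)) (b : Bool) (ν' : Measure (ZSeq Bool)) : Prop :=
  ∃ νseq : ℕ → Measure (ZSeq Bool),
    (∀ n, CylTendsto (fun l => ν[|blockEvt n l b]) (νseq n)) ∧ CylTendsto νseq ν'

/-- Stochastic domination: `ν ≤ μ` iff `ν B ≤ μ B` for every increasing measurable event `B`. -/
def StochDom {A : Type*} [MeasurableSpace A] [Preorder A]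
    (ν μ : Measure (ZSeq A)) : Prop :=
  ∀ B : Set (ZSeq A), MeasurableSet B → (∀ ⦃x y : ZSeq A⦄, x ≤ y → x ∈ B → y ∈ B) → ν B ≤ μ B

/-- `π` is the i.i.d. product measure with `π(η_i = +1) = ρ` for each coordinate. -/
def IsBernoulliProd (ρ : ℝ) (π : Measure (ZSeq Bool)) : Prop :=
  IsProbabilityMeasure π ∧ ∀ (s : Finset ℤ) (f : ℤ → Bool),
    π {η | ∀ i ∈ s, η i = f i} = ∏ i ∈ s, ENNReal.ofReal (if f i then ρ else 1 - ρ)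

/-- Splicing of pasts: coordinates `−k,…,−1` (indices `< k`) from `ω`, the rest from `σ`. -/
def splice {A : Type*} (σ ω : Past A) (k : ℕ) : Past A := fun j => if j < k then ω j else σ j

/-- `ν'` is an extreme point of the convex set of g-measures consistent with `P`. -/
def ExtremeGMeasure (ν' : Measure (ZSeq Bool)) (P : Bool → Past Bool → ℝ) : Prop :=
  IsGMeasure ν' P ∧
  ∀ ν₁ ν₂ : Measure (ZSeq Bool), IsGMeasure ν₁ P → IsGMeasure ν₂ P →
    ∀ t : ℝ, t ∈ Set.Ioo (0 : ℝ) 1 →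
      ν' = ENNReal.ofReal t • ν₁ + ENNReal.ofReal (1 - t) • ν₂ → ν₁ = ν' ∧ ν₂ = ν'

/-- The event that the spins on the line are `−1` on `{−m,…,−n} × {0}`. -/
def lineMinusEvt (n m : ℕ) : Set Cfg2 :=
  {η | ∀ i : ℤ, -(m : ℤ) ≤ i → i ≤ -(n : ℤ) → η (i, 0) = false}

/-- Nearest-neighbour adjacency in `ℤ²` (`‖x−y‖₁ = 1`). -/
def adj2 (x y : ℤ × ℤ) : Prop := (x.1 - y.1).natAbs + (x.2 - y.2).natAbs = 1

/-- The event `A_n`: there is an infinite nearest-neighbour path of `+1` spins starting at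
`(n,0)` entirely contained in the half-plane `{x ≤ n}`. -/
def plusPathEvt (n : ℕ) : Set Cfg2 :=
  {η | ∃ γ : ℕ → ℤ × ℤ, γ 0 = ((n : ℤ), 0) ∧ (∀ j, adj2 (γ j) (γ (j + 1))) ∧
    Function.Injective γ ∧ (∀ j, (γ j).1 ≤ (n : ℤ)) ∧ ∀ j, η (γ j) = true}

/-- The block map for the decimation `ν_{l,k}`: the `j`-th letter consists of the spins on
`[j(k+l), j(k+l)+l−1]`. -/
def blockMap (l k : ℕ) (η : ZSeq Bool) : ZSeq (Fin l → Bool) :=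
  fun j r => η (j * ((k : ℤ) + l) + r)

end

noncomputable section

/-- The sign character of `ZMod 2`. -/
def sg (x : ZMod 2) : ℝ := if x = 0 then 1 else -1

lemma sg_zero : sg 0 = 1 := by simp [sg]
lemma sg_one : sg 1 = -1 := by simp [sg]
lemma zmod2_cases (x : ZMod 2) : x = 0 ∨ x = 1 := by revert x; decide
lemma zmod2_add_self (x : ZMod 2) : x + x = 0 := by revert x; decide
lemma sg_add (x y : ZMod 2) : sg (x + y) = sg x * sg y := by
  rcases zmod2_cases x with rfl | rfl <;> rcases zmod2_cases y with rfl | rfl <;>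
    simp [sg, show (1 + 1 : ZMod 2) = 0 from rfl]
lemma sg_mul_self (x : ZMod 2) : sg x * sg x = 1 := by
  rw [← sg_add, zmod2_add_self, sg_zero]
lemma sg_eq (x : ZMod 2) : sg x = 1 ∨ sg x = -1 := by
  rcases zmod2_cases x with rfl | rfl <;> simp [sg]

set_option linter.unusedSectionVars false

section Graph

variable {V : Type*} [DecidableEq V]

/-- The indicator of the symmetric difference of `{a}` and `{b}`. -/
def pr (a b : V) : V → ZMod 2 := Pi.single a 1 + Pi.single b 1

/-- The boundary modulo two of a set of edges. -/
def par (F : Finset (V × V)) : V → ZMod 2 := ∑ e ∈ F, pr e.1 e.2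

/-- The high-temperature sum over subgraphs of `E` with boundary `d`. -/
def hw (t : ℝ) (E : Finset (V × V)) (d : V → ZMod 2) : ℝ :=
  open Classical in ∑ F ∈ E.powerset with par F = d, t ^ F.card

/-- The two-point correlation of the Ising model on the graph `E` with edge weights `t`. -/
def corr (t : ℝ) (E : Finset (V × V)) (a b : V) : ℝ := hw t E (pr a b) / hw t E 0

lemma pr_comm (a b : V) : pr a b = pr b a := add_comm _ _
lemma pr_self (a : V) : pr a a = 0 := by
  funext v; simp [pr, zmod2_add_self]
lemma pr_add (a b c : V) : pr a b + pr b c = pr a c := by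
  funext v
  simp only [pr, Pi.add_apply]
  have := zmod2_add_self ((Pi.single b 1 : V → ZMod 2) v)
  linear_combination this

section Spin

variable [Fintype V]

/-- The character with index `d` on `ZMod 2`-valued spin configurations. -/
def chi (d σ : V → ZMod 2) : ℝ := sg (d ⬝ᵥ σ)

lemma chi_add (d d' σ : V → ZMod 2) : chi (d + d') σ = chi d σ * chi d' σ := by
  simp [chi, add_dotProduct, sg_add]
lemma chi_add' (d σ τ : V → ZMod 2) : chi d (σ + τ) = chi d σ * chi d τ := by
  simp [chi, dotProduct_add, sg_add]
lemma chi_zero (σ : V → ZMod 2) : chi 0 σ = 1 := by simp [chi, sg]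
lemma chi_eq (d σ : V → ZMod 2) : chi d σ = 1 ∨ chi d σ = -1 := sg_eq _
lemma chi_pr (a b : V) (σ : V → ZMod 2) : chi (pr a b) σ = sg (σ a + σ b) := by
  simp [chi, pr, add_dotProduct]
lemma chi_mul_self (d σ : V → ZMod 2) : chi d σ * chi d σ = 1 := sg_mul_self _

lemma sum_chi (d : V → ZMod 2) :
    ∑ σ, chi d σ = if d = 0 then (2 : ℝ) ^ Fintype.card V else 0 := by
  split_ifs with h
  · subst h; simp [chi_zero, ZMod.card]
  · obtain ⟨v, hv⟩ : ∃ v, d v ≠ 0 := by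
      by_contra! hh; exact h (funext hh)
    have hv1 : d v = 1 := (zmod2_cases _).resolve_left hv
    have : ∑ σ, chi d σ = ∑ σ, chi d (σ + Pi.single v 1) :=
      (Fintype.sum_equiv (Equiv.addRight (Pi.single v 1)) _ _ (fun σ => rfl)).symm
    simp only [chi_add'] at this
    have h2 : chi d (Pi.single v 1) = -1 := by simp [chi, hv1, sg]
    rw [h2, ← Finset.sum_mul] at this
    linarith

/-- The weight of a spin configuration. -/
def sw (t : ℝ) (E : Finset (V × V)) (σ : V → ZMod 2) : ℝ :=
  ∏ e ∈ E, (1 + t * chi (pr e.1 e.2) σ)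

lemma chi_par (F : Finset (V × V)) (σ : V → ZMod 2) :
    chi (par F) σ = ∏ e ∈ F, chi (pr e.1 e.2) σ := by
  induction F using Finset.induction_on with
  | empty => simp [par, chi_zero]
  | insert e F he ih =>
    rw [par, Finset.sum_insert he, chi_add, Finset.prod_insert he, ← ih, par]

/-- The unnormalised expectation of the character `d`. -/
def sz (t : ℝ) (E : Finset (V × V)) (d : V → ZMod 2) : ℝ := ∑ σ, chi d σ * sw t E σ

lemma sz_eq (t : ℝ) (E : Finset (V × V)) (d : V → ZMod 2) :
    sz t E d = 2 ^ Fintype.card V * hw t E d := by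
  classical
  have h1 : ∀ σ, chi d σ * sw t E σ = ∑ F ∈ E.powerset, t ^ F.card * chi (d + par F) σ := by
    intro σ
    rw [sw, Finset.prod_one_add, Finset.mul_sum]
    refine Finset.sum_congr rfl fun F _ => ?_
    rw [Finset.prod_mul_distrib, ← chi_par, chi_add, Finset.prod_const]; ring
  simp only [sz, h1]
  rw [Finset.sum_comm, hw, Finset.sum_filter, Finset.mul_sum]
  refine Finset.sum_congr rfl fun F _ => ?_
  rw [← Finset.mul_sum, sum_chi]
  have : d + par F = 0 ↔ par F = d := by
    constructor
    · intro h
      funext v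
      have h1 := congrFun h v
      have h2 := zmod2_add_self (d v)
      simp only [Pi.add_apply, Pi.zero_apply] at h1
      linear_combination h1 - h2
    · rintro rfl; funext v; exact zmod2_add_self _
  simp only [this]
  split_ifs <;> ring

/-- Nonnegative combinations of characters. -/
inductive PosType : ((V → ZMod 2) → ℝ) → Prop
  | char (c : ℝ) (hc : 0 ≤ c) (d : V → ZMod 2) : PosType (fun σ => c * chi d σ)
  | add {f g} : PosType f → PosType g → PosType (fun σ => f σ + g σ)

namespace PosType

lemma const (c : ℝ) (hc : 0 ≤ c) : PosType (V := V) (fun _ => c) := by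
  have := PosType.char (V := V) c hc 0
  simpa [chi_zero] using this

lemma chi (d : V → ZMod 2) : PosType (chi d) := by
  have := PosType.char (V := V) 1 zero_le_one d
  simpa using this

lemma mul {f g : (V → ZMod 2) → ℝ} (hf : PosType f) (hg : PosType g) :
    PosType (fun σ => f σ * g σ) := by
  induction hf with
  | char c hc d =>
    induction hg with
    | char c' hc' d' =>
      have := PosType.char (c * c') (mul_nonneg hc hc') (d + d')
      convert this using 2 with σ
      rw [chi_add]; ring
    | add _ _ h1 h2 =>
      have := h1.add h2
      convert this using 2 with σ
      ring
  | add _ _ h1 h2 =>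
    have := h1.add h2
    convert this using 2 with σ
    ring

lemma prod {ι : Type*} (s : Finset ι) (f : ι → (V → ZMod 2) → ℝ)
    (h : ∀ i ∈ s, PosType (f i)) : PosType (fun σ => ∏ i ∈ s, f i σ) := by
  classical
  induction s using Finset.induction_on with
  | empty => simpa using const 1 zero_le_one
  | insert i s hi ih =>
    simp only [Finset.prod_insert hi]
    exact (h i (Finset.mem_insert_self i s)).mul
      (ih fun j hj => h j (Finset.mem_insert_of_mem hj))

lemma sum_nonneg {f : (V → ZMod 2) → ℝ} (hf : PosType f) : 0 ≤ ∑ σ, f σ := by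
  induction hf with
  | char c hc d =>
    rw [← Finset.mul_sum, sum_chi]
    positivity
  | add _ _ h1 h2 => rw [Finset.sum_add_distrib]; exact add_nonneg h1 h2

lemma edge {t : ℝ} (ht : 0 ≤ t) (d : V → ZMod 2) :
    PosType (fun σ => 1 + t * _root_.chi d σ) :=
  (const 1 zero_le_one).add (char t ht d)

lemma sw {t : ℝ} (ht : 0 ≤ t) (E : Finset (V × V)) : PosType (sw t E) :=
  prod E _ fun e _ => edge ht (pr e.1 e.2)

end PosType

lemma sw_double {t : ℝ} (S : Finset (V × V)) (σ ε : V → ZMod 2) :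
    sw t S σ * sw t S (σ + ε) = ∏ e ∈ S,
      ((1 - t ^ 2) + (t ^ 2 + t * chi (pr e.1 e.2) σ) * (1 + chi (pr e.1 e.2) ε)) := by
  rw [sw, sw, ← Finset.prod_mul_distrib]
  refine Finset.prod_congr rfl fun e _ => ?_
  rw [chi_add']
  have := chi_mul_self (pr e.1 e.2) σ
  linear_combination (t ^ 2 * chi (pr e.1 e.2) ε) * this

lemma posType_double {t : ℝ} (ht : 0 ≤ t) (ht1 : t ≤ 1) (S : Finset (V × V)) (ε : V → ZMod 2) :
    PosType (fun σ => sw t S σ * sw t S (σ + ε)) := by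
  simp only [sw_double]
  refine PosType.prod S _ fun e _ => ?_
  have h0 : 0 ≤ 1 + chi (pr e.1 e.2) ε := by
    rcases chi_eq (pr e.1 e.2) ε with h | h <;> rw [h] <;> norm_num
  exact (PosType.const _ (by nlinarith)).add
    (((PosType.const _ (sq_nonneg t)).add (PosType.char t ht _)).mul (PosType.const _ h0))

lemma sum_double (f : (V → ZMod 2) → (V → ZMod 2) → ℝ) :
    ∑ σ, ∑ τ, f σ τ = ∑ ε, ∑ σ, f σ (σ + ε) := by
  rw [Finset.sum_comm (s := Finset.univ) (t := Finset.univ) (f := fun ε σ => f σ (σ + ε))]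
  refine Finset.sum_congr rfl fun σ _ => ?_
  exact (Fintype.sum_equiv (Equiv.addLeft σ) _ _ (fun ε => rfl)).symm

lemma sz_mul_sz (t : ℝ) (E S : Finset (V × V)) (d d' : V → ZMod 2) :
    sz t E d * sz t S d' =
      ∑ ε, ∑ σ, chi (d + d') σ * chi d' ε * (sw t E σ * sw t S (σ + ε)) := by
  rw [sz, sz, Finset.sum_mul_sum, sum_double]
  refine Finset.sum_congr rfl fun ε _ => Finset.sum_congr rfl fun σ _ => ?_
  rw [chi_add, chi_add']; ring

lemma sw_sdiff_mul {t : ℝ} {E S : Finset (V × V)} (h : S ⊆ E) (σ : V → ZMod 2) :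
    sw t E σ = sw t (E \ S) σ * sw t S σ := by
  rw [sw, sw, sw, Finset.prod_sdiff h]

/-- Griffiths' second inequality, for two nested graphs. -/
lemma sz_griffiths {t : ℝ} (ht : 0 ≤ t) (ht1 : t ≤ 1) {E S : Finset (V × V)} (h : S ⊆ E)
    (d d' : V → ZMod 2) : sz t E d * sz t S d' ≤ sz t E (d + d') * sz t S 0 := by
  rw [← sub_nonneg, sz_mul_sz, sz_mul_sz, add_zero, ← Finset.sum_sub_distrib]
  refine Finset.sum_nonneg fun ε _ => ?_
  rw [← Finset.sum_sub_distrib]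
  have h0 : 0 ≤ 1 - chi d' ε := by
    rcases chi_eq d' ε with h | h <;> rw [h] <;> norm_num
  have hp := (((PosType.chi (d + d')).mul (PosType.const _ h0)).mul
    ((PosType.sw ht (E \ S)).mul (posType_double ht ht1 S ε))).sum_nonneg
  refine hp.trans_eq (Finset.sum_congr rfl fun σ _ => ?_)
  rw [sw_sdiff_mul h, chi_zero]; ring

/-- Connection relation generated by `O`. -/
def conn (O : Finset (V × V)) (a b : V) : Prop :=
  ∀ ε : V → ZMod 2, (∀ e ∈ O, ε e.1 = ε e.2) → ε a = ε b

lemma chi_pr_eq_one_iff (a b : V) (ε : V → ZMod 2) : chi (pr a b) ε = 1 ↔ ε a = ε b := by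
  rw [chi_pr]
  rcases zmod2_cases (ε a) with h | h <;> rcases zmod2_cases (ε b) with h' | h' <;>
    rw [h, h'] <;> norm_num [sg]
  rfl

open Classical in
lemma sum_chi_conn (O : Finset (V × V)) (a b : V) :
    ∑ ε, chi (pr a b) ε * ∏ e ∈ O, (1 + chi (pr e.1 e.2) ε) =
      if conn O a b then ∑ ε, ∏ e ∈ O, (1 + chi (pr e.1 e.2) ε) else 0 := by
  have hz : ∀ ε : V → ZMod 2, (¬ ∀ e ∈ O, ε e.1 = ε e.2) →
      ∏ e ∈ O, (1 + chi (pr e.1 e.2) ε) = 0 := by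
    intro ε hε
    push Not at hε
    obtain ⟨e, he, hne⟩ := hε
    refine Finset.prod_eq_zero he ?_
    rw [(chi_eq _ ε).resolve_left (by rwa [chi_pr_eq_one_iff])]; norm_num
  split_ifs with h
  · refine Finset.sum_congr rfl fun ε _ => ?_
    by_cases hε : ∀ e ∈ O, ε e.1 = ε e.2
    · rw [(chi_pr_eq_one_iff a b ε).2 (h ε hε), one_mul]
    · rw [hz ε hε, mul_zero]
  · rw [conn] at h
    push Not at h
    obtain ⟨ε₀, h0, hab⟩ := h
    set f : (V → ZMod 2) → ℝ := fun ε => chi (pr a b) ε * ∏ e ∈ O, (1 + chi (pr e.1 e.2) ε)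
    have : ∑ ε, f ε = ∑ ε, f (ε + ε₀) :=
      (Fintype.sum_equiv (Equiv.addRight ε₀) _ _ (fun σ => rfl)).symm
    have h2 : ∀ ε, f (ε + ε₀) = - f ε := by
      intro ε
      simp only [f, chi_add']
      rw [(chi_eq (pr a b) ε₀).resolve_left (by rwa [chi_pr_eq_one_iff])]
      rw [Finset.prod_congr rfl (fun e he => by
        rw [(chi_pr_eq_one_iff e.1 e.2 ε₀).2 (h0 e he), mul_one])]
      ring
    simp only [h2, Finset.sum_neg_distrib] at this
    linarith

lemma posType_add_sub {t : ℝ} (ht : 0 ≤ t) (D : Finset (V × V)) :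
    PosType (fun σ => sw t D σ + sw (-t) D σ) ∧ PosType (fun σ => sw t D σ - sw (-t) D σ) := by
  induction D using Finset.induction_on with
  | empty =>
    simp only [sw, Finset.prod_empty, sub_self]
    exact ⟨PosType.const _ (by norm_num), PosType.const _ le_rfl⟩
  | insert e D he ih =>
    have hx := PosType.char (V := V) t ht (pr e.1 e.2)
    constructor
    · convert ih.1.add (hx.mul ih.2) using 2 with σ
      simp only [sw, Finset.prod_insert he]; ring
    · convert ih.2.add (hx.mul ih.1) using 2 with σ
      simp only [sw, Finset.prod_insert he]; ring

lemma posType_flip {t : ℝ} (ht : 0 ≤ t) (D : Finset (V × V)) :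
    PosType (fun σ => 2 * t * (∑ e ∈ D, chi (pr e.1 e.2) σ) * sw t D σ
      - sw t D σ + sw (-t) D σ) := by
  induction D using Finset.induction_on with
  | empty =>
    simp only [sw, Finset.prod_empty, Finset.sum_empty]
    convert PosType.const (V := V) 0 le_rfl using 2; ring
  | insert f D hf ih =>
    have hx := PosType.char (V := V) t ht (pr f.1 f.2)
    have h2 := ((posType_add_sub ht D).2.add (hx.mul (PosType.sw ht D)))
    convert (ih.mul (PosType.edge ht (pr f.1 f.2))).add
      (((PosType.const 2 zero_le_two).mul hx).mul h2) using 2 with σ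
    simp only [sw, Finset.prod_insert hf, Finset.sum_insert hf]
    ring

open Classical in
/-- The part of the Simon–Lieb inequality belonging to a fixed set of open edges. -/
lemma simon_lieb_fixed {t : ℝ} (ht : 0 ≤ t) (X O : Finset (V × V)) (a b : V) :
    (if conn O a b then 0 else
      ∑ τ, chi (pr a b) τ * (sw t X τ * ∏ e ∈ O, (t ^ 2 + t * chi (pr e.1 e.2) τ))) ≤
    t * ∑ e ∈ X, ((if conn O a e.1 then (1 : ℝ) else 0) + (if conn O a e.2 then 1 else 0)) *
      ∑ τ, chi (pr a b) τ * (chi (pr e.1 e.2) τ *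
        (sw t X τ * ∏ e ∈ O, (t ^ 2 + t * chi (pr e.1 e.2) τ))) := by
  set u : (V → ZMod 2) → ℝ := fun τ => ∏ e ∈ O, (t ^ 2 + t * chi (pr e.1 e.2) τ) with hu_def
  have hu : PosType u := PosType.prod O _ fun e _ =>
    (PosType.const _ (sq_nonneg t)).add (PosType.char t ht _)
  have hterm : ∀ e ∈ X, 0 ≤ ∑ τ, chi (pr a b) τ * (chi (pr e.1 e.2) τ * (sw t X τ * u τ)) :=
    fun e _ => ((PosType.chi _).mul ((PosType.chi _).mul ((PosType.sw ht X).mul hu))).sum_nonneg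
  have hcoef : ∀ e : V × V, 0 ≤ (if conn O a e.1 then (1 : ℝ) else 0) +
      (if conn O a e.2 then 1 else 0) := by
    intro e; split_ifs <;> norm_num
  split_ifs with hab
  · exact mul_nonneg ht (Finset.sum_nonneg fun e he => mul_nonneg (hcoef e) (hterm e he))
  set C : V → ZMod 2 := fun v => if conn O a v then 1 else 0 with hC
  set D := X.filter (fun e => C e.1 ≠ C e.2) with hD
  have hCa : C a = 1 := if_pos (fun ε _ => rfl)
  have hCb : C b = 0 := if_neg hab
  have hCO : ∀ e ∈ O, C e.1 = C e.2 := by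
    intro e he
    have : conn O a e.1 ↔ conn O a e.2 :=
      ⟨fun h ε hε => (h ε hε).trans (hε e he), fun h ε hε => (h ε hε).trans (hε e he).symm⟩
    simp only [hC, this]
  have hchiC : ∀ e : V × V, chi (pr e.1 e.2) C = if C e.1 = C e.2 then 1 else -1 := by
    intro e
    split_ifs with h
    · rwa [chi_pr_eq_one_iff]
    · exact (chi_eq _ _).resolve_left (by rwa [chi_pr_eq_one_iff])
  have hflip : ∑ τ, chi (pr a b) τ * (sw t X τ * u τ) =
      ∑ τ, - (chi (pr a b) τ * (sw (-t) D τ * sw t (X \ D) τ * u τ)) := by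
    rw [← Fintype.sum_equiv (Equiv.addRight C) (fun τ => chi (pr a b) (τ + C) *
      (sw t X (τ + C) * u (τ + C))) _ (fun σ => rfl)]
    refine Finset.sum_congr rfl fun τ _ => ?_
    have h1 : chi (pr a b) (τ + C) = - chi (pr a b) τ := by
      rw [chi_add', hchiC (a, b), if_neg (by simp [hCa, hCb])]; ring
    have h2 : u (τ + C) = u τ := by
      refine Finset.prod_congr rfl fun e he => ?_
      rw [chi_add', hchiC, if_pos (hCO e he), mul_one]
    have h3 : sw t X (τ + C) = sw (-t) D τ * sw t (X \ D) τ := by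
      rw [sw_sdiff_mul (Finset.filter_subset _ _ : D ⊆ X), mul_comm]
      congr 1
      · refine Finset.prod_congr rfl fun e he => ?_
        rw [chi_add', hchiC, if_neg (Finset.mem_filter.1 he).2]; ring
      · refine Finset.prod_congr rfl fun e he => ?_
        rw [chi_add', hchiC, if_pos, mul_one]
        rw [Finset.mem_sdiff, hD, Finset.mem_filter] at he
        by_contra hne
        exact he.2 ⟨he.1, hne⟩
    rw [h1, h2, h3]; ring
  have hmain := ((PosType.chi (pr a b)).mul
    ((posType_flip ht D).mul ((PosType.sw ht (X \ D)).mul hu))).sum_nonneg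
  have hstep : ∑ τ, chi (pr a b) τ * (sw t X τ * u τ) ≤
      t * ∑ e ∈ D, ∑ τ, chi (pr a b) τ * (chi (pr e.1 e.2) τ * (sw t X τ * u τ)) := by
    have e1 : ∑ τ, chi (pr a b) τ * ((2 * t * (∑ e ∈ D, chi (pr e.1 e.2) τ) * sw t D τ
        - sw t D τ + sw (-t) D τ) * (sw t (X \ D) τ * u τ)) =
        2 * (t * ∑ e ∈ D, ∑ τ, chi (pr a b) τ * (chi (pr e.1 e.2) τ * (sw t X τ * u τ)))
        - ∑ τ, chi (pr a b) τ * (sw t X τ * u τ)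
        - ∑ τ, - (chi (pr a b) τ * (sw (-t) D τ * sw t (X \ D) τ * u τ)) := by
      rw [Finset.sum_comm, Finset.mul_sum, Finset.mul_sum, ← Finset.sum_sub_distrib,
        ← Finset.sum_sub_distrib]
      refine Finset.sum_congr rfl fun τ _ => ?_
      rw [← Finset.mul_sum, ← Finset.sum_mul,
        sw_sdiff_mul (t := t) (Finset.filter_subset _ _ : D ⊆ X)]
      ring
    rw [e1, ← hflip] at hmain
    linarith
  refine hstep.trans (mul_le_mul_of_nonneg_left ?_ ht)
  rw [hD, Finset.sum_filter]
  refine Finset.sum_le_sum fun e he => ?_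
  split_ifs with hne h1 h2 h2
  · simp [hC, h1, h2] at hne
  · simp [hu_def]
  · simp [hu_def]
  · simp [hC, h1, h2] at hne
  all_goals exact mul_nonneg (by norm_num) (hterm e he)

/-- Expansion of the duplicated system over the sets of open edges. -/
lemma sz_mul_expand {t : ℝ} {E S : Finset (V × V)} (h : S ⊆ E) (d : V → ZMod 2) (a x : V) :
    open Classical in
    sz t E d * sz t S (pr a x) = ∑ O ∈ S.powerset,
      (1 - t ^ 2) ^ (S \ O).card * (∑ ε, ∏ e ∈ O, (1 + chi (pr e.1 e.2) ε)) *
      ((if conn O a x then 1 else 0) * ∑ τ, chi (d + pr a x) τ *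
        (sw t (E \ S) τ * ∏ e ∈ O, (t ^ 2 + t * chi (pr e.1 e.2) τ))) := by
  classical
  rw [sz_mul_sz]
  have h1 : ∀ ε τ, chi (d + pr a x) τ * chi (pr a x) ε * (sw t E τ * sw t S (τ + ε)) =
      ∑ O ∈ S.powerset, (1 - t ^ 2) ^ (S \ O).card *
        ((chi (pr a x) ε * ∏ e ∈ O, (1 + chi (pr e.1 e.2) ε)) *
        (chi (d + pr a x) τ * (sw t (E \ S) τ *
          ∏ e ∈ O, (t ^ 2 + t * chi (pr e.1 e.2) τ)))) := by
    intro ε τ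
    rw [sw_sdiff_mul h, mul_assoc (sw t (E \ S) τ), sw_double, Finset.prod_congr rfl
      (fun e _ => add_comm _ _), Finset.prod_add, Finset.mul_sum, Finset.mul_sum]
    refine Finset.sum_congr rfl fun O _ => ?_
    rw [Finset.prod_mul_distrib, Finset.prod_const]
    ring
  simp only [h1]
  rw [Finset.sum_congr rfl (fun ε _ => Finset.sum_comm), Finset.sum_comm]
  refine Finset.sum_congr rfl fun O _ => ?_
  simp only [← Finset.mul_sum]
  rw [← Finset.sum_mul, sum_chi_conn]
  split_ifs <;> ring

lemma sz_simon_lieb {t : ℝ} (ht : 0 ≤ t) (ht1 : t ≤ 1) {E S : Finset (V × V)} (h : S ⊆ E)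
    (a b : V) :
    sz t E (pr a b) * sz t S 0 - sz t E 0 * sz t S (pr a b) ≤
      t * ∑ e ∈ E \ S, (sz t S (pr a e.1) * sz t E (pr e.2 b) +
        sz t S (pr a e.2) * sz t E (pr e.1 b)) := by
  classical
  have ha : ∀ O : Finset (V × V), conn O a a := fun O ε _ => rfl
  have hL : sz t E (pr a b) * sz t S 0 - sz t E 0 * sz t S (pr a b) = ∑ O ∈ S.powerset,
      (1 - t ^ 2) ^ (S \ O).card * (∑ ε, ∏ e ∈ O, (1 + chi (pr e.1 e.2) ε)) *
      (if conn O a b then 0 else ∑ τ, chi (pr a b) τ *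
        (sw t (E \ S) τ * ∏ e ∈ O, (t ^ 2 + t * chi (pr e.1 e.2) τ))) := by
    rw [← pr_self a, sz_mul_expand h, pr_self, sz_mul_expand h, ← Finset.sum_sub_distrib]
    refine Finset.sum_congr rfl fun O _ => ?_
    rw [add_zero, zero_add, if_pos (ha O)]
    split_ifs <;> ring
  have key : ∀ e : V × V, pr e.2 b + pr a e.1 = pr a b + pr e.1 e.2 ∧
      pr e.1 b + pr a e.2 = pr a b + pr e.1 e.2 := by
    intro e
    constructor
    · simp only [pr]; abel
    · simp only [pr]; abel
  have hR : t * ∑ e ∈ E \ S, (sz t S (pr a e.1) * sz t E (pr e.2 b) +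
        sz t S (pr a e.2) * sz t E (pr e.1 b)) = ∑ O ∈ S.powerset,
      (1 - t ^ 2) ^ (S \ O).card * (∑ ε, ∏ e ∈ O, (1 + chi (pr e.1 e.2) ε)) *
      (t * ∑ e ∈ E \ S, ((if conn O a e.1 then (1 : ℝ) else 0) +
        (if conn O a e.2 then 1 else 0)) * ∑ τ, chi (pr a b) τ * (chi (pr e.1 e.2) τ *
        (sw t (E \ S) τ * ∏ e ∈ O, (t ^ 2 + t * chi (pr e.1 e.2) τ)))) := by
    have h1 : ∀ e ∈ E \ S, sz t S (pr a e.1) * sz t E (pr e.2 b) +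
        sz t S (pr a e.2) * sz t E (pr e.1 b) = ∑ O ∈ S.powerset,
      (1 - t ^ 2) ^ (S \ O).card * (∑ ε, ∏ e ∈ O, (1 + chi (pr e.1 e.2) ε)) *
      (((if conn O a e.1 then (1 : ℝ) else 0) +
        (if conn O a e.2 then 1 else 0)) * ∑ τ, chi (pr a b) τ * (chi (pr e.1 e.2) τ *
        (sw t (E \ S) τ * ∏ e ∈ O, (t ^ 2 + t * chi (pr e.1 e.2) τ)))) := by
      intro e _
      rw [mul_comm, sz_mul_expand h, mul_comm (sz t S _), sz_mul_expand h,
        ← Finset.sum_add_distrib, (key e).1, (key e).2]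
      refine Finset.sum_congr rfl fun O _ => ?_
      simp only [chi_add, mul_assoc]
      ring
    rw [Finset.sum_congr rfl h1, Finset.sum_comm, Finset.mul_sum]
    refine Finset.sum_congr rfl fun O _ => ?_
    rw [← Finset.mul_sum]; ring
  rw [hL, hR]
  refine Finset.sum_le_sum fun O _ => mul_le_mul_of_nonneg_left (simon_lieb_fixed ht _ O a b) ?_
  refine mul_nonneg (pow_nonneg (by nlinarith) _) (Finset.sum_nonneg fun ε _ =>
    Finset.prod_nonneg fun e _ => ?_)
  rcases chi_eq (pr e.1 e.2) ε with h | h <;> rw [h] <;> norm_num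

end Spin

section Transfer

lemma pr_map {V' : Type*} [DecidableEq V'] {f : V → V'} (hf : f.Injective) (a b v : V) :
    pr (f a) (f b) (f v) = pr a b v := by
  simp [pr, Pi.single_apply, hf.eq_iff]

lemma pr_map_of_notMem {V' : Type*} [DecidableEq V'] {f : V → V'} (a b : V) {v : V'}
    (hv : v ∉ Set.range f) : pr (f a) (f b) v = 0 := by
  have : ∀ a, v ≠ f a := fun a h => hv ⟨a, h.symm⟩
  simp [pr, this a, this b]

lemma hw_image {V' : Type*} [DecidableEq V'] (t : ℝ) {f : V → V'} (hf : f.Injective)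
    (E : Finset (V × V)) (a b : V) :
    hw t (E.image (Prod.map f f)) (pr (f a) (f b)) = hw t E (pr a b) := by
  classical
  have hinj : Function.Injective (Prod.map f f) := hf.prodMap hf
  have hpar : ∀ F : Finset (V × V), par (F.image (Prod.map f f)) =
      ∑ e ∈ F, pr (f e.1) (f e.2) := fun F =>
    Finset.sum_image fun x _ y _ h => hinj h
  rw [hw, hw, Finset.powerset_image, Finset.sum_filter, Finset.sum_filter, Finset.sum_image]
  · refine Finset.sum_congr rfl fun F _ => ?_
    rw [Finset.card_image_of_injective _ hinj]
    congr 1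
    rw [hpar, eq_iff_iff]
    constructor
    · intro h
      funext v
      rw [← pr_map hf, ← congrFun h (f v), par, Finset.sum_apply, Finset.sum_apply]
      simp only [pr_map hf]
    · intro h
      funext v
      by_cases hv : v ∈ Set.range f
      · obtain ⟨v, rfl⟩ := hv
        rw [pr_map hf, ← congrFun h v, par, Finset.sum_apply, Finset.sum_apply]
        simp only [pr_map hf]
      · rw [Finset.sum_apply, pr_map_of_notMem a b hv]
        exact Finset.sum_eq_zero fun e _ => pr_map_of_notMem _ _ hv
  · intro x _ y _ h
    exact Finset.image_injective hinj h

lemma corr_image {V' : Type*} [DecidableEq V'] (t : ℝ) {f : V → V'} (hf : f.Injective)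
    (E : Finset (V × V)) (a b : V) :
    corr t (E.image (Prod.map f f)) (f a) (f b) = corr t E a b := by
  rw [corr, corr, hw_image t hf, ← pr_self (f a), hw_image t hf, pr_self]

/-- The set of endpoints of a set of edges. -/
def ends (E : Finset (V × V)) : Finset V := E.image Prod.fst ∪ E.image Prod.snd

lemma fst_mem_ends {E : Finset (V × V)} {e : V × V} (he : e ∈ E) : e.1 ∈ ends E :=
  Finset.mem_union_left _ (Finset.mem_image_of_mem _ he)
lemma snd_mem_ends {E : Finset (V × V)} {e : V × V} (he : e ∈ E) : e.2 ∈ ends E :=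
  Finset.mem_union_right _ (Finset.mem_image_of_mem _ he)

/-- Restriction of a set of edges to a finite vertex set. -/
def resE (W : Finset V) (E : Finset (V × V)) : Finset (W × W) :=
  Finset.univ.filter fun e => ((e.1 : V), (e.2 : V)) ∈ E

lemma image_resE {W : Finset V} {E : Finset (V × V)} (h : ends E ⊆ W) :
    (resE W E).image (Prod.map Subtype.val Subtype.val) = E := by
  ext e
  simp only [resE, Finset.mem_image, Finset.mem_filter, Finset.mem_univ, true_and, Prod.exists,
    Prod.map]
  constructor
  · rintro ⟨x, y, hxy, rfl⟩; exact hxy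
  · intro he
    exact ⟨⟨e.1, h (fst_mem_ends he)⟩, ⟨e.2, h (snd_mem_ends he)⟩, he, rfl⟩

lemma hw_resE (t : ℝ) {W : Finset V} {E : Finset (V × V)} (h : ends E ⊆ W) (a b : W) :
    hw t (resE W E) (pr a b) = hw t E (pr (a : V) b) := by
  conv_rhs => rw [← image_resE h]
  exact (hw_image t Subtype.val_injective (resE W E) a b).symm

lemma hw_resE_zero (t : ℝ) {W : Finset V} {E : Finset (V × V)} (h : ends E ⊆ W) (a : W) :
    hw t (resE W E) 0 = hw t E 0 := by
  rw [← pr_self a, hw_resE t h, pr_self]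

lemma ends_mono {S E : Finset (V × V)} (h : S ⊆ E) : ends S ⊆ ends E :=
  Finset.union_subset_union (Finset.image_subset_image h) (Finset.image_subset_image h)

variable {t : ℝ}

lemma hw_nonneg (ht : 0 ≤ t) (E : Finset (V × V)) (d : V → ZMod 2) : 0 ≤ hw t E d :=
  Finset.sum_nonneg fun _ _ => pow_nonneg ht _

lemma one_le_hw_zero (ht : 0 ≤ t) (E : Finset (V × V)) : 1 ≤ hw t E 0 := by
  classical
  have : t ^ (∅ : Finset (V × V)).card ≤ hw t E 0 := by
    refine Finset.single_le_sum (f := fun F : Finset (V × V) => t ^ F.card)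
      (fun _ _ => pow_nonneg ht _) ?_
    exact Finset.mem_filter.2 ⟨Finset.empty_mem_powerset _, by simp [par]⟩
  simpa using this

lemma hw_zero_pos (ht : 0 ≤ t) (E : Finset (V × V)) : 0 < hw t E 0 :=
  zero_lt_one.trans_le (one_le_hw_zero ht E)

lemma hw_griffiths (ht : 0 ≤ t) (ht1 : t ≤ 1) {E S : Finset (V × V)} (h : S ⊆ E)
    (a b c : V) : hw t E (pr a b) * hw t S (pr b c) ≤ hw t E (pr a c) * hw t S 0 := by
  set W : Finset V := ends E ∪ {a, b, c} with hW
  have hE : ends E ⊆ W := Finset.subset_union_left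
  have hS : ends S ⊆ W := (ends_mono h).trans hE
  have hres : resE W S ⊆ resE W E := Finset.monotone_filter_right _ fun e _ he => h he
  have ha : a ∈ W := by simp [hW]
  have hb : b ∈ W := by simp [hW]
  have hc : c ∈ W := by simp [hW]
  have := sz_griffiths ht ht1 hres (pr ⟨a, ha⟩ ⟨b, hb⟩) (pr ⟨b, hb⟩ ⟨c, hc⟩)
  rw [pr_add] at this
  simp only [sz_eq, hw_resE t hE, hw_resE t hS, hw_resE_zero t hS ⟨a, ha⟩] at this
  have hpos : (0 : ℝ) < 2 ^ Fintype.card W * 2 ^ Fintype.card W := by positivity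
  exact le_of_mul_le_mul_left (by linarith) hpos

lemma corr_nonneg (ht : 0 ≤ t) (E : Finset (V × V)) (a b : V) : 0 ≤ corr t E a b :=
  div_nonneg (hw_nonneg ht _ _) (hw_nonneg ht _ _)

lemma corr_self (ht : 0 ≤ t) (E : Finset (V × V)) (a : V) : corr t E a a = 1 := by
  rw [corr, pr_self, div_self (hw_zero_pos ht E).ne']

lemma corr_comm (t : ℝ) (E : Finset (V × V)) (a b : V) : corr t E a b = corr t E b a := by
  rw [corr, corr, pr_comm]

lemma corr_mono (ht : 0 ≤ t) (ht1 : t ≤ 1) {E S : Finset (V × V)} (h : S ⊆ E) (a b : V) :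
    corr t S a b ≤ corr t E a b := by
  rw [corr, corr, div_le_div_iff₀ (hw_zero_pos ht S) (hw_zero_pos ht E)]
  have := hw_griffiths ht ht1 h a a b
  rw [pr_self] at this
  linarith

lemma corr_mul_le (ht : 0 ≤ t) (ht1 : t ≤ 1) (E : Finset (V × V)) (a b c : V) :
    corr t E a b * corr t E b c ≤ corr t E a c := by
  have h0 := hw_zero_pos ht E
  rw [corr, corr, corr, div_mul_div_comm, div_le_div_iff₀ (by positivity) h0]
  nlinarith [hw_griffiths ht ht1 (Finset.Subset.refl E) a b c]

lemma corr_le_one (ht : 0 ≤ t) (ht1 : t ≤ 1) (E : Finset (V × V)) (a b : V) :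
    corr t E a b ≤ 1 := by
  have := corr_mul_le ht ht1 E a b a
  rw [corr_comm t E b a, corr_self ht] at this
  nlinarith [corr_nonneg ht E a b]

lemma le_corr_of_mem (ht : 0 ≤ t) (ht1 : t ≤ 1) {E : Finset (V × V)} {a b : V}
    (he : (a, b) ∈ E) : t ≤ corr t E a b := by
  classical
  by_cases hab : a = b
  · subst hab; rwa [corr_self ht]
  refine le_trans ?_ (corr_mono ht ht1 (Finset.singleton_subset_iff.2 he) a b)
  have h0 : pr a b ≠ 0 := by
    intro h
    have := congrFun h a
    simp [pr, hab] at this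
  have hne : (∅ : Finset (V × V)) ≠ {(a, b)} := (Finset.singleton_ne_empty _).symm
  have hps : ({(a, b)} : Finset (V × V)).powerset = {∅, {(a, b)}} := by
    ext F; simp [Finset.subset_singleton_iff]
  have h1 : hw t {(a, b)} 0 = 1 := by
    rw [hw, Finset.sum_filter, hps, Finset.sum_pair hne]
    simp [par, h0]
  have h2 : hw t {(a, b)} (pr a b) = t := by
    rw [hw, Finset.sum_filter, hps, Finset.sum_pair hne]
    simp [par, h0.symm]
  rw [corr, h1, h2, div_one]

lemma corr_eq_zero (E : Finset (V × V)) (U : V → Prop) (hU : ∀ e ∈ E, U e.1 ↔ U e.2)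
    {a b : V} (ha : U a) (hb : ¬ U b) : corr t E a b = 0 := by
  classical
  rw [corr, hw, Finset.sum_eq_zero, zero_div]
  intro F hF
  exfalso
  rw [Finset.mem_filter, Finset.mem_powerset] at hF
  set W := (ends E ∪ {a}).filter U
  have hs : ∀ x y : V, ∑ v ∈ W, pr x y v = (if x ∈ W then 1 else 0) + (if y ∈ W then 1 else 0) := by
    intro x y
    simp [pr, Finset.sum_add_distrib, Pi.single_apply]
  have h1 : ∑ v ∈ W, par F v = 0 := by
    simp only [par, Finset.sum_apply]
    rw [Finset.sum_comm]
    refine Finset.sum_eq_zero fun e he => ?_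
    have he := hF.1 he
    rw [hs]
    have : e.1 ∈ W ↔ e.2 ∈ W := by
      simp [W, fst_mem_ends he, snd_mem_ends he, hU e he]
    simp only [this]
    exact zmod2_add_self _
  rw [hF.2, hs, if_pos (by simp [W, ha]), if_neg (by simp [W, hb])] at h1
  exact absurd h1 (by decide)

/-- The Simon–Lieb inequality. -/
lemma simon_lieb (ht : 0 ≤ t) (ht1 : t ≤ 1) {E S : Finset (V × V)} (h : S ⊆ E) (a b : V) :
    corr t E a b - corr t S a b ≤ t * ∑ e ∈ E \ S,
      (corr t S a e.1 * corr t E e.2 b + corr t S a e.2 * corr t E e.1 b) := by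
  set W : Finset V := ends E ∪ {a, b} with hW
  have hE : ends E ⊆ W := Finset.subset_union_left
  have hS : ends S ⊆ W := (ends_mono h).trans hE
  have hres : resE W S ⊆ resE W E := Finset.monotone_filter_right _ fun e _ he => h he
  have ha : a ∈ W := by simp [hW]
  have hb : b ∈ W := by simp [hW]
  have := sz_simon_lieb ht ht1 hres ⟨a, ha⟩ ⟨b, hb⟩
  simp only [sz_eq, hw_resE t hE, hw_resE t hS, hw_resE_zero t hS ⟨a, ha⟩,
    hw_resE_zero t hE ⟨a, ha⟩] at this
  have hsum : ∑ e ∈ E \ S, (hw t S (pr a e.1) * hw t E (pr e.2 b) +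
      hw t S (pr a e.2) * hw t E (pr e.1 b)) = ∑ e ∈ resE W E \ resE W S,
      (hw t S (pr a (e.1 : V)) * hw t E (pr (e.2 : V) b) +
      hw t S (pr a (e.2 : V)) * hw t E (pr (e.1 : V) b)) := by
    have hd : (resE W E \ resE W S).image (Prod.map Subtype.val Subtype.val) = E \ S := by
      rw [Finset.image_sdiff _ _ (Subtype.val_injective.prodMap Subtype.val_injective),
        image_resE hE, image_resE hS]
    rw [← hd, Finset.sum_image]
    · rfl
    · intro x _ y _ hxy
      exact (Subtype.val_injective.prodMap Subtype.val_injective) hxy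
  have hp : (0 : ℝ) < 2 ^ Fintype.card W * 2 ^ Fintype.card W := by positivity
  have h2 : hw t E (pr a b) * hw t S 0 - hw t E 0 * hw t S (pr a b) ≤
      t * ∑ e ∈ E \ S, (hw t S (pr a e.1) * hw t E (pr e.2 b) +
      hw t S (pr a e.2) * hw t E (pr e.1 b)) := by
    rw [hsum]
    refine le_of_mul_le_mul_left ?_ hp
    rw [Finset.mul_sum] at this ⊢
    rw [Finset.mul_sum]
    refine (le_of_eq (by ring)).trans (this.trans (le_of_eq ?_))
    refine Finset.sum_congr rfl fun e _ => ?_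
    ring
  have hE0 := hw_zero_pos ht E
  have hS0 := hw_zero_pos ht S
  have h3 := div_le_div_of_nonneg_right h2 (mul_pos hE0 hS0).le
  refine (le_of_eq ?_).trans (h3.trans (le_of_eq ?_))
  · simp only [corr]; field_simp
  · rw [mul_div_assoc, Finset.sum_div]
    congr 1
    refine Finset.sum_congr rfl fun e _ => ?_
    simp only [corr]; field_simp

end Transfer
end Graph
end

noncomputable section
set_option linter.unusedSectionVars false

/-- Spectral theorem for a symmetric endomorphism of `n → ℝ`. -/
lemma exists_eigenbasis {n : Type*} [Fintype n] [DecidableEq n] (L : (n → ℝ) →ₗ[ℝ] (n → ℝ))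
    (hL : ∀ f g, f ⬝ᵥ L g = L f ⬝ᵥ g) :
    ∃ (lam : n → ℝ) (v : n → n → ℝ), (∀ i, L (v i) = lam i • v i) ∧
      (∀ i j, v i ⬝ᵥ v j = if i = j then 1 else 0) ∧ ∀ f, f = ∑ i, (v i ⬝ᵥ f) • v i := by
  have hA : (LinearMap.toMatrix' L).IsHermitian := by
    ext i j
    have h := hL (Pi.single i 1) (Pi.single j 1)
    simp only [single_dotProduct, dotProduct_single, one_mul, mul_one] at h
    simp [Matrix.conjTranspose_apply, LinearMap.toMatrix'_apply, h]
  refine ⟨hA.eigenvalues, fun i => WithLp.ofLp (hA.eigenvectorBasis i), fun i => ?_,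
    fun i j => ?_, fun f => ?_⟩
  · rw [← LinearMap.toMatrix'_mulVec]
    exact hA.mulVec_eigenvectorBasis i
  · have := orthonormal_iff_ite.1 hA.eigenvectorBasis.orthonormal i j
    rw [← this, EuclideanSpace.inner_eq_star_dotProduct]
    simp [dotProduct_comm]
  · have := hA.eigenvectorBasis.sum_repr' (WithLp.toLp 2 f)
    have h2 := congrArg WithLp.ofLp this
    conv_lhs => rw [show f = WithLp.ofLp (WithLp.toLp 2 f) from rfl, ← h2]
    simp only [WithLp.ofLp_sum, WithLp.ofLp_smul]
    refine Finset.sum_congr rfl fun i _ => ?_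
    rw [EuclideanSpace.inner_eq_star_dotProduct]
    simp [dotProduct_comm]

namespace Transfer

/-- Configurations of a column. -/
abbrev Col (m : ℕ) := Fin (m + 1) → ZMod 2

/-- Index set of the fermionic generators. -/
abbrev Gen (m : ℕ) := Fin (m + 1) × Bool

variable {m : ℕ} {t : ℝ}

/-- The configuration that is `1` below height `l`. -/
def msk (m l : ℕ) : Col m := fun j => if (j : ℕ) < l then 1 else 0

/-- Height of the string of a generator. -/
def lev (i : Gen m) : ℕ := i.1 + if i.2 then 1 else 0

/-- The fermionic generators. -/
def fe (i : Gen m) : Module.End ℝ (Col m → ℝ) where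
  toFun f := fun c => sg (c i.1) * f (c + msk m (lev i))
  map_add' f g := by funext c; simp [mul_add]
  map_smul' a f := by funext c; simp; ring

lemma fe_apply (i : Gen m) (f : Col m → ℝ) (c : Col m) :
    fe i f c = sg (c i.1) * f (c + msk m (lev i)) := rfl

/-- Linear combinations of the generators. -/
def fg (u : Gen m → ℝ) : Module.End ℝ (Col m → ℝ) := ∑ i, u i • fe i

lemma fg_apply (u : Gen m → ℝ) (f : Col m → ℝ) : fg u f = ∑ i, u i • fe i f := by
  simp [fg]

lemma fg_smul (a : ℝ) (u : Gen m → ℝ) : fg (a • u) = a • fg u := by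
  simp [fg, Finset.smul_sum, smul_smul]

lemma fg_sum {ι : Type*} (s : Finset ι) (a : ι → ℝ) (u : ι → Gen m → ℝ) :
    fg (∑ k ∈ s, a k • u k) = ∑ k ∈ s, a k • fg (u k) := by
  simp only [fg, Finset.smul_sum, Finset.sum_apply, Finset.sum_smul, Pi.smul_apply, smul_smul,
    smul_eq_mul]
  exact Finset.sum_comm

lemma col_add_self (c : Col m) : c + c = 0 := funext fun _ => zmod2_add_self _

lemma sum_col_add (d : Col m) (f : Col m → ℝ) : ∑ c, f (c + d) = ∑ c, f c :=
  Fintype.sum_equiv (Equiv.addRight d) _ _ (fun _ => rfl)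

lemma sg_msk (l : ℕ) (j : Fin (m + 1)) : sg (msk m l j) = if (j : ℕ) < l then -1 else 1 := by
  unfold msk; split_ifs <;> simp [sg]

lemma sg_msk_lev (i : Gen m) : sg (msk m (lev i) i.1) = if i.2 then -1 else 1 := by
  rw [sg_msk]; rcases i with ⟨j, b⟩; cases b <;> simp [lev]

/-- The signature of a generator. -/
def sig (i : Gen m) : ℝ := if i.2 then -1 else 1

lemma fe_adj (i : Gen m) (f g : Col m → ℝ) : fe i f ⬝ᵥ g = sig i * (f ⬝ᵥ fe i g) := by
  simp only [dotProduct, fe_apply]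
  rw [← sum_col_add (msk m (lev i)), Finset.mul_sum]
  refine Finset.sum_congr rfl fun c _ => ?_
  rw [add_assoc, col_add_self, add_zero, Pi.add_apply, sg_add, sg_msk_lev, sig]
  ring

lemma fg_adj (u : Gen m → ℝ) (f g : Col m → ℝ) :
    fg u f ⬝ᵥ g = f ⬝ᵥ fg (sig * u) g := by
  rw [fg_apply, fg_apply, sum_dotProduct, dotProduct_sum]
  refine Finset.sum_congr rfl fun i _ => ?_
  rw [smul_dotProduct, dotProduct_smul, fe_adj, Pi.mul_apply, smul_eq_mul, smul_eq_mul]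
  ring

lemma fe_mul (i k : Gen m) : fe i * fe k + fe k * fe i = if i = k then (2 * sig i) • 1 else 0 := by
  refine LinearMap.ext fun f => funext fun c => ?_
  simp only [LinearMap.add_apply, Module.End.mul_apply, Pi.add_apply, fe_apply, sg_add, sg_msk]
  rw [add_right_comm c (msk m (lev k))]
  by_cases h : i = k
  · subst h
    rw [if_pos rfl]
    simp only [LinearMap.smul_apply, Module.End.one_apply, Pi.smul_apply, smul_eq_mul]
    rw [add_assoc c, col_add_self, add_zero]
    have := sg_mul_self (c i.1)
    have h2 : (if (i.1 : ℕ) < lev i then (-1 : ℝ) else 1) = sig i := by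
      rw [← sg_msk, sg_msk_lev, sig]
    rw [h2]
    linear_combination (2 * sig i * f c) * this
  · rw [if_neg h]
    have : (if (k.1 : ℕ) < lev i then (-1 : ℝ) else 1) =
        - (if (i.1 : ℕ) < lev k then (-1 : ℝ) else 1) := by
      rcases i with ⟨i, b⟩
      rcases k with ⟨k, b'⟩
      have h' : b = b' → (i : ℕ) ≠ k := by
        rintro rfl hik
        exact h (by rw [Fin.ext hik])
      cases b <;> cases b' <;> simp [lev] at h' ⊢ <;> split_ifs <;> first | omega | norm_num
    rw [this]
    simp only [LinearMap.zero_apply, Pi.zero_apply]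
    ring

lemma fg_mul (u w : Gen m → ℝ) : ∃ a : ℝ, fg u * fg w + fg w * fg u = a • 1 := by
  refine ⟨∑ i, ∑ k, u i * w k * (if i = k then 2 * sig i else 0), ?_⟩
  have h : ∀ u w : Gen m → ℝ, fg u * fg w = ∑ i, ∑ k, (u i * w k) • (fe i * fe k) := by
    intro u w
    simp only [fg, Finset.sum_mul_sum, smul_mul_smul_comm]
  rw [h, h, Finset.sum_comm (s := Finset.univ) (t := Finset.univ)
    (f := fun i k => (w i * u k) • (fe i * fe k)), ← Finset.sum_add_distrib, Finset.sum_smul]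
  refine Finset.sum_congr rfl fun i _ => ?_
  rw [← Finset.sum_add_distrib, Finset.sum_smul]
  refine Finset.sum_congr rfl fun k _ => ?_
  rw [mul_comm (w k), ← smul_add, fe_mul]
  split_ifs <;> simp [smul_smul]

/-- Swap of the two generators at the same height. -/
def swapA (i : Gen m) : Gen m := (i.1, !i.2)

lemma swapA_swapA (i : Gen m) : swapA (swapA i) = i := by simp [swapA]

/-- Swap of the two generators attached to the same vertical bond. -/
def swapB (i : Gen m) : Gen m :=
  if i.2 then (if h : (i.1 : ℕ) + 1 < m + 1 then (⟨i.1 + 1, h⟩, false) else i)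
  else (if (i.1 : ℕ) = 0 then i else (⟨i.1 - 1, by omega⟩, true))

/-- Whether a generator is not fixed by `swapB`. -/
def inner (i : Gen m) : Prop := 0 < lev i ∧ lev i < m + 1

instance (i : Gen m) : Decidable (inner i) := by unfold inner; infer_instance

lemma lev_swapB (i : Gen m) : lev (swapB i) = lev i := by
  rcases i with ⟨j, b⟩
  cases b
  · by_cases h : (j : ℕ) = 0
    · simp [swapB, h]
    · simp [swapB, h, lev]; omega
  · by_cases h : (j : ℕ) + 1 < m + 1
    · simp [swapB, h, lev]
    · simp [swapB, h]

lemma inner_swapB (i : Gen m) : inner (swapB i) ↔ inner i := by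
  simp [inner, lev_swapB]

lemma swapB_swapB (i : Gen m) : swapB (swapB i) = i := by
  rcases i with ⟨j, b⟩
  cases b
  · by_cases h : (j : ℕ) = 0
    · simp [swapB, h]
    · have : (j : ℕ) - 1 + 1 < m + 1 := by omega
      have h2 : (j : ℕ) - 1 + 1 = j := by omega
      simp [swapB, h, h2]; omega
  · by_cases h : (j : ℕ) + 1 < m + 1
    · simp [swapB, h]
    · have h2 : ¬ (j : ℕ) < m := by omega
      simp [swapB, h2]

lemma inner_fst (i : Gen m) (h : inner i) :
    ((i.1 : ℕ) + 1 = lev i ∧ ((swapB i).1 : ℕ) = lev i) ∨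
    ((i.1 : ℕ) = lev i ∧ ((swapB i).1 : ℕ) + 1 = lev i) := by
  rcases i with ⟨j, b⟩
  have h1 := h.1
  have h2 := h.2
  cases b <;> simp only [swapB, lev] at h1 h2 ⊢
  · right
    simp at h1 ⊢
    rw [if_neg (by rintro rfl; simp at h1)]
    simp; omega
  · left
    simp at h2 ⊢
    simp [h2]

/-- Generator rotation induced by the horizontal transfer operator. -/
def rotA (t : ℝ) (u : Gen m → ℝ) : Gen m → ℝ := fun i =>
  (t + 1 / t) / 2 * u i + (t - 1 / t) / 2 * u (swapA i)

/-- The square root of the ratio of vertical bond weights. -/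
def kap (t : ℝ) : ℝ := √(1 + t) / √(1 - t)

/-- Generator rotation induced by the vertical bond weights. -/
def rotB (t : ℝ) (u : Gen m → ℝ) : Gen m → ℝ := fun i =>
  if inner i then (kap t + 1 / kap t) / 2 * u i + (kap t - 1 / kap t) / 2 * u (swapB i) else u i

/-- Horizontal transfer kernel. -/
def bk (t : ℝ) (c d : Col m) : ℝ := ∏ j, (1 + t * sg (c j + d j))

/-- Horizontal transfer operator. -/
def bop (t : ℝ) : Module.End ℝ (Col m → ℝ) where
  toFun f := fun c => ∑ c', bk t c c' * f c'
  map_add' f g := by funext c; simp [mul_add, Finset.sum_add_distrib]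
  map_smul' a f := by funext c; simp [Finset.mul_sum]; congr 1; funext; ring

/-- Square root of the weight of the vertical bonds of a column. -/
def dh (t : ℝ) (c : Col m) : ℝ := ∏ j : Fin m, √(1 + t * sg (c j.castSucc + c j.succ))

/-- Multiplication by a function. -/
def mulOp (w : Col m → ℝ) : Module.End ℝ (Col m → ℝ) where
  toFun f := w * f
  map_add' f g := by simp [mul_add]
  map_smul' a f := by simp

/-- The symmetrised transfer operator. -/
def tv (t : ℝ) : Module.End ℝ (Col m → ℝ) := mulOp (dh t) * bop t * mulOp (dh t)

lemma bop_apply (f : Col m → ℝ) (c : Col m) : bop t f c = ∑ c', bk t c c' * f c' := rfl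

lemma bk_comm (c c' : Col m) : bk t c c' = bk t c' c := by simp [bk, add_comm]

lemma bk_shift (c c' d : Col m) : bk t c (c' + d) = bk t (c + d) c' := by
  simp only [bk, Pi.add_apply]
  refine Finset.prod_congr rfl fun j _ => ?_
  rw [add_assoc, add_comm (d j)]

lemma bop_fe (ht : t ≠ 0) (i : Gen m) :
    bop t * fe i = ((t + 1 / t) / 2) • (fe i * bop t) + ((t - 1 / t) / 2) • (fe (swapA i) * bop t)
    := by
  refine LinearMap.ext fun f => funext fun c => ?_
  simp only [LinearMap.add_apply, LinearMap.smul_apply, Module.End.mul_apply, Pi.add_apply,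
    Pi.smul_apply, fe_apply, bop_apply, smul_eq_mul]
  rw [← sum_col_add (msk m (lev i))]
  simp only [Finset.mul_sum]
  rw [← Finset.sum_add_distrib]
  refine Finset.sum_congr rfl fun c' _ => ?_
  rw [add_assoc, col_add_self, add_zero, Pi.add_apply, sg_add, sg_msk_lev, bk_shift]
  have hsplit : ∀ l, bk t (c + msk m l) c' = (1 + t * (sg (c i.1) * sg (msk m l i.1) *
      sg (c' i.1))) * ∏ k ∈ Finset.univ.erase i.1, (1 + t * sg (c k + msk m l k + c' k)) := by
    intro l
    rw [bk, ← Finset.mul_prod_erase _ _ (Finset.mem_univ i.1)]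
    simp only [Pi.add_apply, sg_add]
  have hrest : ∏ k ∈ Finset.univ.erase i.1, (1 + t * sg (c k + msk m (lev (swapA i)) k + c' k)) =
      ∏ k ∈ Finset.univ.erase i.1, (1 + t * sg (c k + msk m (lev i) k + c' k)) := by
    refine Finset.prod_congr rfl fun k hk => ?_
    have hk : (k : ℕ) ≠ i.1 := fun h => (Finset.mem_erase.1 hk).1 (Fin.ext h)
    have : msk m (lev (swapA i)) k = msk m (lev i) k := by
      have : ((k : ℕ) < lev (swapA i)) ↔ ((k : ℕ) < lev i) := by
        rcases i with ⟨j, b⟩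
        cases b <;> simp [lev, swapA] <;> simp at hk <;> omega
      simp only [msk, this]
    rw [this]
  have hs : sg (msk m (lev (swapA i)) i.1) = - sg (msk m (lev i) i.1) := by
    have := sg_msk_lev (swapA i)
    rw [show (swapA i).1 = i.1 from rfl] at this
    rw [this, sg_msk_lev]
    rcases i with ⟨j, b⟩; cases b <;> simp [swapA]
  rw [hsplit, hsplit, hrest, hs, sg_msk_lev, show (swapA i).1 = i.1 from rfl]
  rcases sg_eq (c i.1) with h1 | h1 <;> rcases sg_eq (c' i.1) with h2 | h2 <;>
    rcases i with ⟨j, b⟩ <;> cases b <;> simp only [h1, h2] <;> simp <;> field_simp <;> ring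

lemma dh_pos (ht : 0 < t) (ht1 : t < 1) (c : Col m) : 0 < dh t c := by
  refine Finset.prod_pos fun j _ => Real.sqrt_pos.2 ?_
  rcases sg_eq (c j.castSucc + c j.succ) with h | h <;> rw [h] <;> linarith

lemma kap_pos (ht : 0 < t) (ht1 : t < 1) : 0 < kap t :=
  div_pos (Real.sqrt_pos.2 (by linarith)) (Real.sqrt_pos.2 (by linarith))

lemma kap_sq (ht : 0 < t) (ht1 : t < 1) : kap t ^ 2 = (1 + t) / (1 - t) := by
  rw [kap, div_pow, Real.sq_sqrt (by linarith), Real.sq_sqrt (by linarith)]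

lemma one_le_kap (ht : 0 < t) (ht1 : t < 1) : 1 ≤ kap t := by
  have := kap_sq ht ht1
  have h2 : 1 ≤ (1 + t) / (1 - t) := by rw [one_le_div (by linarith)]; linarith
  have := kap_pos ht ht1
  nlinarith

lemma dh_msk_of_inner (ht : 0 < t) (ht1 : t < 1) (i : Gen m) (hi : inner i) (c : Col m) :
    dh t c = ((kap t + 1 / kap t) / 2 + (kap t - 1 / kap t) / 2 * (sg (c i.1) * sg (c (swapB i).1)))
      * dh t (c + msk m (lev i)) := by
  obtain ⟨h1, h2⟩ := hi
  obtain ⟨l, hl⟩ : ∃ l, lev i = l + 1 := ⟨lev i - 1, by omega⟩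
  have hlm : l < m := by omega
  have hx : sg (c i.1) * sg (c (swapB i).1) =
      sg (c (Fin.castSucc ⟨l, hlm⟩)) * sg (c (Fin.succ ⟨l, hlm⟩)) := by
    rcases inner_fst i ⟨h1, h2⟩ with h | h
    · rw [show i.1 = Fin.castSucc ⟨l, hlm⟩ from Fin.ext (by simp; omega),
        show (swapB i).1 = Fin.succ ⟨l, hlm⟩ from Fin.ext (by simp; omega)]
    · rw [show i.1 = Fin.succ ⟨l, hlm⟩ from Fin.ext (by simp; omega),
        show (swapB i).1 = Fin.castSucc ⟨l, hlm⟩ from Fin.ext (by simp; omega), mul_comm]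
  rw [hx, dh, dh, ← Finset.mul_prod_erase _ _ (Finset.mem_univ (⟨l, hlm⟩ : Fin m)),
    ← Finset.mul_prod_erase Finset.univ (fun j : Fin m => √(1 + t *
      sg ((c + msk m (lev i)) j.castSucc + (c + msk m (lev i)) j.succ)))
      (Finset.mem_univ (⟨l, hlm⟩ : Fin m))]
  have hrest : ∏ j ∈ Finset.univ.erase (⟨l, hlm⟩ : Fin m),
      √(1 + t * sg ((c + msk m (lev i)) j.castSucc + (c + msk m (lev i)) j.succ)) =
      ∏ j ∈ Finset.univ.erase (⟨l, hlm⟩ : Fin m), √(1 + t * sg (c j.castSucc + c j.succ)) := by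
    refine Finset.prod_congr rfl fun j hj => ?_
    have hj : (j : ℕ) ≠ l := fun h => (Finset.mem_erase.1 hj).1 (Fin.ext h)
    congr 4
    have : msk m (lev i) j.castSucc = msk m (lev i) j.succ := by
      have : ((j.castSucc : ℕ) < lev i) ↔ ((j.succ : ℕ) < lev i) := by
        rw [hl]; simp; omega
      simp only [msk, this]
    rw [Pi.add_apply, Pi.add_apply, this]
    linear_combination zmod2_add_self (msk m (lev i) j.succ)
  rw [hrest, ← mul_assoc]
  congr 1
  have e1 : msk m (lev i) (Fin.castSucc ⟨l, hlm⟩) = 1 := by simp [msk, hl]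
  have e2 : msk m (lev i) (Fin.succ ⟨l, hlm⟩) = 0 := by simp [msk, hl]
  simp only [Pi.add_apply, e1, e2, sg_add, sg_one, sg_zero]
  have hp := kap_pos ht ht1
  have p1 : 0 < √(1 + t) := Real.sqrt_pos.2 (by linarith)
  have p2 : 0 < √(1 - t) := Real.sqrt_pos.2 (by linarith)
  rcases sg_eq (c (Fin.castSucc ⟨l, hlm⟩)) with h1 | h1 <;>
    rcases sg_eq (c (Fin.succ ⟨l, hlm⟩)) with h2 | h2 <;> rw [h1, h2] <;>
    simp only [kap, mul_one, mul_neg, neg_neg, ← sub_eq_add_neg] <;>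
    field_simp <;> ring

lemma dh_add_const (c : Col m) (d : Col m) (hd : ∀ j j', d j = d j') : dh t (c + d) = dh t c := by
  refine Finset.prod_congr rfl fun j _ => ?_
  congr 4
  rw [Pi.add_apply, Pi.add_apply, hd j.succ j.castSucc]
  linear_combination zmod2_add_self (d j.castSucc)

lemma dh_fe (ht : 0 < t) (ht1 : t < 1) (i : Gen m) : mulOp (dh t) * fe i =
    if inner i then ((kap t + 1 / kap t) / 2) • (fe i * mulOp (dh t)) +
      ((kap t - 1 / kap t) / 2) • (fe (swapB i) * mulOp (dh t)) else fe i * mulOp (dh t) := by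
  refine LinearMap.ext fun f => funext fun c => ?_
  split_ifs with hi
  · simp only [LinearMap.add_apply, LinearMap.smul_apply, Module.End.mul_apply, Pi.add_apply,
      Pi.smul_apply, fe_apply, mulOp, smul_eq_mul, LinearMap.coe_mk, AddHom.coe_mk, Pi.mul_apply,
      lev_swapB]
    rw [dh_msk_of_inner ht ht1 i hi c]
    have := sg_mul_self (c i.1)
    linear_combination ((kap t - 1 / kap t) / 2 * sg (c (swapB i).1) * dh t (c + msk m (lev i)) *
      f (c + msk m (lev i))) * this
  · simp only [Module.End.mul_apply, fe_apply, mulOp, LinearMap.coe_mk, AddHom.coe_mk, Pi.mul_apply]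
    have : dh t (c + msk m (lev i)) = dh t c := by
      refine dh_add_const c _ fun j j' => ?_
      have : ∀ j : Fin (m + 1), ((j : ℕ) < lev i) ↔ ((0 : ℕ) < lev i) := by
        intro j
        rw [inner] at hi
        omega
      simp only [msk, this]
    rw [this]; ring

lemma bop_fg (ht : t ≠ 0) (u : Gen m → ℝ) : bop t * fg u = fg (rotA t u) * bop t := by
  have hsw : ∑ i, u i • fe (swapA i) = ∑ i, u (swapA i) • fe i := by
    refine Fintype.sum_equiv (⟨swapA, swapA, swapA_swapA, swapA_swapA⟩ : Equiv.Perm (Gen m)) _ _ ?_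
    intro i; simp [swapA_swapA]
  have h1 : bop t * fg u = ((t + 1 / t) / 2) • (∑ i, u i • fe i) * bop t +
      ((t - 1 / t) / 2) • (∑ i, u i • fe (swapA i)) * bop t := by
    simp only [fg, Finset.mul_sum, mul_smul_comm, bop_fe ht, Finset.smul_sum, Finset.sum_mul,
      ← Finset.sum_add_distrib, smul_mul_assoc, smul_add]
    refine Finset.sum_congr rfl fun i _ => ?_
    rw [smul_comm (u i), smul_comm (u i)]
  rw [h1, hsw, ← add_mul]
  congr 1
  simp only [fg, rotA, Finset.smul_sum, ← Finset.sum_add_distrib, add_smul, smul_smul]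

lemma dh_fg (ht : 0 < t) (ht1 : t < 1) (u : Gen m → ℝ) :
    mulOp (dh t) * fg u = fg (rotB t u) * mulOp (dh t) := by
  set p := (kap t + 1 / kap t) / 2
  set q := (kap t - 1 / kap t) / 2
  have hsw : ∑ i, (if inner i then q * u i else 0) • fe (swapB i) =
      ∑ i, (if inner i then q * u (swapB i) else 0) • fe i := by
    refine Fintype.sum_equiv (⟨swapB, swapB, swapB_swapB, swapB_swapB⟩ : Equiv.Perm (Gen m)) _ _ ?_
    intro i; simp [swapB_swapB, inner_swapB]
  have h1 : mulOp (dh t) * fg u = (∑ i, (if inner i then p * u i else u i) • fe i) * mulOp (dh t) +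
      (∑ i, (if inner i then q * u i else 0) • fe (swapB i)) * mulOp (dh t) := by
    simp only [fg, Finset.mul_sum, mul_smul_comm, dh_fe ht ht1, Finset.sum_mul,
      ← Finset.sum_add_distrib, smul_mul_assoc]
    refine Finset.sum_congr rfl fun i _ => ?_
    split_ifs
    · rw [smul_add, smul_smul, smul_smul, mul_comm p, mul_comm q]
    · simp
  rw [h1, hsw, ← add_mul]
  congr 1
  simp only [fg, rotB, ← Finset.sum_add_distrib, ← add_smul]
  refine Finset.sum_congr rfl fun i _ => ?_
  split_ifs <;> simp [p, q]

/-- The generator rotation induced by the symmetrised transfer operator. -/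
def rot (t : ℝ) (u : Gen m → ℝ) : Gen m → ℝ := rotB t (rotA t (rotB t u))

lemma tv_fg (ht : 0 < t) (ht1 : t < 1) (u : Gen m → ℝ) : tv t * fg u = fg (rot t u) * tv t := by
  rw [tv, mul_assoc, dh_fg ht ht1, mul_assoc, ← mul_assoc (bop t), bop_fg ht.ne',
    mul_assoc, ← mul_assoc, dh_fg ht ht1, rot]
  simp only [mul_assoc]

end Transfer
end

noncomputable section
set_option linter.unusedSectionVars false
namespace Transfer
variable {m : ℕ} {t : ℝ}

lemma sum_swapA (f : Gen m → ℝ) : ∑ i, f (swapA i) = ∑ i, f i :=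
  Fintype.sum_equiv (⟨swapA, swapA, swapA_swapA, swapA_swapA⟩ : Equiv.Perm (Gen m)) _ _
    (fun _ => rfl)

lemma sum_swapB (f : Gen m → ℝ) : ∑ i, f (swapB i) = ∑ i, f i :=
  Fintype.sum_equiv (⟨swapB, swapB, swapB_swapB, swapB_swapB⟩ : Equiv.Perm (Gen m)) _ _
    (fun _ => rfl)

lemma rotA_symm (u w : Gen m → ℝ) : u ⬝ᵥ rotA t w = rotA t u ⬝ᵥ w := by
  have h := sum_swapA (fun i => u i * w (swapA i))
  simp only [swapA_swapA] at h
  have e1 : ∀ i, u i * rotA t w i = (t + 1 / t) / 2 * (u i * w i) +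
      (t - 1 / t) / 2 * (u i * w (swapA i)) := by
    intro i; simp only [rotA]; ring
  have e2 : ∀ i, rotA t u i * w i = (t + 1 / t) / 2 * (u i * w i) +
      (t - 1 / t) / 2 * (u (swapA i) * w i) := by
    intro i; simp only [rotA]; ring
  simp only [dotProduct, e1, e2, Finset.sum_add_distrib, ← Finset.mul_sum, h]

lemma rotB_symm (u w : Gen m → ℝ) : u ⬝ᵥ rotB t w = rotB t u ⬝ᵥ w := by
  have h := sum_swapB (fun i => if inner i then u i * w (swapB i) else 0)
  simp only [swapB_swapB, inner_swapB] at h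
  have e1 : ∀ i, u i * rotB t w i = (if inner i then (kap t + 1 / kap t) / 2 * (u i * w i) else
      u i * w i) + (kap t - 1 / kap t) / 2 * (if inner i then u i * w (swapB i) else 0) := by
    intro i; simp only [rotB]; split_ifs <;> ring
  have e2 : ∀ i, rotB t u i * w i = (if inner i then (kap t + 1 / kap t) / 2 * (u i * w i) else
      u i * w i) + (kap t - 1 / kap t) / 2 * (if inner i then u (swapB i) * w i else 0) := by
    intro i; simp only [rotB]; split_ifs <;> ring
  simp only [dotProduct, e1, e2, Finset.sum_add_distrib, ← Finset.mul_sum, h]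

/-- Conjugation by the signature inverts the rotations. -/
lemma rotA_sig (ht : 0 < t) (u : Gen m → ℝ) : rotA t (sig * rotA t u) = sig * u := by
  funext i
  have h : sig (swapA i) = - sig i := by
    rcases i with ⟨j, b⟩; cases b <;> simp [sig, swapA]
  simp only [rotA, Pi.mul_apply, swapA_swapA, h]
  field_simp
  ring

lemma sig_swapB (i : Gen m) (hi : inner i) : sig (swapB i) = - sig i := by
  rcases i with ⟨j, b⟩
  obtain ⟨h1, h2⟩ := hi
  cases b <;> simp only [swapB, sig, lev] at *
  · simp at h1
    have : (j : ℕ) ≠ 0 := by rintro h; exact h1.ne' (Fin.ext h)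
    simp [this]
  · simp at h2
    simp [h2]

lemma rotB_sig (ht : 0 < t) (ht1 : t < 1) (u : Gen m → ℝ) :
    rotB t (sig * rotB t u) = sig * u := by
  funext i
  have hk := kap_pos ht ht1
  simp only [rotB, Pi.mul_apply, swapB_swapB, inner_swapB]
  split_ifs with hi
  · rw [sig_swapB i hi]
    field_simp
    ring
  · rfl

lemma rot_sig (ht : 0 < t) (ht1 : t < 1) (u : Gen m → ℝ) :
    rot t (sig * rot t u) = sig * u := by
  rw [rot, rot, rotB_sig ht ht1, rotA_sig ht, rotB_sig ht ht1]

/-- `rot` as a linear map. -/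
def rotL (t : ℝ) : Module.End ℝ (Gen m → ℝ) where
  toFun := rot t
  map_add' f g := by
    funext i; simp only [rot, rotB, rotA, Pi.add_apply]; split_ifs <;> ring
  map_smul' a f := by
    funext i; simp only [rot, rotB, rotA, Pi.smul_apply, smul_eq_mul, RingHom.id_apply]
    split_ifs <;> ring

lemma rotL_symm (u w : Gen m → ℝ) : u ⬝ᵥ rotL t w = rotL t u ⬝ᵥ w := by
  show u ⬝ᵥ rot t w = rot t u ⬝ᵥ w
  rw [rot, rotB_symm, rotA_symm, rotB_symm, rot]

/-- Symmetric part. -/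
def symA (w : Gen m → ℝ) : Gen m → ℝ := fun i => (w i + w (swapA i)) / 2
/-- Antisymmetric part. -/
def antA (w : Gen m → ℝ) : Gen m → ℝ := fun i => (w i - w (swapA i)) / 2

lemma sym_add_ant (w : Gen m → ℝ) : symA w + antA w = w := by
  funext i; simp only [symA, antA, Pi.add_apply]; ring

lemma sym_dot_ant (u w : Gen m → ℝ) : symA u ⬝ᵥ antA w = 0 := by
  have h := sum_swapA (fun i => symA u i * antA w i)
  have : ∀ i, symA u (swapA i) * antA w (swapA i) = - (symA u i * antA w i) := by
    intro i; simp only [symA, antA, swapA_swapA]; ring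
  simp only [this, Finset.sum_neg_distrib] at h
  simp only [dotProduct]
  linarith

lemma rotA_eq (ht : 0 < t) (v : Gen m → ℝ) : rotA t v = t • symA v + (1 / t) • antA v := by
  funext i
  simp only [rotA, symA, antA, Pi.add_apply, Pi.smul_apply, smul_eq_mul]
  field_simp; ring

lemma dot_self_nonneg {n : Type*} [Fintype n] (u : n → ℝ) : 0 ≤ u ⬝ᵥ u :=
  Finset.sum_nonneg fun _ _ => mul_self_nonneg _

lemma dot_self_eq_zero {n : Type*} [Fintype n] {u : n → ℝ} (h : u ⬝ᵥ u = 0) : u = 0 :=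
  dotProduct_self_eq_zero.1 h

lemma rotB_norm_bounds (ht : 0 < t) (ht1 : t < 1) (w : Gen m → ℝ) :
    rotB t w ⬝ᵥ rotB t w ≤ kap t ^ 2 * (w ⬝ᵥ w) ∧
    w ⬝ᵥ w ≤ kap t ^ 2 * (rotB t w ⬝ᵥ rotB t w) := by
  have hk := kap_pos ht ht1
  have hk1 := one_le_kap ht ht1
  have key : ∀ i, (rotB t w i) * (rotB t w i) + (rotB t w (swapB i)) * (rotB t w (swapB i)) ≤
      kap t ^ 2 * (w i * w i + w (swapB i) * w (swapB i)) ∧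
      w i * w i + w (swapB i) * w (swapB i) ≤ kap t ^ 2 *
      ((rotB t w i) * (rotB t w i) + (rotB t w (swapB i)) * (rotB t w (swapB i))) := by
    intro i
    simp only [rotB, swapB_swapB, inner_swapB]
    generalize w i = x
    generalize w (swapB i) = y
    split_ifs with hi
    · generalize hkk : kap t = k at *
      have e : ((k + 1 / k) / 2 * x + (k - 1 / k) / 2 * y) *
          ((k + 1 / k) / 2 * x + (k - 1 / k) / 2 * y) +
          ((k + 1 / k) / 2 * y + (k - 1 / k) / 2 * x) *
          ((k + 1 / k) / 2 * y + (k - 1 / k) / 2 * x) =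
          k ^ 2 * (x + y) ^ 2 / 2 + (x - y) ^ 2 / (2 * k ^ 2) := by
        field_simp; ring
      rw [e]
      have hk2 : 1 ≤ k ^ 2 := by nlinarith
      have h3 : 1 / (k ^ 2) ≤ 1 := by rw [div_le_one (by positivity)]; exact hk2
      have h4 : k ^ 2 * (1 / k ^ 2) = 1 := by field_simp
      have e2 : (x - y) ^ 2 / (2 * k ^ 2) = (1 / k ^ 2) * (x - y) ^ 2 / 2 := by field_simp
      rw [e2]
      generalize 1 / k ^ 2 = r at *
      constructor
      · nlinarith [sq_nonneg (x - y), mul_nonneg (sub_nonneg.2 (h3.trans hk2)) (sq_nonneg (x - y))]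
      · have e3 : k ^ 2 * (k ^ 2 * (x + y) ^ 2 / 2 + r * (x - y) ^ 2 / 2) =
            (k ^ 2 * k ^ 2) * (x + y) ^ 2 / 2 + (x - y) ^ 2 / 2 := by
          linear_combination ((x - y) ^ 2 / 2) * h4
        rw [e3]
        have : 1 ≤ k ^ 2 * k ^ 2 := by nlinarith
        nlinarith [mul_nonneg (sub_nonneg.2 this) (sq_nonneg (x + y))]
    · have hk2 : 1 ≤ kap t ^ 2 := by nlinarith
      constructor <;> nlinarith [mul_self_nonneg x, mul_self_nonneg y,
        mul_nonneg (sub_nonneg.2 hk2) (add_nonneg (mul_self_nonneg x) (mul_self_nonneg y))]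
  have h1 := Finset.sum_le_sum fun i (_ : i ∈ Finset.univ) => (key i).1
  have h2 := Finset.sum_le_sum fun i (_ : i ∈ Finset.univ) => (key i).2
  simp only [← Finset.mul_sum, Finset.sum_add_distrib,
    sum_swapB (fun i => w i * w i), sum_swapB (fun i => rotB t w i * rotB t w i)] at h1 h2
  simp only [dotProduct]
  constructor <;> linarith

/-- The gap parameter. -/
def rho (t : ℝ) : ℝ := t * (1 + t) / (1 - t)

lemma rho_pos (ht : 0 < t) (ht1 : t < 1) : 0 < rho t :=
  div_pos (by positivity) (by linarith)

lemma rho_lt_one (ht : 0 < t) (h : t ^ 2 + 2 * t < 1) : rho t < 1 := by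
  rw [rho, div_lt_one (by nlinarith)]; nlinarith

lemma rho_eq (ht : 0 < t) (ht1 : t < 1) : rho t = t * kap t ^ 2 := by
  rw [kap_sq ht ht1, rho]; ring

/-- The spectrum of the rotation is nonnegative with a gap around one. -/
lemma rot_gap (ht : 0 < t) (ht1 : t < 1) {r : ℝ} {u : Gen m → ℝ} (hu : u ≠ 0)
    (h : rot t u = r • u) : 0 < r ∧ (r ≤ rho t ∨ 1 / rho t ≤ r) := by
  set v := rotB t u with hv
  set w := rotA t v with hw
  have hwe : w = t • symA v + (1 / t) • antA v := rotA_eq ht v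
  set S := symA v ⬝ᵥ symA v with hS
  set A := antA v ⬝ᵥ antA v with hA
  have hS0 : 0 ≤ S := dot_self_nonneg _
  have hA0 : 0 ≤ A := dot_self_nonneg _
  have hsa : symA v ⬝ᵥ antA v = 0 := sym_dot_ant v v
  have has : antA v ⬝ᵥ symA v = 0 := by rw [dotProduct_comm, hsa]
  have hv0 : v ≠ 0 := by
    intro h0
    have h1 := rotB_sig ht ht1 u
    rw [← hv, h0, mul_zero] at h1
    apply hu
    funext i
    have h2 := congrFun h1 i
    have h3 : sig i ≠ 0 := by unfold sig; split_ifs <;> norm_num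
    have h4 : rotB t (0 : Gen m → ℝ) i = 0 := by simp [rotB]
    rw [h4, Pi.mul_apply] at h2
    exact (mul_eq_zero.1 h2.symm).resolve_left h3
  have hSA : 0 < S ∨ 0 < A := by
    by_contra! hc
    have h1 : symA v = 0 := dot_self_eq_zero (le_antisymm hc.1 hS0)
    have h2 : antA v = 0 := dot_self_eq_zero (le_antisymm hc.2 hA0)
    apply hv0
    rw [← sym_add_ant v, h1, h2, add_zero]
  have huu : 0 < u ⬝ᵥ u := lt_of_le_of_ne (dot_self_nonneg u) fun h0 => hu (dot_self_eq_zero h0.symm)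
  have hr : 0 < r := by
    have e : u ⬝ᵥ rot t u = t * S + 1 / t * A := by
      rw [rot, rotB_symm, ← hv, ← hw, hwe, dotProduct_add, dotProduct_smul, dotProduct_smul]
      conv_lhs => rw [← sym_add_ant v]
      have hs2 : symA (symA v + antA v) = symA v := by rw [sym_add_ant]
      have hs3 : antA (symA v + antA v) = antA v := by rw [sym_add_ant]
      rw [hs2, hs3, add_dotProduct, add_dotProduct, has, hsa]
      simp [hS, hA]
    rw [h, dotProduct_smul, smul_eq_mul] at e
    have : 0 < r * (u ⬝ᵥ u) := by
      rw [e]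
      rcases hSA with h | h
      · exact add_pos_of_pos_of_nonneg (by positivity) (by positivity)
      · exact add_pos_of_nonneg_of_pos (by positivity) (by positivity)
    exact pos_of_mul_pos_left this huu.le
  refine ⟨hr, ?_⟩
  by_contra! hc
  obtain ⟨hc1, hc2⟩ := hc
  have hrho := rho_pos ht ht1
  have hk := kap_pos ht ht1
  have hBw : rotB t w = r • u := h
  have hadd : ∀ x y : Gen m → ℝ, rotB t (x + y) = rotB t x + rotB t y := by
    intro x y; funext i; simp only [rotB, Pi.add_apply]; split_ifs <;> ring
  have hsmul : ∀ (a : ℝ) (x : Gen m → ℝ), rotB t (a • x) = a • rotB t x := by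
    intro a x; funext i; simp only [rotB, Pi.smul_apply, smul_eq_mul]; split_ifs <;> ring
  set x := t • symA v with hx
  set y := (1 / t) • antA v with hy
  have e1 : (y - x) ⬝ᵥ rotB t (rotB t w) = rotB t y ⬝ᵥ rotB t y - rotB t x ⬝ᵥ rotB t x := by
    rw [rotB_symm, hwe, hadd, sub_eq_add_neg, hadd, ← neg_one_smul ℝ x, hsmul (-1) x]
    generalize rotB t y = y'
    generalize rotB t x = x'
    simp only [add_dotProduct, dotProduct_add, smul_dotProduct, smul_eq_mul]
    rw [dotProduct_comm y' x']
    ring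
  have e2 : (y - x) ⬝ᵥ rotB t (rotB t w) = r * (1 / t * A - t * S) := by
    rw [hBw, hsmul, ← hv, dotProduct_smul, smul_eq_mul]
    congr 1
    conv_lhs => rw [← sym_add_ant v]
    rw [hx, hy, sub_dotProduct, dotProduct_add, dotProduct_add, smul_dotProduct, smul_dotProduct,
      smul_dotProduct, smul_dotProduct, hsa, has]
    simp [hS, hA]
  have b1 := (rotB_norm_bounds ht ht1 y).2
  have b2 := (rotB_norm_bounds ht ht1 x).1
  have hxx : x ⬝ᵥ x = t ^ 2 * S := by
    rw [hx, smul_dotProduct, dotProduct_smul, smul_eq_mul, smul_eq_mul, hS]; ring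
  have hyy : y ⬝ᵥ y = 1 / t ^ 2 * A := by
    rw [hy, smul_dotProduct, dotProduct_smul, smul_eq_mul, smul_eq_mul, hA]; field_simp
  rw [hyy] at b1
  rw [hxx] at b2
  have e3 := e1.symm.trans e2
  have hrk : t * kap t ^ 2 < r := by rw [← rho_eq ht ht1]; exact hc1
  have hrk2 : r * (t * kap t ^ 2) < 1 := by
    rw [← rho_eq ht ht1]; rwa [lt_div_iff₀ hrho] at hc2
  have hX : rotB t x ⬝ᵥ rotB t x ≤ t * (t * kap t ^ 2) * S := b2.trans_eq (by ring)
  have hY : A ≤ t * (t * kap t ^ 2) * (rotB t y ⬝ᵥ rotB t y) := by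
    have := mul_le_mul_of_nonneg_left b1 (sq_nonneg t)
    have e : t ^ 2 * (1 / t ^ 2 * A) = A := by field_simp
    rw [e] at this
    exact this.trans_eq (by ring)
  have hq : 0 < t * kap t ^ 2 := by positivity
  have e4 : t * (rotB t y ⬝ᵥ rotB t y) - t * (rotB t x ⬝ᵥ rotB t x) = r * (A - t ^ 2 * S) := by
    rw [← mul_sub, e3]; field_simp
  have hS2 : 0 ≤ t ^ 2 * S := by positivity
  have hX2 := mul_le_mul_of_nonneg_left hX ht.le
  generalize rotB t y ⬝ᵥ rotB t y = Y at *
  generalize rotB t x ⬝ᵥ rotB t x = X at *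
  generalize t * kap t ^ 2 = q at *
  have h5 : A * (1 - q * r) + t ^ 2 * S * (q * (r - q)) ≤ 0 := by nlinarith
  have h6 : 0 < 1 - q * r := by linarith
  have h7 : 0 < q * (r - q) := mul_pos hq (by linarith)
  rcases hSA with hS1 | hA1
  · nlinarith [mul_pos (mul_pos (pow_pos ht 2) hS1) h7, mul_nonneg hA0 h6.le]
  · nlinarith [mul_pos hA1 h6, mul_nonneg hS2 h7.le]

end Transfer
end

noncomputable section
set_option linter.unusedSectionVars false
namespace Transfer
variable {m : ℕ} {t : ℝ}

/-- Multiplication by a spin. -/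
def spinOp (j : Fin (m + 1)) (f : Col m → ℝ) : Col m → ℝ := fun c => sg (c j) * f c

section Irreducible
variable {W : Submodule ℝ (Col m → ℝ)} (hW : ∀ i, ∀ f ∈ W, fe i f ∈ W)
include hW

lemma spinOp_mem (j : Fin (m + 1)) {f : Col m → ℝ} (hf : f ∈ W) : spinOp j f ∈ W := by
  obtain ⟨j, hj⟩ := j
  induction j generalizing f with
  | zero =>
    convert hW (⟨0, hj⟩, false) f hf using 1
    funext c
    have : msk m 0 = 0 := by funext k; simp [msk]
    simp [spinOp, fe_apply, lev, this]
  | succ j ih =>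
    have h := ih
      (hW (⟨j, by omega⟩, true) _ (hW (⟨j + 1, hj⟩, false) f hf)) (by omega)
    convert h using 1
    funext c
    simp only [spinOp, fe_apply, lev, Pi.add_apply, sg_add, sg_msk]
    simp only [if_true, Bool.false_eq_true, if_false, add_zero, lt_irrefl]
    rw [add_assoc, col_add_self, add_zero]
    have := sg_mul_self (c ⟨j, by omega⟩)
    linear_combination (-sg (c ⟨j + 1, hj⟩) * f c) * this

lemma flip_mem (j : Fin (m + 1)) {f : Col m → ℝ} (hf : f ∈ W) :
    (fun c => f (c + Pi.single j 1)) ∈ W := by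
  have h := hW (j, false) _ (hW (j, true) f hf)
  convert h using 1
  funext c
  simp only [fe_apply, lev, Pi.add_apply, sg_add, sg_msk]
  simp only [Bool.false_eq_true, if_false, add_zero, lt_irrefl, if_true, mul_one]
  have e : c + msk m j + msk m (j + 1) = c + Pi.single j 1 := by
    rw [add_assoc]
    congr 1
    funext k
    simp only [Pi.add_apply, msk, Pi.single_apply, Fin.ext_iff]
    split_ifs <;> first | omega | simp [zmod2_add_self]
  rw [e]
  have := sg_mul_self (c j)
  linear_combination (-f (c + Pi.single j 1)) * this

lemma translate_mem (d : Col m) {f : Col m → ℝ} (hf : f ∈ W) : (fun c => f (c + d)) ∈ W := by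
  have h : ∀ s : Finset (Fin (m + 1)), (fun c => f (c + ∑ j ∈ s, Pi.single j (d j))) ∈ W := by
    intro s
    induction s using Finset.induction_on with
    | empty => simpa using hf
    | insert j s hj ih =>
      rcases zmod2_cases (d j) with h0 | h1
      · simpa [Finset.sum_insert hj, h0] using ih
      · convert flip_mem hW j ih using 1
        funext c
        rw [Finset.sum_insert hj, h1, add_assoc]
  simpa [Finset.univ_sum_single] using h Finset.univ

lemma eq_top_of_closed {Ω : Col m → ℝ} (hΩ : Ω ∈ W) (h0 : Ω ≠ 0) : W = ⊤ := by
  obtain ⟨c0, hc0⟩ : ∃ c, Ω c ≠ 0 := by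
    by_contra! h
    exact h0 (funext h)
  have hprod : ∀ s : Finset (Fin (m + 1)),
      (fun c => (∏ j ∈ s, (1 + sg (c0 j + c j))) * Ω c) ∈ W := by
    intro s
    induction s using Finset.induction_on with
    | empty => simpa using hΩ
    | insert j s hj ih =>
      convert W.add_mem ih (W.smul_mem (sg (c0 j)) (spinOp_mem hW j ih)) using 1
      funext c
      rw [Finset.prod_insert hj]
      simp only [spinOp, Pi.add_apply, Pi.smul_apply, smul_eq_mul, sg_add]
      ring
  have hsing : Pi.single c0 1 ∈ W := by
    convert W.smul_mem (2 ^ (m + 1) * Ω c0)⁻¹ (hprod Finset.univ) using 1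
    funext c
    simp only [Pi.smul_apply, smul_eq_mul]
    by_cases hc : c = c0
    · subst hc
      have : ∀ j, 1 + sg (c j + c j) = 2 := fun j => by
        rw [zmod2_add_self, sg_zero]; norm_num
      simp only [this, Finset.prod_const, Finset.card_univ, Fintype.card_fin, Pi.single_eq_same]
      field_simp
    · rw [Pi.single_eq_of_ne hc]
      obtain ⟨j, hj⟩ : ∃ j, c j ≠ c0 j := by
        by_contra! h
        exact hc (funext h)
      rw [Finset.prod_eq_zero (Finset.mem_univ j), zero_mul, mul_zero]
      have : c0 j + c j = 1 := by
        rcases zmod2_cases (c0 j) with h | h <;> rcases zmod2_cases (c j) with h' | h' <;>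
          simp [h, h'] at hj ⊢
      rw [this, sg_one]; norm_num
  rw [eq_top_iff]
  intro f _
  have hf : f = ∑ c, f c • Pi.single c (1 : ℝ) := by
    funext c
    simp [Finset.sum_apply, Pi.single_apply]
  rw [hf]
  refine W.sum_mem fun c _ => W.smul_mem _ ?_
  convert translate_mem hW (c + c0) hsing using 1
  funext d
  simp only [Pi.single_apply]
  congr 1
  rw [eq_iff_iff]
  constructor
  · rintro rfl
    rw [← add_assoc, col_add_self, zero_add]
  · intro h
    have : d + (c + c0) + (c + c0) = d := by rw [add_assoc, col_add_self, add_zero]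
    rw [← this, h, add_comm c, ← add_assoc, col_add_self, zero_add]

end Irreducible

lemma fg_eig_zero (ht : 0 < t) (ht1 : t < 1) {Λ lam r : ℝ} {ψ : Col m → ℝ}
    (hmax : ∀ (f : Col m → ℝ) (c : ℝ), f ≠ 0 → tv t f = c • f → c ≤ Λ)
    (hψ : tv t ψ = lam • ψ) {u : Gen m → ℝ} (hu : rot t u = r • u) (hr : Λ < r * lam) :
    fg u ψ = 0 := by
  by_contra h
  have h1 : tv t (fg u ψ) = (r * lam) • fg u ψ := by
    have := congrArg (fun L => L ψ) (tv_fg ht ht1 u)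
    simp only [Module.End.mul_apply] at this
    rw [this, hu, fg_smul, hψ, map_smul, LinearMap.smul_apply, smul_smul, mul_comm]
  exact absurd (hmax _ _ h h1) (not_le.2 hr)

lemma rot_sig_eig (ht : 0 < t) (ht1 : t < 1) {r : ℝ} (hr : 0 < r) {u : Gen m → ℝ}
    (hu : rot t u = r • u) : rot t (sig * u) = r⁻¹ • (sig * u) := by
  have h := rot_sig ht ht1 u
  rw [hu, mul_smul_comm] at h
  have h2 : rot t (r • (sig * u)) = r • rot t (sig * u) := (rotL t).map_smul r (sig * u)
  rw [h2] at h
  conv_rhs => rw [← h, smul_smul, inv_mul_cancel₀ hr.ne', one_smul]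

/-- The odd spectrum of the transfer operator is separated from the top eigenvalue. -/
theorem odd_eig_zero (ht : 0 < t) (ht1 : t < 1) (hrho : rho t < 1) {Λ lam : ℝ} (hΛ : 0 < Λ)
    {Ω ψ : Col m → ℝ} (hmax : ∀ (f : Col m → ℝ) (c : ℝ), f ≠ 0 → tv t f = c • f → c ≤ Λ)
    (hΩ0 : Ω ≠ 0) (hΩ : tv t Ω = Λ • Ω) (hψ : tv t ψ = lam • ψ) (horth : ψ ⬝ᵥ Ω = 0)
    (hlam : rho t * Λ < lam) : ψ = 0 := by
  obtain ⟨r, u, hu, hon, hrep⟩ := exists_eigenbasis (rotL t : Module.End ℝ (Gen m → ℝ)) rotL_symm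
  have hu' : ∀ i, rot t (u i) = r i • u i := hu
  have hne : ∀ i, u i ≠ 0 := fun i h => by
    have := hon i i
    rw [h] at this; simp at this
  have hgap := fun i => rot_gap ht ht1 (hne i) (hu' i)
  have hrp := rho_pos ht ht1
  have hgrow : ∀ i, 1 / rho t ≤ r i → fg (u i) Ω = 0 := fun i hi => by
    refine fg_eig_zero ht ht1 hmax hΩ (hu' i) ?_
    have : 1 < r i := lt_of_lt_of_le (by rw [lt_div_iff₀ hrp]; linarith) hi
    nlinarith
  have hdec : ∀ i, r i ≤ rho t → fg (sig * u i) ψ = 0 := fun i hi => by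
    refine fg_eig_zero ht ht1 hmax hψ (rot_sig_eig ht ht1 (hgap i).1 (hu' i)) ?_
    have h1 : r i * Λ < lam := lt_of_le_of_lt (by nlinarith) hlam
    rw [inv_mul_eq_div, lt_div_iff₀ (hgap i).1]; linarith
  let act : List (Gen m) → Module.End ℝ (Col m → ℝ) := fun w => (w.map fun i => fg (u i)).prod
  have hact : ∀ i w, act (i :: w) = fg (u i) * act w := fun i w => by simp [act]
  have happ : ∀ w w', act (w ++ w') = act w * act w' := fun w w' => by simp [act]
  have key : ∀ n, ∀ w : List (Gen m), w.length = n → ψ ⬝ᵥ act w Ω = 0 := by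
    intro n
    induction n using Nat.strong_induction_on with
    | _ n IH =>
    intro w hw
    rcases w with _ | ⟨i, w⟩
    · simpa [act] using horth
    rcases (hgap i).2 with hi | hi
    · have h := fg_adj (sig * u i) ψ (act w Ω)
      have e : sig * (sig * u i) = u i := by
        funext k
        simp only [Pi.mul_apply, sig]
        split_ifs <;> ring
      rw [hdec i hi, zero_dotProduct, e] at h
      rw [hact, Module.End.mul_apply, ← h]
    · have inner : ∀ post pre : List (Gen m), pre.length + 1 + post.length = n →
          ψ ⬝ᵥ act pre (fg (u i) (act post Ω)) = 0 := by
        intro post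
        induction post with
        | nil =>
          intro pre _
          simp [act, hgrow i hi]
        | cons k post ih =>
          intro pre hlen
          obtain ⟨a, ha⟩ := fg_mul (u i) (u k)
          have h1 : fg (u i) (act (k :: post) Ω) =
              a • act post Ω - fg (u k) (fg (u i) (act post Ω)) := by
            have := congrArg (fun L => L (act post Ω)) ha
            simp only [LinearMap.add_apply, Module.End.mul_apply, LinearMap.smul_apply,
              Module.End.one_apply] at this
            rw [hact, Module.End.mul_apply, ← this]
            abel
          have h2 := IH (pre ++ post).length (by simp at hlen ⊢; omega) _ rfl
          have h3 := ih (pre ++ [k]) (by simp at hlen ⊢; omega)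
          rw [happ, Module.End.mul_apply] at h2 h3
          have h4 : act [k] = fg (u k) := by simp [act]
          rw [h4] at h3
          rw [h1, map_sub, map_smul, dotProduct_sub, dotProduct_smul, h2, h3]
          simp
      have := inner w [] (by simp at hw ⊢; omega)
      simpa [act] using this
  let W : Submodule ℝ (Col m → ℝ) := Submodule.span ℝ (Set.range fun w => act w Ω)
  have hWu : ∀ k, ∀ f ∈ W, fg (u k) f ∈ W := by
    intro k f hf
    induction hf using Submodule.span_induction with
    | mem x hx =>
      obtain ⟨w, rfl⟩ := hx
      exact Submodule.subset_span ⟨k :: w, by simp [act]⟩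
    | zero => simp
    | add x y _ _ hx hy => rw [map_add]; exact W.add_mem hx hy
    | smul a x _ hx => rw [map_smul]; exact W.smul_mem a hx
  have hWf : ∀ i, ∀ f ∈ W, fe i f ∈ W := by
    intro i f hf
    have e : fe i = fg (Pi.single i 1 : Gen m → ℝ) := by
      simp [fg, Pi.single_apply]
    rw [e, hrep (Pi.single i 1), fg_sum, LinearMap.sum_apply]
    exact W.sum_mem fun k _ => W.smul_mem _ (hWu k f hf)
  have htop := eq_top_of_closed hWf (Ω := Ω) (Submodule.subset_span ⟨[], by simp [act]⟩) hΩ0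
  have hψW : ψ ∈ W := htop ▸ Submodule.mem_top
  have hall : ∀ f ∈ W, ψ ⬝ᵥ f = 0 := by
    intro f hf
    induction hf using Submodule.span_induction with
    | mem x hx => obtain ⟨w, rfl⟩ := hx; exact key _ w rfl
    | zero => simp
    | add x y _ _ hx hy => rw [dotProduct_add, hx, hy, add_zero]
    | smul a x _ hx => rw [dotProduct_smul, hx, smul_zero]
  exact dot_self_eq_zero (hall ψ hψW)

end Transfer
end

noncomputable section
set_option linter.unusedSectionVars false
namespace Transfer
variable {m : ℕ} {t : ℝ}

/-- The kernel of the symmetrised transfer operator. -/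
def tk (t : ℝ) (c c' : Col m) : ℝ := dh t c * bk t c c' * dh t c'

lemma tv_apply (f : Col m → ℝ) (c : Col m) : tv t f c = ∑ c', tk t c c' * f c' := by
  simp only [tv, Module.End.mul_apply, mulOp, LinearMap.coe_mk, AddHom.coe_mk, Pi.mul_apply,
    bop_apply, tk, Finset.mul_sum]
  exact Finset.sum_congr rfl fun _ _ => by ring

lemma tk_comm (c c' : Col m) : tk t c c' = tk t c' c := by
  rw [tk, tk, bk_comm]; ring

lemma bk_pos (ht : 0 < t) (ht1 : t < 1) (c c' : Col m) : 0 < bk t c c' := by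
  refine Finset.prod_pos fun j _ => ?_
  rcases sg_eq (c j + c' j) with h | h <;> rw [h] <;> linarith

lemma tk_pos (ht : 0 < t) (ht1 : t < 1) (c c' : Col m) : 0 < tk t c c' :=
  mul_pos (mul_pos (dh_pos ht ht1 c) (bk_pos ht ht1 c c')) (dh_pos ht ht1 c')

lemma tv_symm (f g : Col m → ℝ) : f ⬝ᵥ tv t g = tv t f ⬝ᵥ g := by
  simp only [dotProduct, tv_apply, Finset.mul_sum, Finset.sum_mul]
  rw [Finset.sum_comm]
  refine Finset.sum_congr rfl fun c _ => Finset.sum_congr rfl fun c' _ => ?_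
  rw [tk_comm]; ring

lemma tv_psd (ht : 0 < t) (f : Col m → ℝ) : 0 ≤ f ⬝ᵥ tv t f := by
  have hbk : ∀ c c' : Col m, bk t c c' = ∑ s : Finset (Fin (m + 1)), t ^ s.card *
      (∏ j ∈ s, sg (c j)) * ∏ j ∈ s, sg (c' j) := by
    intro c c'
    rw [bk, Finset.prod_one_add, Finset.powerset_univ]
    refine Finset.sum_congr rfl fun s _ => ?_
    simp only [sg_add, Finset.prod_mul_distrib, Finset.prod_const]
    ring
  have : f ⬝ᵥ tv t f = ∑ s : Finset (Fin (m + 1)), t ^ s.card *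
      (∑ c, (∏ j ∈ s, sg (c j)) * (dh t c * f c)) ^ 2 := by
    simp only [dotProduct, tv_apply, tk, hbk, sq, Finset.mul_sum, Finset.sum_mul]
    rw [Finset.sum_comm' (s := Finset.univ) (t := fun _ => Finset.univ) (t' := Finset.univ)
      (s' := fun _ => Finset.univ) (by simp)]
    rw [Finset.sum_comm]
    refine (Finset.sum_congr rfl fun c _ => Finset.sum_comm).trans ?_
    rw [Finset.sum_comm]
    refine Finset.sum_congr rfl fun s _ => Finset.sum_congr rfl fun c _ =>
      Finset.sum_congr rfl fun c' _ => ?_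
    ring
  rw [this]
  exact Finset.sum_nonneg fun s _ => by positivity

lemma tk_shift_one (c c' : Col m) : tk t (c + 1) (c' + 1) = tk t c c' := by
  have : ∀ c : Col m, dh t (c + 1) = dh t c := fun c => dh_add_const c 1 fun _ _ => rfl
  rw [tk, tk, this, this, bk_shift, add_assoc, show (1 : Col m) + 1 = 0 from col_add_self 1,
    add_zero]

/-- Global spin flip. -/
def flp (f : Col m → ℝ) : Col m → ℝ := fun c => f (c + 1)

lemma flp_flp (f : Col m → ℝ) : flp (flp f) = f := by
  funext c; simp only [flp]; rw [add_assoc, show (1 : Col m) + 1 = 0 from col_add_self 1, add_zero]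

lemma tv_flp (f : Col m → ℝ) : tv t (flp f) = flp (tv t f) := by
  funext c
  simp only [flp, tv_apply]
  rw [← sum_col_add 1]
  refine Finset.sum_congr rfl fun c' _ => ?_
  rw [← tk_shift_one (c := c), add_assoc c', show (1 : Col m) + 1 = 0 from col_add_self 1, add_zero]

lemma flp_dot (f g : Col m → ℝ) : flp f ⬝ᵥ g = f ⬝ᵥ flp g := by
  simp only [dotProduct, flp]
  rw [← sum_col_add 1]
  refine Finset.sum_congr rfl fun c' _ => ?_
  rw [add_assoc c', show (1 : Col m) + 1 = 0 from col_add_self 1, add_zero]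

section Spectral
variable {lam : Col m → ℝ} {v : Col m → Col m → ℝ} (hv : ∀ i, tv t (v i) = lam i • v i)
  (hrep : ∀ f : Col m → ℝ, f = ∑ i, (v i ⬝ᵥ f) • v i)
include hv hrep

lemma pow_dot (f g : Col m → ℝ) (k : ℕ) :
    f ⬝ᵥ (tv t ^ k) g = ∑ i, lam i ^ k * ((v i ⬝ᵥ f) * (v i ⬝ᵥ g)) := by
  have hp : ∀ i, (tv t ^ k) (v i) = lam i ^ k • v i := by
    intro i
    induction k with
    | zero => simp
    | succ k ih => rw [pow_succ, Module.End.mul_apply, hv, map_smul, ih, smul_smul]; ring_nf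
  conv_lhs => rw [hrep g]
  simp only [map_sum, map_smul, hp, dotProduct_sum, dotProduct_smul, smul_eq_mul]
  exact Finset.sum_congr rfl fun i _ => by rw [dotProduct_comm f]; ring

lemma eq_of_rayleigh {Λ : ℝ} (hmax : ∀ i, lam i ≤ Λ) {f : Col m → ℝ}
    (h : Λ * (f ⬝ᵥ f) ≤ f ⬝ᵥ tv t f) : tv t f = Λ • f := by
  have h1 := pow_dot hv hrep f f 1
  have h0 := pow_dot hv hrep f f 0
  simp only [pow_one, pow_zero, one_mul, Module.End.one_apply] at h1 h0
  rw [h1, h0, Finset.mul_sum] at h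
  have h3 : ∀ i, lam i * (v i ⬝ᵥ f * (v i ⬝ᵥ f)) = Λ * (v i ⬝ᵥ f * (v i ⬝ᵥ f)) := by
    have hle : ∀ i ∈ Finset.univ, lam i * (v i ⬝ᵥ f * (v i ⬝ᵥ f)) ≤
        Λ * (v i ⬝ᵥ f * (v i ⬝ᵥ f)) :=
      fun i _ => mul_le_mul_of_nonneg_right (hmax i) (mul_self_nonneg _)
    intro i
    exact (Finset.sum_eq_sum_iff_of_le hle).1 (le_antisymm (Finset.sum_le_sum hle) h) i
      (Finset.mem_univ i)
  have h4 : ∀ i, (v i ⬝ᵥ f) • tv t (v i) = Λ • (v i ⬝ᵥ f) • v i := by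
    intro i
    by_cases hz : v i ⬝ᵥ f = 0
    · simp [hz]
    · have : lam i = Λ := mul_right_cancel₀ (mul_ne_zero hz hz) (h3 i)
      rw [hv, this, smul_comm]
  conv_lhs => rw [hrep f]
  simp only [map_sum, map_smul, h4]
  rw [← Finset.smul_sum, ← hrep f]

lemma eig_le {Λ : ℝ} (hmax : ∀ i, lam i ≤ Λ) (f : Col m → ℝ) (c : ℝ) (hf : f ≠ 0)
    (h : tv t f = c • f) : c ≤ Λ := by
  obtain ⟨i, hi⟩ : ∃ i, v i ⬝ᵥ f ≠ 0 := by
    by_contra! h0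
    apply hf
    rw [hrep f]
    simp [h0]
  have h1 : c * (v i ⬝ᵥ f) = lam i * (v i ⬝ᵥ f) := by
    have := tv_symm (t := t) (v i) f
    rwa [h, hv, dotProduct_smul, smul_dotProduct] at this
  rw [mul_right_cancel₀ hi h1]
  exact hmax i

end Spectral

/-- Spectral information on the transfer operator used for correlation decay. -/
theorem tv_spectral (ht : 0 < t) (ht1 : t < 1) (hrho : rho t < 1) :
    ∃ Λ > 0, (∃ a > 0, Tendsto (fun n : ℕ => (dh t ⬝ᵥ (tv t ^ n) (dh t : Col m → ℝ)) / Λ ^ n)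
      atTop (𝓝 a)) ∧
    ∀ f g : Col m → ℝ, flp f = -f → ∀ k : ℕ,
      f ⬝ᵥ (tv t ^ k) g ≤ (rho t * Λ) ^ k * ((f ⬝ᵥ f + g ⬝ᵥ g) / 2) := by
  obtain ⟨lam, v, hv, hon, hrep⟩ := exists_eigenbasis (tv t : Module.End ℝ (Col m → ℝ)) tv_symm
  obtain ⟨i0, -, hi0⟩ := Finset.exists_max_image Finset.univ lam ⟨0, Finset.mem_univ _⟩
  set Λ := lam i0 with hΛ
  have hmax : ∀ i, lam i ≤ Λ := fun i => hi0 i (Finset.mem_univ i)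
  have hlam0 : ∀ i, 0 ≤ lam i := fun i => by
    have := tv_psd ht (v i)
    rw [hv, dotProduct_smul, hon, if_pos rfl] at this
    simpa using this
  have habs : tv t |v i0| = Λ • |v i0| := by
    refine eq_of_rayleigh hv hrep hmax ?_
    have e1 : |v i0| ⬝ᵥ |v i0| = v i0 ⬝ᵥ v i0 := by simp [dotProduct]
    have e2 : Λ * (v i0 ⬝ᵥ v i0) = v i0 ⬝ᵥ tv t (v i0) := by
      rw [hv, dotProduct_smul, smul_eq_mul]
    rw [e1, e2]
    simp only [dotProduct, tv_apply, Finset.mul_sum]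
    refine Finset.sum_le_sum fun c _ => Finset.sum_le_sum fun c' _ => ?_
    have h1 := le_abs_self (v i0 c * v i0 c')
    rw [abs_mul] at h1
    simp only [Pi.abs_apply]
    nlinarith [mul_le_mul_of_nonneg_left h1 (tk_pos ht ht1 c c').le]
  set Ω := |v i0| + flp |v i0| with hΩdef
  have hflpΩ : flp Ω = Ω := by
    have : flp Ω = flp |v i0| + flp (flp |v i0|) := rfl
    rw [this, flp_flp, add_comm]
  have hΩ : tv t Ω = Λ • Ω := by
    rw [hΩdef, map_add, tv_flp, habs, smul_add]; rfl
  have hv0 : v i0 ≠ 0 := fun h => by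
    have := hon i0 i0
    rw [h] at this; simp at this
  obtain ⟨c0, hc0⟩ : ∃ c, v i0 c ≠ 0 := by
    by_contra! h
    exact hv0 (funext h)
  have hΩnn : ∀ c, 0 ≤ Ω c := fun c => add_nonneg (abs_nonneg _) (abs_nonneg _)
  have hΩc0 : 0 < Ω c0 := add_pos_of_pos_of_nonneg (abs_pos.2 hc0) (abs_nonneg _)
  have hΩ0 : Ω ≠ 0 := fun h => by rw [h] at hΩc0; simp at hΩc0
  have hΛpos : 0 < Λ := by
    have h1 : 0 < tv t Ω c0 := by
      rw [tv_apply]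
      exact Finset.sum_pos' (fun c _ => mul_nonneg (tk_pos ht ht1 _ _).le (hΩnn c))
        ⟨c0, Finset.mem_univ _, mul_pos (tk_pos ht ht1 _ _) hΩc0⟩
    rw [hΩ, Pi.smul_apply, smul_eq_mul] at h1
    exact pos_of_mul_pos_left h1 hΩc0.le
  refine ⟨Λ, hΛpos, ?_, ?_⟩
  · set l : Col m → ℝ := dh t with hl
    refine ⟨∑ i, if lam i = Λ then (v i ⬝ᵥ l) * (v i ⬝ᵥ l) else 0, ?_, ?_⟩
    · have h1 : 0 < l ⬝ᵥ Ω := Finset.sum_pos' (fun c _ => mul_nonneg (dh_pos ht ht1 c).le (hΩnn c))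
        ⟨c0, Finset.mem_univ _, mul_pos (dh_pos ht ht1 _) hΩc0⟩
      obtain ⟨i, hi1, hi2⟩ : ∃ i, v i ⬝ᵥ Ω ≠ 0 ∧ v i ⬝ᵥ l ≠ 0 := by
        by_contra! h
        have h2 := pow_dot hv hrep l Ω 0
        simp only [pow_zero, one_mul, Module.End.one_apply] at h2
        rw [h2] at h1
        refine h1.ne' (Finset.sum_eq_zero fun i _ => ?_)
        by_cases hz : v i ⬝ᵥ Ω = 0
        · rw [hz, mul_zero]
        · rw [h i hz, zero_mul]
      have hi : lam i = Λ := by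
        have := tv_symm (t := t) (v i) Ω
        rw [hΩ, hv, dotProduct_smul, smul_dotProduct] at this
        exact (mul_right_cancel₀ hi1 this).symm
      refine Finset.sum_pos' (fun j _ => ?_) ⟨i, Finset.mem_univ i, ?_⟩
      · split_ifs
        · exact mul_self_nonneg _
        · exact le_rfl
      · rw [if_pos hi]
        exact lt_of_le_of_ne (mul_self_nonneg _) (mul_ne_zero hi2 hi2).symm
    · have e : ∀ n : ℕ, (l ⬝ᵥ (tv t ^ n) l) / Λ ^ n =
          ∑ i, (lam i / Λ) ^ n * ((v i ⬝ᵥ l) * (v i ⬝ᵥ l)) := by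
        intro n
        rw [pow_dot hv hrep, Finset.sum_div]
        exact Finset.sum_congr rfl fun i _ => by rw [div_pow]; ring
      simp only [e]
      refine tendsto_finsetSum _ fun i _ => ?_
      split_ifs with h
      · rw [h, div_self hΛpos.ne']
        simp
      · have h1 : lam i / Λ < 1 := (div_lt_one hΛpos).2 (lt_of_le_of_ne (hmax i) h)
        have := tendsto_pow_atTop_nhds_zero_of_lt_one (div_nonneg (hlam0 i) hΛpos.le) h1
        simpa using this.mul_const ((v i ⬝ᵥ l) * (v i ⬝ᵥ l))
  · intro f g hf k
    have hsmall : ∀ i, v i ⬝ᵥ f ≠ 0 → lam i ≤ rho t * Λ := by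
      intro i hi
      by_contra! hlt
      apply hi
      have hodd : v i - flp (v i) = 0 := by
        refine odd_eig_zero (lam := lam i) ht ht1 hrho hΛpos (eig_le hv hrep hmax) hΩ0 hΩ ?_ ?_ hlt
        · rw [map_sub, tv_flp, hv, smul_sub]; rfl
        · rw [sub_dotProduct, flp_dot, hflpΩ, sub_self]
      have h1 : v i ⬝ᵥ f = - (v i ⬝ᵥ f) := by
        conv_lhs => rw [sub_eq_zero.1 hodd, flp_dot, hf, dotProduct_neg]
      linarith
    have hff := pow_dot hv hrep f f 0
    have hgg := pow_dot hv hrep g g 0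
    simp only [pow_zero, one_mul, Module.End.one_apply] at hff hgg
    rw [pow_dot hv hrep, hff, hgg, ← Finset.sum_add_distrib, mul_div_assoc', Finset.mul_sum,
      Finset.sum_div]
    have hrΛ : 0 ≤ rho t * Λ := mul_nonneg (rho_pos ht ht1).le hΛpos.le
    refine Finset.sum_le_sum fun i _ => ?_
    by_cases hz : v i ⬝ᵥ f = 0
    · rw [hz]
      have : 0 ≤ (rho t * Λ) ^ k * ((v i ⬝ᵥ g) * (v i ⬝ᵥ g)) :=
        mul_nonneg (pow_nonneg hrΛ k) (mul_self_nonneg _)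
      simp only [zero_mul, mul_zero, zero_add]
      linarith
    · have h1 : lam i ^ k ≤ (rho t * Λ) ^ k := pow_le_pow_left₀ (hlam0 i) (hsmall i hz) k
      have h2 : 0 ≤ lam i ^ k := pow_nonneg (hlam0 i) k
      nlinarith [mul_nonneg h2 (sq_nonneg (v i ⬝ᵥ f - v i ⬝ᵥ g)), mul_nonneg (sub_nonneg.2 h1)
        (add_nonneg (mul_self_nonneg (v i ⬝ᵥ f)) (mul_self_nonneg (v i ⬝ᵥ g)))]

/-- Cauchy-Schwarz for powers of the transfer operator. -/
lemma tv_pow_cs (ht : 0 < t) (f g : Col m → ℝ) (k : ℕ) :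
    f ⬝ᵥ (tv t ^ k) g ≤ (f ⬝ᵥ (tv t ^ k) f + g ⬝ᵥ (tv t ^ k) g) / 2 := by
  obtain ⟨lam, v, hv, hon, hrep⟩ := exists_eigenbasis (tv t : Module.End ℝ (Col m → ℝ)) tv_symm
  have hlam0 : ∀ i, 0 ≤ lam i := fun i => by
    have := tv_psd ht (v i)
    rw [hv, dotProduct_smul, hon, if_pos rfl] at this
    simpa using this
  rw [pow_dot hv hrep, pow_dot hv hrep, pow_dot hv hrep, ← Finset.sum_add_distrib, Finset.sum_div]
  refine Finset.sum_le_sum fun i _ => ?_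
  nlinarith [mul_nonneg (pow_nonneg (hlam0 i) k) (sq_nonneg (v i ⬝ᵥ f - v i ⬝ᵥ g))]

end Transfer
end

noncomputable section
set_option linter.unusedSectionVars false
namespace Transfer
variable {m : ℕ} {t : ℝ}

/-- Iterated transfer with insertions. -/
def ytr (t : ℝ) : ℕ → (ℕ → Col m → ℝ) → Col m → ℝ
  | 0, s => s 0 * dh t
  | n + 1, s => s 0 * tv t (ytr t n fun i => s (i + 1))

lemma ytr_sum (n : ℕ) (s : ℕ → Col m → ℝ) (φ : Col m → ℝ) :
    ∑ σ : Fin (n + 1) → Col m, φ (σ 0) * (∏ i : Fin (n + 1), s i (σ i)) *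
      (∏ i : Fin n, tk t (σ i.castSucc) (σ i.succ)) * dh t (σ (Fin.last n)) = φ ⬝ᵥ ytr t n s := by
  induction n generalizing s φ with
  | zero =>
    simp only [dotProduct, ytr]
    refine Fintype.sum_equiv (Equiv.funUnique (Fin 1) (Col m)) _ _ fun σ => ?_
    simp [Equiv.funUnique]; ring
  | succ n ih =>
    rw [← (Fin.consEquiv fun _ : Fin (n + 2) => Col m).sum_comp, Fintype.sum_prod_type]
    simp only [dotProduct, ytr, Pi.mul_apply, tv_apply]
    refine Finset.sum_congr rfl fun c _ => ?_
    have h := ih (fun i => s (i + 1)) (fun c' => tk t c c')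
    simp only [dotProduct] at h
    rw [← h, Finset.mul_sum, Finset.mul_sum]
    refine Finset.sum_congr rfl fun σ _ => ?_
    have e1 : ∏ i : Fin (n + 1 + 1), s i ((Fin.cons c σ : Fin (n + 2) → Col m) i) =
        s 0 c * ∏ i : Fin (n + 1), s (i + 1) (σ i) := by
      rw [Fin.prod_univ_succ]
      simp
    have e2 : ∏ i : Fin (n + 1), tk t ((Fin.cons c σ : Fin (n + 2) → Col m) i.castSucc)
          ((Fin.cons c σ : Fin (n + 2) → Col m) i.succ) =
        tk t c (σ 0) * ∏ i : Fin n, tk t (σ i.castSucc) (σ i.succ) := by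
      rw [Fin.prod_univ_succ]
      rfl
    have e3 : (Fin.cons c σ : Fin (n + 2) → Col m) (Fin.last (n + 1)) = σ (Fin.last n) := rfl
    simp only [Fin.consEquiv_apply, Fin.cons_zero]
    rw [e1, e2, e3]
    ring

lemma ytr_one (n : ℕ) : ytr t n (fun _ => 1) = (tv t ^ n) (dh t : Col m → ℝ) := by
  induction n with
  | zero => simp [ytr]
  | succ n ih => simp [ytr, ih, pow_succ']

lemma ytr_skip (k n : ℕ) (s : ℕ → Col m → ℝ) (h : ∀ i < k, s i = 1) :
    ytr t (k + n) s = (tv t ^ k) (ytr t n fun i => s (k + i)) := by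
  induction k generalizing s with
  | zero => simp
  | succ k ih =>
    rw [show k + 1 + n = (k + n) + 1 by ring, ytr, h 0 (by omega), one_mul,
      ih _ fun i hi => h (i + 1) (by omega), pow_succ', Module.End.mul_apply]
    congr 3
    funext i
    congr 1; ring

lemma ytr_mul (n : ℕ) (s : ℕ → Col m → ℝ) (p : Col m → ℝ) :
    ytr t n (fun i => (if i = 0 then p else 1) * s i) = p * ytr t n s := by
  cases n <;> simp [ytr, mul_assoc]

lemma ytr_two (a k r : ℕ) (p q : Col m → ℝ) :
    ytr t (a + (k + r)) (fun i => (if i = a then p else 1) * (if i = a + k then q else 1)) =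
      (tv t ^ a) (p * (tv t ^ k) (q * (tv t ^ r) (dh t))) := by
  rw [ytr_skip a (k + r)]
  · have e1 : (fun i => (if a + i = a then p else 1) * (if a + i = a + k then q else 1)) =
        fun i => (if i = 0 then p else 1) * (if i = k then q else 1) := by
      funext i; simp
    rw [e1, ytr_mul, ytr_skip k r]
    · have e2 : (fun i => (if k + i = k then q else 1)) =
          fun i => (if i = 0 then q else 1) * (1 : Col m → ℝ) := by
        funext i; simp
      rw [e2, ytr_mul r (fun _ => 1), ytr_one]
    · intro i hi
      simp [hi.ne]
  · intro i hi
    simp [hi.ne, show i ≠ a + k by omega]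

/-- Edges of the rectangle graph. -/
def rectE (n m : ℕ) :
    Finset ((Fin (n + 1) × Fin (m + 1)) × (Fin (n + 1) × Fin (m + 1))) :=
  (Finset.univ.image fun x : Fin n × Fin (m + 1) => ((x.1.castSucc, x.2), (x.1.succ, x.2))) ∪
  (Finset.univ.image fun x : Fin (n + 1) × Fin m => ((x.1, x.2.castSucc), (x.1, x.2.succ)))

lemma sw_rectE (ht : 0 < t) (ht1 : t < 1) (n m : ℕ) (σ : Fin (n + 1) → Col m) :
    sw t (rectE n m) (fun x => σ x.1 x.2) =
      dh t (σ 0) * (∏ i : Fin n, tk t (σ i.castSucc) (σ i.succ)) * dh t (σ (Fin.last n)) := by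
  have hdisj : Disjoint (Finset.univ.image fun x : Fin n × Fin (m + 1) =>
      (((x.1.castSucc, x.2), (x.1.succ, x.2)) :
        (Fin (n + 1) × Fin (m + 1)) × (Fin (n + 1) × Fin (m + 1))))
      (Finset.univ.image fun x : Fin (n + 1) × Fin m => ((x.1, x.2.castSucc), (x.1, x.2.succ))) := by
    rw [Finset.disjoint_left]
    intro e he he'
    simp only [Finset.mem_image, Finset.mem_univ, true_and] at he he'
    obtain ⟨x, rfl⟩ := he
    obtain ⟨y, hy⟩ := he'
    simp only [Prod.mk.injEq] at hy
    have h1 := hy.1.1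
    rw [hy.2.1] at h1
    simp [Fin.ext_iff] at h1
  rw [sw, rectE, Finset.prod_union hdisj, Finset.prod_image, Finset.prod_image]
  · have e1 : ∏ x : Fin n × Fin (m + 1), (1 + t * chi (pr (x.1.castSucc, x.2) (x.1.succ, x.2))
        (fun x : Fin (n + 1) × Fin (m + 1) => σ x.1 x.2)) =
        ∏ i : Fin n, bk t (σ i.castSucc) (σ i.succ) := by
      rw [Fintype.prod_prod_type]
      simp only [chi_pr, bk]
    have e2 : ∏ x : Fin (n + 1) × Fin m, (1 + t * chi (pr (x.1, x.2.castSucc) (x.1, x.2.succ))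
        (fun x : Fin (n + 1) × Fin (m + 1) => σ x.1 x.2)) =
        (∏ i, dh t (σ i)) * ∏ i, dh t (σ i) := by
      rw [Fintype.prod_prod_type, ← Finset.prod_mul_distrib]
      refine Finset.prod_congr rfl fun i _ => ?_
      rw [dh, ← Finset.prod_mul_distrib]
      refine Finset.prod_congr rfl fun j _ => ?_
      rw [chi_pr, Real.mul_self_sqrt]
      rcases sg_eq (σ i j.castSucc + σ i j.succ) with h | h <;> rw [h] <;> linarith
    simp only [e1, e2]
    have e3 : (∏ i, dh t (σ i)) * ∏ i, dh t (σ i) =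
        (dh t (σ 0) * ∏ i : Fin n, dh t (σ i.succ)) *
          ((∏ i : Fin n, dh t (σ i.castSucc)) * dh t (σ (Fin.last n))) :=
      congrArg₂ (· * ·) (Fin.prod_univ_succ fun i => dh t (σ i))
        (Fin.prod_univ_castSucc fun i => dh t (σ i))
    rw [e3]
    simp only [tk, Finset.prod_mul_distrib]
    ring
  · intro x _ y _ h
    simp only [Prod.mk.injEq] at h
    exact Prod.ext h.1.1 (Fin.castSucc_inj.1 h.1.2)
  · intro x _ y _ h
    simp only [Prod.mk.injEq, Fin.castSucc_inj] at h
    exact Prod.ext h.1.1 h.1.2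

lemma sum_rect (n m : ℕ) (F : (Fin (n + 1) × Fin (m + 1) → ZMod 2) → ℝ) :
    ∑ σ, F σ = ∑ σ : Fin (n + 1) → Col m, F fun x => σ x.1 x.2 :=
  Fintype.sum_equiv (Equiv.curry _ _ _) _ _ fun _ => rfl

lemma sz_rect (ht : 0 < t) (ht1 : t < 1) (a k r : ℕ) (j j' : Fin (m + 1)) :
    sz t (rectE (a + (k + r)) m) (pr (⟨a, by omega⟩, j) (⟨a + k, by omega⟩, j')) =
      dh t ⬝ᵥ (tv t ^ a) (spinOp j ((tv t ^ k) (spinOp j' ((tv t ^ r) (dh t))))) := by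
  have h := ytr_two (t := t) a k r (fun c : Col m => sg (c j)) (fun c => sg (c j'))
  have e : ∀ (j : Fin (m + 1)) (f : Col m → ℝ), spinOp j f = (fun c => sg (c j)) * f :=
    fun j f => rfl
  rw [e, e, ← h, ← ytr_sum, sz, sum_rect]
  refine Finset.sum_congr rfl fun σ _ => ?_
  rw [sw_rectE ht ht1, chi_pr, sg_add]
  have hp : (∏ i : Fin (a + (k + r) + 1), ((if (i : ℕ) = a then fun c : Col m => sg (c j) else 1) *
      (if (i : ℕ) = a + k then fun c : Col m => sg (c j') else 1)) (σ i)) =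
      sg (σ ⟨a, by omega⟩ j) * sg (σ ⟨a + k, by omega⟩ j') := by
    simp only [Pi.mul_apply, Finset.prod_mul_distrib]
    congr 1
    · rw [Finset.prod_eq_single (⟨a, by omega⟩ : Fin (a + (k + r) + 1))]
      · simp
      · intro b _ hb
        rw [if_neg fun h => hb (Fin.ext h)]; rfl
      · simp
    · rw [Finset.prod_eq_single (⟨a + k, by omega⟩ : Fin (a + (k + r) + 1))]
      · simp
      · intro b _ hb
        rw [if_neg fun h => hb (Fin.ext h)]; rfl
      · simp
  rw [hp]
  ring

lemma sz_rect_zero (ht : 0 < t) (ht1 : t < 1) (n : ℕ) :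
    sz t (rectE n m) 0 = dh t ⬝ᵥ (tv t ^ n) (dh t : Col m → ℝ) := by
  rw [← ytr_one, ← ytr_sum, sz, sum_rect]
  refine Finset.sum_congr rfl fun σ _ => ?_
  rw [sw_rectE ht ht1]
  simp [chi, sg_zero]

lemma tv_pow_symm (k : ℕ) (f g : Col m → ℝ) : f ⬝ᵥ (tv t ^ k) g = (tv t ^ k) f ⬝ᵥ g := by
  induction k generalizing f g with
  | zero => simp
  | succ k ih => rw [pow_succ, Module.End.mul_apply, ih, tv_symm, ← Module.End.mul_apply,
      ← pow_succ', pow_succ]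

lemma corr_eq_sz {V : Type*} [DecidableEq V] [Fintype V] (E : Finset (V × V)) (a b : V) :
    corr t E a b = sz t E (pr a b) / sz t E 0 := by
  rw [sz_eq, sz_eq, corr, mul_div_mul_left _ _ (by positivity)]

lemma corr_rect (ht : 0 < t) (ht1 : t < 1) (p k : ℕ) (j j' : Fin (m + 1)) :
    corr t (rectE (p + (k + p)) m) (⟨p, by omega⟩, j) (⟨p + k, by omega⟩, j') =
      (spinOp j ((tv t ^ p) (dh t)) ⬝ᵥ (tv t ^ k) (spinOp j' ((tv t ^ p) (dh t)))) /
        (dh t ⬝ᵥ (tv t ^ (p + (k + p))) (dh t : Col m → ℝ)) := by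
  rw [corr_eq_sz, sz_rect ht ht1, sz_rect_zero ht ht1, tv_pow_symm]
  congr 1
  simp only [dotProduct, spinOp]
  exact Finset.sum_congr rfl fun _ _ => by ring

lemma corr_rect_cs (ht : 0 < t) (ht1 : t < 1) (p k : ℕ) (j j' : Fin (m + 1)) :
    corr t (rectE (p + (k + p)) m) (⟨p, by omega⟩, j) (⟨p + k, by omega⟩, j') ≤
      (corr t (rectE (p + (k + p)) m) (⟨p, by omega⟩, j) (⟨p + k, by omega⟩, j) +
        corr t (rectE (p + (k + p)) m) (⟨p, by omega⟩, j') (⟨p + k, by omega⟩, j')) / 2 := by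
  have hZ : 0 < dh t ⬝ᵥ (tv t ^ (p + (k + p))) (dh t : Col m → ℝ) := by
    rw [← sz_rect_zero ht ht1, sz_eq]
    exact mul_pos (by positivity) (hw_zero_pos ht.le _)
  rw [corr_rect ht ht1, corr_rect ht ht1, corr_rect ht ht1, ← add_div, div_right_comm]
  exact div_le_div_of_nonneg_right (tv_pow_cs ht _ _ k) hZ.le

lemma flp_pow_dh (p : ℕ) : flp ((tv t ^ p) (dh t : Col m → ℝ)) = (tv t ^ p) (dh t) := by
  induction p with
  | zero => funext c; exact dh_add_const c 1 fun _ _ => rfl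
  | succ p ih => rw [pow_succ', Module.End.mul_apply, ← tv_flp, ih]

/-- Asymptotic decay of correlations in rectangles with growing margins. -/
theorem corr_rect_decay (ht : 0 < t) (ht1 : t < 1) (hrho : rho t < 1) (k : ℕ) :
    ∃ x : ℕ → ℝ, Tendsto x atTop (𝓝 (rho t ^ k)) ∧ ∀ p (j j' : Fin (m + 1)),
      corr t (rectE (p + (k + p)) m) (⟨p, by omega⟩, j) (⟨p + k, by omega⟩, j') ≤ x p := by
  obtain ⟨Λ, hΛ, ⟨a, ha, hlim⟩, hodd⟩ := tv_spectral (m := m) ht ht1 hrho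
  set z : ℕ → ℝ := fun n => (dh t ⬝ᵥ (tv t ^ n) (dh t : Col m → ℝ)) / Λ ^ n with hz
  refine ⟨fun p => rho t ^ k * (z (p + p) / z (p + (k + p))), ?_, fun p j j' => ?_⟩
  · have h1 : Tendsto (fun p : ℕ => p + p) atTop atTop :=
      tendsto_atTop_mono (fun p => Nat.le_add_left p p) tendsto_id
    have h2 : Tendsto (fun p : ℕ => p + (k + p)) atTop atTop :=
      tendsto_atTop_mono (fun p => Nat.le_add_right p _) tendsto_id
    have := ((hlim.comp h1).div (hlim.comp h2) ha.ne').const_mul (rho t ^ k)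
    rwa [div_self ha.ne', mul_one] at this
  · have hZ : 0 < dh t ⬝ᵥ (tv t ^ (p + (k + p))) (dh t : Col m → ℝ) := by
      rw [← sz_rect_zero ht ht1, sz_eq]
      exact mul_pos (by positivity) (hw_zero_pos ht.le _)
    set φ := (tv t ^ p) (dh t : Col m → ℝ) with hφ
    have hss : ∀ j : Fin (m + 1), spinOp j φ ⬝ᵥ spinOp j φ =
        dh t ⬝ᵥ (tv t ^ (p + p)) (dh t : Col m → ℝ) := by
      intro j
      rw [pow_add, Module.End.mul_apply, tv_pow_symm, ← hφ]
      simp only [dotProduct, spinOp]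
      refine Finset.sum_congr rfl fun c _ => ?_
      have := sg_mul_self (c j)
      linear_combination (φ c * φ c) * this
    have hflp : flp (spinOp j φ) = - spinOp j φ := by
      funext c
      have := congrFun (flp_pow_dh (t := t) (m := m) p) c
      simp only [flp] at this
      simp only [flp, spinOp, Pi.add_apply, Pi.one_apply, sg_add, sg_one, Pi.neg_apply]
      rw [hφ, this]; ring
    have h := hodd (spinOp j φ) (spinOp j' φ) hflp k
    rw [hss, hss, add_self_div_two] at h
    rw [corr_rect ht ht1, div_le_iff₀ hZ]
    refine h.trans_eq ?_
    simp only [hz]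
    have : Λ ^ (p + (k + p)) = Λ ^ k * Λ ^ (p + p) := by ring
    rw [this, mul_pow]
    field_simp

end Transfer
end

noncomputable section
set_option linter.unusedSectionVars false
open Transfer

/-- Sets of (oriented) nearest-neighbour edges of `ℤ²`. -/
def IsGrid (E : Finset ((ℤ × ℤ) × (ℤ × ℤ))) : Prop :=
  ∀ e ∈ E, e.2 = (e.1.1 + 1, e.1.2) ∨ e.2 = (e.1.1, e.1.2 + 1)

/-- The nearest-neighbour edges with both endpoints in `S`. -/
def gE (S : Finset (ℤ × ℤ)) : Finset ((ℤ × ℤ) × (ℤ × ℤ)) :=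
  (S.image fun p => (p, ((p.1 + 1, p.2) : ℤ × ℤ))).filter (fun e => e.2 ∈ S) ∪
    (S.image fun p => (p, ((p.1, p.2 + 1) : ℤ × ℤ))).filter (fun e => e.2 ∈ S)

lemma mem_gE {S : Finset (ℤ × ℤ)} {e : (ℤ × ℤ) × (ℤ × ℤ)} :
    e ∈ gE S ↔ e.1 ∈ S ∧ e.2 ∈ S ∧ (e.2 = (e.1.1 + 1, e.1.2) ∨ e.2 = (e.1.1, e.1.2 + 1)) := by
  simp only [gE, Finset.mem_union, Finset.mem_filter, Finset.mem_image]
  constructor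
  · rintro (⟨⟨p, hp, rfl⟩, h⟩ | ⟨⟨p, hp, rfl⟩, h⟩)
    · exact ⟨hp, h, Or.inl rfl⟩
    · exact ⟨hp, h, Or.inr rfl⟩
  · rintro ⟨h1, h2, h | h⟩
    · exact Or.inl ⟨⟨e.1, h1, by rw [← h]⟩, h2⟩
    · exact Or.inr ⟨⟨e.1, h1, by rw [← h]⟩, h2⟩

lemma isGrid_gE (S : Finset (ℤ × ℤ)) : IsGrid (gE S) := fun _ he => (mem_gE.1 he).2.2

lemma IsGrid.subset {E F : Finset ((ℤ × ℤ) × (ℤ × ℤ))} (hF : IsGrid F) (h : E ⊆ F) : IsGrid E :=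
  fun e he => hF e (h he)

/-- The embedding of a rectangle into `ℤ²` with lower left corner `z`. -/
def embR {n m : ℕ} (z : ℤ × ℤ) (x : Fin (n + 1) × Fin (m + 1)) : ℤ × ℤ :=
  (z.1 + (x.1 : ℕ), z.2 + (x.2 : ℕ))

lemma embR_injective {n m : ℕ} (z : ℤ × ℤ) : (embR (n := n) (m := m) z).Injective := by
  intro x y h
  simp only [embR, Prod.mk.injEq, add_right_inj, Nat.cast_inj] at h
  exact Prod.ext (Fin.ext h.1) (Fin.ext h.2)

lemma isGrid_embR {n m : ℕ} (z : ℤ × ℤ) :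
    IsGrid ((rectE n m).image (Prod.map (embR z) (embR z))) := by
  intro e he
  simp only [rectE, Finset.mem_image, Finset.mem_union, Finset.mem_univ, true_and] at he
  obtain ⟨f, ⟨x, rfl⟩ | ⟨x, rfl⟩, rfl⟩ := he
  · left; simp [embR, add_assoc]
  · right; simp [embR, add_assoc]

lemma subset_embR {E : Finset ((ℤ × ℤ) × (ℤ × ℤ))} (hE : IsGrid E) {n m : ℕ} (z : ℤ × ℤ)
    (h : ∀ v ∈ ends E, z.1 ≤ v.1 ∧ v.1 ≤ z.1 + n ∧ z.2 ≤ v.2 ∧ v.2 ≤ z.2 + m) :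
    E ⊆ (rectE n m).image (Prod.map (embR z) (embR z)) := by
  intro e he
  have h1 := h _ (fst_mem_ends he)
  have h2 := h _ (snd_mem_ends he)
  simp only [rectE, Finset.mem_image, Finset.mem_union, Finset.mem_univ, true_and]
  obtain ⟨⟨a, b⟩, c⟩ := e
  rcases hE _ he with hc | hc <;> simp only at hc h1 h2 <;> subst hc
  · simp only at h2
    refine ⟨_, Or.inl ⟨(⟨(a - z.1).toNat, by omega⟩, ⟨(b - z.2).toNat, by omega⟩), rfl⟩, ?_⟩
    simp only [Prod.map, embR, Fin.castSucc_mk, Fin.succ_mk, Prod.mk.injEq]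
    omega
  · simp only at h2
    refine ⟨_, Or.inr ⟨(⟨(a - z.1).toNat, by omega⟩, ⟨(b - z.2).toNat, by omega⟩), rfl⟩, ?_⟩
    simp only [Prod.map, embR, Fin.castSucc_mk, Fin.succ_mk, Prod.mk.injEq]
    omega

variable {t : ℝ}

lemma exists_coord_bound (W : Finset (ℤ × ℤ)) :
    ∃ M : ℕ, ∀ v ∈ W, -(M : ℤ) ≤ v.1 ∧ v.1 ≤ M ∧ -(M : ℤ) ≤ v.2 ∧ v.2 ≤ M := by
  obtain ⟨M, hM⟩ := (W.image fun v => v.1.natAbs + v.2.natAbs).exists_le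
  refine ⟨M, fun v hv => ?_⟩
  have := hM _ (Finset.mem_image_of_mem _ hv)
  omega

lemma exists_rect_bound (ht : 0 ≤ t) (ht1 : t ≤ 1) {E : Finset ((ℤ × ℤ) × (ℤ × ℤ))}
    (hE : IsGrid E) (a b : ℤ × ℤ) (k : ℕ) (hk : b.1 = a.1 + k) :
    ∃ (m p₀ : ℕ) (j j' : Fin (m + 1)), ∀ p ≥ p₀,
      corr t E a b ≤ corr t (rectE (p + (k + p)) m) (⟨p, by omega⟩, j) (⟨p + k, by omega⟩, j') := by
  obtain ⟨M, hM⟩ := exists_coord_bound (insert a (insert b (ends E)))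
  have ha := hM a (by simp)
  have hb := hM b (by simp)
  refine ⟨2 * M, 2 * M, ⟨(a.2 + M).toNat, by omega⟩, ⟨(b.2 + M).toNat, by omega⟩, fun p hp => ?_⟩
  rw [← corr_image t (embR_injective (a.1 - p, -(M : ℤ)))]
  have e1 : embR (n := p + (k + p)) (m := 2 * M) (a.1 - p, -(M : ℤ))
      (⟨p, by omega⟩, ⟨(a.2 + M).toNat, by omega⟩) = a := by
    simp only [embR]; ext <;> simp only <;> omega
  have e2 : embR (n := p + (k + p)) (m := 2 * M) (a.1 - p, -(M : ℤ))
      (⟨p + k, by omega⟩, ⟨(b.2 + M).toNat, by omega⟩) = b := by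
    simp only [embR]; ext <;> simp only <;> omega
  rw [e1, e2]
  refine corr_mono ht ht1 (subset_embR hE _ fun v hv => ?_) a b
  have := hM v (by simp [hv])
  simp only; push_cast; omega

/-- The supremum over finite subgraphs of `ℤ²` of the axis two-point function. -/
def axisG (t : ℝ) (k : ℕ) : ℝ := sSup {r | ∃ E, IsGrid E ∧ r = corr t E (0, 0) ((k : ℤ), 0)}

lemma axisG_bdd (ht : 0 ≤ t) (ht1 : t ≤ 1) (k : ℕ) :
    BddAbove {r | ∃ E, IsGrid E ∧ r = corr t E (0, 0) ((k : ℤ), 0)} :=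
  ⟨1, by rintro r ⟨E, _, rfl⟩; exact corr_le_one ht ht1 _ _ _⟩

lemma corr_le_axisG (ht : 0 ≤ t) (ht1 : t ≤ 1) {E : Finset ((ℤ × ℤ) × (ℤ × ℤ))} (hE : IsGrid E)
    (k : ℕ) : corr t E (0, 0) ((k : ℤ), 0) ≤ axisG t k :=
  le_csSup (axisG_bdd ht ht1 k) ⟨E, hE, rfl⟩

lemma corr_rect_le_axisG (ht : 0 ≤ t) (ht1 : t ≤ 1) {m : ℕ} (p k : ℕ) (j : Fin (m + 1)) :
    corr t (rectE (p + (k + p)) m) (⟨p, by omega⟩, j) (⟨p + k, by omega⟩, j) ≤ axisG t k := by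
  rw [← corr_image t (embR_injective (-(p : ℤ), -((j : ℕ) : ℤ)))]
  have e1 : embR (n := p + (k + p)) (-(p : ℤ), -((j : ℕ) : ℤ)) (⟨p, by omega⟩, j) = (0, 0) := by
    simp [embR]
  have e2 : embR (n := p + (k + p)) (-(p : ℤ), -((j : ℕ) : ℤ)) (⟨p + k, by omega⟩, j) =
      ((k : ℤ), 0) := by
    simp [embR]
  rw [e1, e2]
  exact corr_le_axisG ht ht1 (isGrid_embR _) k

lemma corr_le_pow_aux (ht : 0 < t) (ht1 : t < 1) (hrho : rho t < 1)
    {E : Finset ((ℤ × ℤ) × (ℤ × ℤ))} (hE : IsGrid E) (a b : ℤ × ℤ) (k : ℕ)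
    (hk : b.1 = a.1 + k) : corr t E a b ≤ rho t ^ k := by
  obtain ⟨m, p₀, j, j', h⟩ := exists_rect_bound ht.le ht1.le hE a b k hk
  obtain ⟨x, hx, hx'⟩ := corr_rect_decay (m := m) ht ht1 hrho k
  refine ge_of_tendsto hx ?_
  filter_upwards [eventually_ge_atTop p₀] with p hp
  exact (h p hp).trans (hx' p j j')

lemma corr_le_axisG_aux (ht : 0 < t) (ht1 : t < 1)
    {E : Finset ((ℤ × ℤ) × (ℤ × ℤ))} (hE : IsGrid E) (a b : ℤ × ℤ) (k : ℕ)
    (hk : b.1 = a.1 + k) : corr t E a b ≤ axisG t k := by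
  obtain ⟨m, p₀, j, j', h⟩ := exists_rect_bound ht.le ht1.le hE a b k hk
  refine (h p₀ le_rfl).trans ((corr_rect_cs ht ht1 p₀ k j j').trans ?_)
  have h1 := corr_rect_le_axisG ht.le ht1.le p₀ k j
  have h2 := corr_rect_le_axisG ht.le ht1.le p₀ k j'
  linarith

lemma corr_swap (t : ℝ) (E : Finset ((ℤ × ℤ) × (ℤ × ℤ))) (a b : ℤ × ℤ) :
    corr t (E.image (Prod.map Prod.swap Prod.swap)) a.swap b.swap = corr t E a b :=
  corr_image t Prod.swap_injective E a b

lemma IsGrid.swap {E : Finset ((ℤ × ℤ) × (ℤ × ℤ))} (hE : IsGrid E) :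
    IsGrid (E.image (Prod.map Prod.swap Prod.swap)) := by
  intro e he
  obtain ⟨f, hf, rfl⟩ := Finset.mem_image.1 he
  rcases hE f hf with h | h
  · right; simp [h]
  · left; simp [h]

lemma corr_le_axisG_abs (ht : 0 < t) (ht1 : t < 1)
    {E : Finset ((ℤ × ℤ) × (ℤ × ℤ))} (hE : IsGrid E) (a b : ℤ × ℤ) :
    corr t E a b ≤ axisG t (b.1 - a.1).natAbs := by
  rcases le_total a.1 b.1 with h | h
  · exact corr_le_axisG_aux ht ht1 hE a b _ (by omega)
  · rw [corr_comm]; exact corr_le_axisG_aux ht ht1 hE b a _ (by omega)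

lemma corr_le_axisG_abs' (ht : 0 < t) (ht1 : t < 1)
    {E : Finset ((ℤ × ℤ) × (ℤ × ℤ))} (hE : IsGrid E) (a b : ℤ × ℤ) :
    corr t E a b ≤ axisG t (b.2 - a.2).natAbs := by
  rw [← corr_swap]; exact corr_le_axisG_abs ht ht1 hE.swap _ _

/-- Exponential decay of correlations along the first coordinate. -/
theorem corr_le_pow (ht : 0 < t) (ht1 : t < 1) (hrho : rho t < 1)
    {E : Finset ((ℤ × ℤ) × (ℤ × ℤ))} (hE : IsGrid E) (a b : ℤ × ℤ) :
    corr t E a b ≤ rho t ^ (b.1 - a.1).natAbs := by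
  rcases le_total a.1 b.1 with h | h
  · exact corr_le_pow_aux ht ht1 hrho hE a b _ (by omega)
  · rw [corr_comm]; exact corr_le_pow_aux ht ht1 hrho hE b a _ (by omega)

lemma pow_le_corr_aux (ht : 0 ≤ t) (ht1 : t ≤ 1) (E : Finset ((ℤ × ℤ) × (ℤ × ℤ))) (a : ℤ × ℤ)
    (k : ℕ) (h : ∀ i : ℕ, i < k → ((a.1 + i, a.2), (a.1 + i + 1, a.2)) ∈ E) :
    t ^ k ≤ corr t E a (a.1 + k, a.2) := by
  induction k with
  | zero => simp [corr_self ht]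
  | succ k ih =>
    refine le_trans ?_ (corr_mul_le ht ht1 E a (a.1 + k, a.2) _)
    rw [pow_succ]
    refine mul_le_mul (ih fun i hi => h i (by omega)) ?_ ht (corr_nonneg ht _ _ _)
    have := le_corr_of_mem ht ht1 (h k (by omega))
    push_cast
    rwa [← add_assoc]

lemma pow_le_axisG (ht : 0 ≤ t) (ht1 : t ≤ 1) (k : ℕ) : t ^ k ≤ axisG t k := by
  have h := pow_le_corr_aux ht ht1 (gE (Finset.Icc 0 (k : ℤ) ×ˢ {0})) (0, 0) k ?_
  · simp only [zero_add] at h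
    exact h.trans (corr_le_axisG ht ht1 (isGrid_gE _) k)
  · intro i hi
    rw [mem_gE]
    refine ⟨?_, ?_, Or.inl rfl⟩ <;> simp <;> omega

lemma mul_axisG_le (ht : 0 < t) (ht1 : t < 1) (k : ℕ) : t * axisG t k ≤ axisG t (k + 1) := by
  rw [mul_comm, ← le_div_iff₀ ht]
  refine csSup_le ⟨_, ∅, by simp [IsGrid], rfl⟩ ?_
  rintro r ⟨E, hE, rfl⟩
  rw [le_div_iff₀ ht]
  set E' := insert (((k : ℤ), (0 : ℤ)), ((k : ℤ) + 1, (0 : ℤ))) E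
  have hE' : IsGrid E' := by
    intro e he
    rcases Finset.mem_insert.1 he with rfl | he
    · left; rfl
    · exact hE e he
  have h := corr_le_axisG ht.le ht1.le hE' (k + 1)
  push_cast at h
  refine le_trans ?_ ((corr_mul_le ht.le ht1.le E' (0, 0) ((k : ℤ), 0) ((k : ℤ) + 1, 0)).trans h)
  exact mul_le_mul (corr_mono ht.le ht1.le (Finset.subset_insert _ _) _ _)
    (le_corr_of_mem ht.le ht1.le (Finset.mem_insert_self _ _)) ht.le (corr_nonneg ht.le _ _ _)

end

noncomputable section
set_option linter.unusedSectionVars false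

/-! ### Peierls contours and duality -/

lemma par_symmDiff {V : Type*} [DecidableEq V] (F G : Finset (V × V)) :
    par (symmDiff F G) = par F + par G := by
  have hFG : ∀ F G : Finset (V × V), par F = par (F \ G) + par (F ∩ G) := by
    intro F G
    rw [par, par, par, ← Finset.sum_union (Finset.disjoint_sdiff_inter F G), Finset.sdiff_union_inter]
  have hs : par (symmDiff F G) = par (F \ G) + par (G \ F) := by
    rw [par, par, par, symmDiff_def, Finset.sup_eq_union, Finset.sum_union]
    exact disjoint_sdiff_sdiff
  rw [hs, hFG F G, hFG G F, Finset.inter_comm G F]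
  funext v
  have := zmod2_add_self (par (F ∩ G) v)
  simp only [Pi.add_apply]
  linear_combination -this

lemma sum_of_par_eq_zero {V : Type*} [DecidableEq V] {F : Finset (V × V)} (hF : par F = 0)
    (g : V → ZMod 2) : ∑ e ∈ F, (g e.1 + g e.2) = 0 := by
  have h : ∀ e ∈ F, g e.1 + g e.2 = ∑ v ∈ ends F, g v * pr e.1 e.2 v := by
    intro e he
    simp only [pr, Pi.add_apply, Pi.single_apply, mul_add, Finset.sum_add_distrib]
    simp [fst_mem_ends he, snd_mem_ends he]
  rw [Finset.sum_congr rfl h, Finset.sum_comm]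
  refine Finset.sum_eq_zero fun v _ => ?_
  rw [← Finset.mul_sum]
  have := congrFun hF v
  simp only [par, Finset.sum_apply, Pi.zero_apply] at this
  rw [this, mul_zero]

/-- The dual edges surrounding a site. -/
def cyc (x : ℤ × ℤ) : Finset ((ℤ × ℤ) × (ℤ × ℤ)) :=
  {((x.1 - 1, x.2), (x.1, x.2)), ((x.1, x.2 - 1), (x.1, x.2)),
    ((x.1 - 1, x.2 - 1), (x.1, x.2 - 1)), ((x.1 - 1, x.2 - 1), (x.1 - 1, x.2))}

/-- The dual edges crossing a bond that touches `Φ`. -/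
def touchE (Φ : Finset (ℤ × ℤ)) : Finset ((ℤ × ℤ) × (ℤ × ℤ)) := Φ.biUnion cyc

/-- The site diagonally above the lower endpoint of a dual edge: the dual edge `e` crosses the bond
`{e.2, opp e}`. -/
def opp (e : (ℤ × ℤ) × (ℤ × ℤ)) : ℤ × ℤ := (e.1.1 + 1, e.1.2 + 1)

/-- The contour of a finite set of sites. -/
def bd (A : Finset (ℤ × ℤ)) : Finset ((ℤ × ℤ) × (ℤ × ℤ)) :=
  (touchE A).filter fun e => ¬ (e.2 ∈ A ↔ opp e ∈ A)

lemma mem_cyc {x : ℤ × ℤ} {e : (ℤ × ℤ) × (ℤ × ℤ)} :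
    e ∈ cyc x ↔ (e.2 = (e.1.1 + 1, e.1.2) ∨ e.2 = (e.1.1, e.1.2 + 1)) ∧ (e.2 = x ∨ opp e = x) := by
  obtain ⟨⟨a, b⟩, c, d⟩ := e
  obtain ⟨x, y⟩ := x
  simp only [cyc, opp, Finset.mem_insert, Finset.mem_singleton, Prod.mk.injEq]
  omega

lemma mem_touchE {Φ : Finset (ℤ × ℤ)} {e : (ℤ × ℤ) × (ℤ × ℤ)} :
    e ∈ touchE Φ ↔ (e.2 = (e.1.1 + 1, e.1.2) ∨ e.2 = (e.1.1, e.1.2 + 1)) ∧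
      (e.2 ∈ Φ ∨ opp e ∈ Φ) := by
  simp only [touchE, Finset.mem_biUnion, mem_cyc]
  constructor
  · rintro ⟨x, hx, h, rfl | rfl⟩
    · exact ⟨h, Or.inl hx⟩
    · exact ⟨h, Or.inr hx⟩
  · rintro ⟨h, hx | hx⟩
    · exact ⟨_, hx, h, Or.inl rfl⟩
    · exact ⟨_, hx, h, Or.inr rfl⟩

lemma isGrid_touchE (Φ : Finset (ℤ × ℤ)) : IsGrid (touchE Φ) := fun _ he => (mem_touchE.1 he).1

lemma mem_bd {A : Finset (ℤ × ℤ)} {e : (ℤ × ℤ) × (ℤ × ℤ)} :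
    e ∈ bd A ↔ (e.2 = (e.1.1 + 1, e.1.2) ∨ e.2 = (e.1.1, e.1.2 + 1)) ∧
      ¬ (e.2 ∈ A ↔ opp e ∈ A) := by
  rw [bd, Finset.mem_filter, mem_touchE]
  tauto

lemma bd_subset_touchE {A Φ : Finset (ℤ × ℤ)} (h : A ⊆ Φ) : bd A ⊆ touchE Φ := by
  intro e he
  rw [mem_bd] at he
  rw [mem_touchE]
  refine ⟨he.1, ?_⟩
  by_contra hh
  push Not at hh
  exact he.2 ⟨fun h' => absurd (h h') hh.1, fun h' => absurd (h h') hh.2⟩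

lemma bd_symmDiff (A A' : Finset (ℤ × ℤ)) : bd (symmDiff A A') = symmDiff (bd A) (bd A') := by
  ext e
  simp only [mem_bd, Finset.mem_symmDiff]
  tauto

lemma bd_singleton (x : ℤ × ℤ) : bd {x} = cyc x := by
  ext e
  rw [mem_bd, mem_cyc]
  simp only [Finset.mem_singleton]
  refine and_congr_right fun h => ?_
  have : ¬ (e.2 = x ∧ opp e = x) := by
    rintro ⟨h1, h2⟩
    rw [← h2, opp] at h1
    rcases h with h | h <;> rw [h] at h1 <;> simp at h1
  tauto

lemma par_cyc (x : ℤ × ℤ) : par (cyc x) = 0 := by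
  rw [par, cyc, Finset.sum_insert, Finset.sum_insert, Finset.sum_insert, Finset.sum_singleton]
  · simp only
    rw [pr_comm (x.1, x.2 - 1) (x.1, x.2), ← add_assoc, pr_add, pr_comm (x.1 - 1, x.2 - 1), ← add_assoc,
      pr_add, pr_comm _ (x.1 - 1, x.2)]
    funext v; exact zmod2_add_self _
  all_goals simp [Prod.ext_iff]
  all_goals omega

lemma par_bd (A : Finset (ℤ × ℤ)) : par (bd A) = 0 := by
  induction A using Finset.induction_on with
  | empty => simp [bd, par]
  | insert x A hx ih =>
    have : insert x A = symmDiff {x} A := by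
      ext y
      simp only [Finset.mem_insert, Finset.mem_symmDiff, Finset.mem_singleton]
      constructor
      · rintro (rfl | h)
        · exact Or.inl ⟨rfl, hx⟩
        · exact Or.inr ⟨h, fun h' => hx (h' ▸ h)⟩
      · tauto
    rw [this, bd_symmDiff, par_symmDiff, ih, bd_singleton, par_cyc, add_zero]

lemma bd_injective : Function.Injective bd := by
  intro A A' h
  by_contra hne
  have hD : (symmDiff A A').Nonempty := by
    rw [Finset.nonempty_iff_ne_empty]
    intro h0
    exact hne (symmDiff_eq_bot.1 h0)
  obtain ⟨x, hx, hmin⟩ := Finset.exists_min_image _ Prod.fst hD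
  have h0 : bd (symmDiff A A') = ∅ := by rw [bd_symmDiff, h]; simp
  have hx' : (x.1 - 1, x.2) ∉ symmDiff A A' := fun hx' => by
    have := hmin _ hx'; simp only at this; omega
  have : ((x.1 - 1, x.2 - 1), (x.1 - 1, x.2)) ∈ bd (symmDiff A A') := by
    rw [mem_bd]
    refine ⟨Or.inr (by simp), ?_⟩
    have e : opp ((x.1 - 1, x.2 - 1), (x.1 - 1, x.2)) = x := by simp [opp]
    rw [e]
    exact fun h => hx' (h.2 hx)
  rw [h0] at this
  simp at this

/-- Every site outside `Φ` has its left or its right horizontal ray outside `Φ`. -/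
def RayOut (Φ : Finset (ℤ × ℤ)) : Prop :=
  ∀ x u : ℤ, (x, u) ∉ Φ → (∀ y ≤ x, (y, u) ∉ Φ) ∨ (∀ y ≥ x, (y, u) ∉ Φ)

lemma ind_mem {α : Type*} [DecidableEq α] (F : Finset α) (a : α) :
    (if a ∈ F then 1 else 0 : ZMod 2) = ∑ e ∈ F, if e = a then 1 else 0 := by
  simp

/-- The parity of the number of vertical dual edges of `F` to the left of a site. -/
def leftPar (F : Finset ((ℤ × ℤ) × (ℤ × ℤ))) (x : ℤ × ℤ) : ZMod 2 :=
  ∑ e ∈ F, if e.2 = (e.1.1, e.1.2 + 1) ∧ e.1.2 = x.2 - 1 ∧ e.1.1 < x.1 then 1 else 0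

lemma leftPar_right (F : Finset ((ℤ × ℤ) × (ℤ × ℤ))) (x u : ℤ) :
    leftPar F (x + 1, u) + leftPar F (x, u) = if ((x, u - 1), (x, u)) ∈ F then 1 else 0 := by
  rw [leftPar, leftPar, ← Finset.sum_add_distrib, ind_mem]
  refine Finset.sum_congr rfl fun e _ => ?_
  obtain ⟨⟨a, b⟩, c, d⟩ := e
  simp only [Prod.mk.injEq]
  split_ifs <;> first | rfl | decide | (exfalso; omega)

lemma leftPar_up {F : Finset ((ℤ × ℤ) × (ℤ × ℤ))} (hF : IsGrid F) (hp : par F = 0) (x u : ℤ) :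
    leftPar F (x, u + 1) + leftPar F (x, u) = if ((x - 1, u), (x, u)) ∈ F then 1 else 0 := by
  have h := sum_of_par_eq_zero hp fun p => if p.2 = u ∧ p.1 < x then 1 else 0
  refine (add_zero _).symm.trans ((congrArg _ h.symm).trans ?_)
  rw [leftPar, leftPar,
    ← Finset.sum_add_distrib, ← Finset.sum_add_distrib, ind_mem]
  refine Finset.sum_congr rfl fun e he => ?_
  have := hF e he
  obtain ⟨⟨a, b⟩, c, d⟩ := e
  simp only [Prod.mk.injEq] at this ⊢
  split_ifs <;> first | rfl | decide | (exfalso; omega)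

lemma row_total {F : Finset ((ℤ × ℤ) × (ℤ × ℤ))} (hF : IsGrid F) (hp : par F = 0) (u : ℤ) :
    (∑ e ∈ F, if e.2 = (e.1.1, e.1.2 + 1) ∧ e.1.2 = u - 1 then 1 else 0 : ZMod 2) = 0 := by
  refine Eq.trans ?_ (sum_of_par_eq_zero hp fun p => if u ≤ p.2 then 1 else 0)
  refine Finset.sum_congr rfl fun e he => ?_
  have := hF e he
  obtain ⟨⟨a, b⟩, c, d⟩ := e
  simp only [Prod.mk.injEq] at this ⊢
  split_ifs <;> first | rfl | decide | (exfalso; omega)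

lemma leftPar_eq_zero {Φ : Finset (ℤ × ℤ)} (hΦ : RayOut Φ) {F : Finset ((ℤ × ℤ) × (ℤ × ℤ))}
    (hF : F ⊆ touchE Φ) (hp : par F = 0) (z : ℤ × ℤ) (hz : z ∉ Φ) : leftPar F z = 0 := by
  classical
  obtain ⟨x, u⟩ := z
  rcases hΦ x u hz with h | h
  · refine Finset.sum_eq_zero fun e he => if_neg ?_
    have := mem_touchE.1 (hF he)
    obtain ⟨⟨a, b⟩, c, d⟩ := e
    rintro ⟨h1, h2, h3⟩
    simp only [Prod.mk.injEq] at h1 h2 h3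
    simp only [opp] at this
    obtain ⟨rfl, rfl⟩ := h1
    obtain rfl : u = b + 1 := by omega
    rcases this.2 with h' | h'
    · exact h _ (by omega) h'
    · exact h _ (by omega) h'
  · rw [← row_total (isGrid_touchE Φ |>.subset hF) hp u, leftPar]
    refine Finset.sum_congr rfl fun e he => ?_
    have := mem_touchE.1 (hF he)
    obtain ⟨⟨a, b⟩, c, d⟩ := e
    by_cases h1 : d = b + 1 ∧ c = a ∧ b = u - 1
    · obtain ⟨rfl, rfl, rfl⟩ := h1
      have h2 : c < x := by
        by_contra h2
        simp only [opp, sub_add_cancel] at this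
        rcases this.2 with h' | h'
        · exact h _ (by omega) h'
        · exact h _ (by omega) h'
      simp [h2]
    · rw [if_neg, if_neg]
      · simp only [Prod.mk.injEq]; omega
      · simp only [Prod.mk.injEq]; omega

/-- A finite even set of dual edges is a contour. -/
theorem exists_bd_eq {Φ : Finset (ℤ × ℤ)} (hΦ : RayOut Φ) {F : Finset ((ℤ × ℤ) × (ℤ × ℤ))}
    (hF : F ⊆ touchE Φ) (hp : par F = 0) : ∃ A ⊆ Φ, bd A = F := by
  classical
  have hG := (isGrid_touchE Φ).subset hF
  refine ⟨Φ.filter fun x => leftPar F x = 1, Finset.filter_subset _ _, ?_⟩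
  have hA : ∀ x, x ∈ Φ.filter (fun x => leftPar F x = 1) ↔ leftPar F x = 1 := by
    intro x
    rw [Finset.mem_filter]
    refine ⟨fun h => h.2, fun h => ⟨?_, h⟩⟩
    by_contra hx
    rw [leftPar_eq_zero hΦ hF hp x hx] at h
    exact absurd h (by decide)
  have key : ∀ (a b : ZMod 2) (P : Prop) [Decidable P], a + b = (if P then 1 else 0) →
      (¬ (a = 1 ↔ b = 1) ↔ P) := by
    intro a b P _ h
    rcases zmod2_cases a with rfl | rfl <;> rcases zmod2_cases b with rfl | rfl <;>
      by_cases hP : P <;> simp [hP] at h ⊢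
  ext e
  rw [mem_bd, hA, hA]
  obtain ⟨⟨a, b⟩, c, d⟩ := e
  simp only [opp, Prod.mk.injEq]
  constructor
  · rintro ⟨⟨rfl, rfl⟩ | ⟨rfl, rfl⟩, h⟩
    · have := leftPar_up hG hp (a + 1) d
      rw [add_comm, add_sub_cancel_right] at this
      exact (key _ _ _ this).1 h
    · have := leftPar_right F c (b + 1)
      rw [add_comm, add_sub_cancel_right] at this
      exact (key _ _ _ this).1 h
  · intro h
    rcases hG _ h with h1 | h1 <;> simp only [Prod.mk.injEq] at h1 <;> obtain ⟨rfl, rfl⟩ := h1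
    · have := leftPar_up hG hp (a + 1) d
      rw [add_comm, add_sub_cancel_right] at this
      exact ⟨Or.inl ⟨rfl, rfl⟩, (key _ _ _ this).2 h⟩
    · have := leftPar_right F c (b + 1)
      rw [add_comm, add_sub_cancel_right] at this
      exact ⟨Or.inr ⟨rfl, rfl⟩, (key _ _ _ this).2 h⟩

/-- The Peierls weight of a set of minus spins. -/
def bw (t : ℝ) (A : Finset (ℤ × ℤ)) : ℝ := t ^ (bd A).card

/-- Kramers–Wannier duality with a fixed set `K` of minus spins. -/
theorem duality (t : ℝ) {Φ K : Finset (ℤ × ℤ)} (hΦ : RayOut Φ) (hK : Disjoint K Φ) :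
    ∑ A ∈ Φ.powerset, bw t (K ∪ A) =
      t ^ (bd K \ touchE Φ).card * hw t (touchE Φ) (par (bd K \ touchE Φ)) := by
  classical
  have hsd : ∀ A ⊆ Φ, bd (K ∪ A) = symmDiff (bd K) (bd A) := by
    intro A hA
    rw [← bd_symmDiff, (hK.mono_right hA).symmDiff_eq_sup]; rfl
  have hout : ∀ A ⊆ Φ, bd (K ∪ A) \ touchE Φ = bd K \ touchE Φ := by
    intro A hA
    rw [hsd A hA]
    have := bd_subset_touchE hA
    ext e
    simp only [Finset.mem_sdiff, Finset.mem_symmDiff]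
    have := @this e
    tauto
  have hpar : ∀ G : Finset ((ℤ × ℤ) × (ℤ × ℤ)),
      par G = par (G ∩ touchE Φ) + par (G \ touchE Φ) := by
    intro G
    rw [par, par, par, ← Finset.sum_union (Finset.disjoint_sdiff_inter G _).symm, Finset.union_comm,
      Finset.sdiff_union_inter]
  have hzero : ∀ a b : (ℤ × ℤ) → ZMod 2, a + b = 0 ↔ a = b := by
    intro a b
    have : -b = b := by
      funext v
      have := zmod2_add_self (b v)
      simp only [Pi.neg_apply]
      linear_combination -this
    rw [add_eq_zero_iff_eq_neg, this]
  rw [hw, Finset.mul_sum]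
  refine Finset.sum_bij (fun A _ => bd (K ∪ A) ∩ touchE Φ) ?_ ?_ ?_ ?_
  · intro A hA
    rw [Finset.mem_powerset] at hA
    rw [Finset.mem_filter, Finset.mem_powerset]
    refine ⟨Finset.inter_subset_right, ?_⟩
    rw [← hzero, ← hout A hA, ← hpar, par_bd]
  · intro A hA A' hA' h
    rw [Finset.mem_powerset] at hA hA'
    have h2 := (hout A hA).trans (hout A' hA').symm
    have h3 : bd (K ∪ A) = bd (K ∪ A') := by
      rw [← Finset.sdiff_union_inter (bd (K ∪ A)) (touchE Φ), h2, h, Finset.sdiff_union_inter]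
    have h4 := bd_injective h3
    have h5 : ∀ A ⊆ Φ, A = (K ∪ A) \ K := by
      intro A hA
      rw [Finset.union_sdiff_left, Finset.sdiff_eq_self_of_disjoint (hK.symm.mono_left hA)]
    rw [h5 A hA, h5 A' hA', h4]
  · intro F hF
    rw [Finset.mem_filter, Finset.mem_powerset] at hF
    obtain ⟨A, hA, hA'⟩ := exists_bd_eq (F := symmDiff F (bd K ∩ touchE Φ)) hΦ
      (by
        intro e he
        rw [Finset.mem_symmDiff] at he
        rcases he with h | h
        · exact hF.1 h.1
        · exact (Finset.mem_inter.1 h.1).2)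
      (by
        rw [par_symmDiff, hF.2, add_comm, ← hpar, par_bd])
    refine ⟨A, Finset.mem_powerset.2 hA, ?_⟩
    rw [hsd A hA, hA']
    ext e
    have := @hF.1 e
    simp only [Finset.mem_inter, Finset.mem_symmDiff]
    tauto
  · intro A hA
    rw [Finset.mem_powerset] at hA
    rw [bw, ← pow_add, ← hout A hA, Finset.card_sdiff_add_card_inter]

end

noncomputable section
set_option linter.unusedSectionVars false

/-! ### Correlation inequalities for sets of minus spins -/

variable {t : ℝ} {Λ : Finset (ℤ × ℤ)}

lemma bw_pos (ht : 0 < t) (A : Finset (ℤ × ℤ)) : 0 < bw t A := pow_pos ht _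

lemma card_bd_inter_union (A B : Finset (ℤ × ℤ)) :
    (bd (A ∩ B)).card + (bd (A ∪ B)).card ≤ (bd A).card + (bd B).card := by
  have h : ∀ C ⊆ A ∪ B, (bd C).card =
      ∑ e ∈ touchE (A ∪ B), if (e.2 ∈ C ↔ opp e ∈ C) then 0 else 1 := by
    intro C hC
    have : bd C = (touchE (A ∪ B)).filter fun e => ¬ (e.2 ∈ C ↔ opp e ∈ C) := by
      ext e
      rw [Finset.mem_filter, mem_bd, mem_touchE]
      have h1 := @hC e.2
      have h2 := @hC (opp e)
      tauto
    rw [this, Finset.card_filter]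
    exact Finset.sum_congr rfl fun e _ => by split_ifs <;> simp_all
  rw [h _ (Finset.inter_subset_left.trans Finset.subset_union_left), h _ subset_rfl,
    h A Finset.subset_union_left, h B Finset.subset_union_right, ← Finset.sum_add_distrib,
    ← Finset.sum_add_distrib]
  refine Finset.sum_le_sum fun e _ => ?_
  simp only [Finset.mem_inter, Finset.mem_union]
  by_cases h1 : e.2 ∈ A <;> by_cases h2 : e.2 ∈ B <;> by_cases h3 : opp e ∈ A <;>
    by_cases h4 : opp e ∈ B <;> simp [h1, h2, h3, h4]

lemma bw_submodular (ht : 0 < t) (ht1 : t ≤ 1) (A B : Finset (ℤ × ℤ)) :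
    bw t A * bw t B ≤ bw t (A ∩ B) * bw t (A ∪ B) := by
  rw [bw, bw, bw, bw, ← pow_add, ← pow_add]
  exact pow_le_pow_of_le_one ht.le ht1 (card_bd_inter_union A B)

open Classical in
/-- The unnormalised expectation of `g` on the event `q` for the set of minus spins in `Λ`. -/
def zg (t : ℝ) (Λ : Finset (ℤ × ℤ)) (q : Finset (ℤ × ℤ) → Prop) (g : Finset (ℤ × ℤ) → ℝ) : ℝ :=
  ∑ A ∈ Λ.powerset with q A, bw t A * g A

/-- The unnormalised weight of the event `q` for the set of minus spins in `Λ`. -/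
def zs (t : ℝ) (Λ : Finset (ℤ × ℤ)) (q : Finset (ℤ × ℤ) → Prop) : ℝ := zg t Λ q fun _ => 1

lemma zs_nonneg (ht : 0 < t) (Λ : Finset (ℤ × ℤ)) (q : Finset (ℤ × ℤ) → Prop) : 0 ≤ zs t Λ q :=
  Finset.sum_nonneg fun A _ => by rw [mul_one]; exact (bw_pos ht A).le

lemma zs_pos (ht : 0 < t) {q : Finset (ℤ × ℤ) → Prop} {A : Finset (ℤ × ℤ)} (hA : A ⊆ Λ)
    (hq : q A) : 0 < zs t Λ q :=
  Finset.sum_pos (fun A _ => by rw [mul_one]; exact bw_pos ht A)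
    ⟨A, by simp [hA, hq]⟩

lemma zs_congr {q q' : Finset (ℤ × ℤ) → Prop} (h : ∀ A ⊆ Λ, (q A ↔ q' A)) :
    zs t Λ q = zs t Λ q' := by
  classical
  unfold zs zg
  refine Finset.sum_congr (Finset.filter_congr fun A hA => h A (Finset.mem_powerset.1 hA)) ?_
  simp

lemma zs_mono (ht : 0 < t) {q q' : Finset (ℤ × ℤ) → Prop} (h : ∀ A ⊆ Λ, q A → q' A) :
    zs t Λ q ≤ zs t Λ q' := by
  classical
  unfold zs zg
  refine Finset.sum_le_sum_of_subset_of_nonneg ?_ fun A _ _ => ?_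
  · intro A hA
    simp only [Finset.mem_filter, Finset.mem_powerset] at hA ⊢
    exact ⟨hA.1, h A hA.1 hA.2⟩
  · rw [mul_one]; exact (bw_pos ht A).le

lemma zg_ite (q r : Finset (ℤ × ℤ) → Prop) [DecidablePred r] :
    zg t Λ q (fun A => if r A then 1 else 0) = zs t Λ fun A => q A ∧ r A := by
  classical
  simp only [zs, zg, Finset.sum_filter]
  refine Finset.sum_congr rfl fun A _ => ?_
  by_cases h1 : q A <;> by_cases h2 : r A <;> simp [h1, h2]

lemma zg_add (q : Finset (ℤ × ℤ) → Prop) (f g : Finset (ℤ × ℤ) → ℝ) :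
    zg t Λ q (fun A => f A + g A) = zg t Λ q f + zg t Λ q g := by
  simp only [zg, mul_add, Finset.sum_add_distrib]

lemma zg_card (q : Finset (ℤ × ℤ) → Prop) (S : Finset (ℤ × ℤ)) :
    zg t Λ q (fun A => ((A ∩ S).card : ℝ)) = ∑ x ∈ S, zs t Λ fun A => q A ∧ x ∈ A := by
  simp only [← zg_ite]
  simp only [zg]
  rw [Finset.sum_comm]
  refine Finset.sum_congr rfl fun A _ => ?_
  rw [← Finset.mul_sum, Finset.inter_comm]
  simp

lemma zs_four (ht : 0 < t) (ht1 : t ≤ 1) {q₁ q₂ q₃ q₄ : Finset (ℤ × ℤ) → Prop}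
    (h : ∀ A B, q₁ A → q₂ B → q₃ (A ∩ B) ∧ q₄ (A ∪ B)) :
    zs t Λ q₁ * zs t Λ q₂ ≤ zs t Λ q₃ * zs t Λ q₄ := by
  classical
  have hn : ∀ q : Finset (ℤ × ℤ) → Prop, (0 : Finset (ℤ × ℤ) → ℝ) ≤ fun A => if q A then bw t A else 0 := by
    intro q A
    simp only [Pi.zero_apply]
    split_ifs
    exacts [(bw_pos ht A).le, le_rfl]
  have := four_functions_theorem (fun A => if q₁ A then bw t A else 0)
    (fun A => if q₂ A then bw t A else 0) (fun A => if q₃ A then bw t A else 0)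
    (fun A => if q₄ A then bw t A else 0) (hn _) (hn _) (hn _) (hn _) (fun A B => by
      by_cases h1 : q₁ A
      · by_cases h2 : q₂ B
        · have := h A B h1 h2
          simp only [Finset.inf_eq_inter, Finset.sup_eq_union, h1, h2, this.1, this.2, if_true]
          exact bw_submodular ht ht1 A B
        · simp only [h2, if_false, mul_zero]
          exact mul_nonneg (hn _ _) (hn _ _)
      · simp only [h1, if_false, zero_mul]
        exact mul_nonneg (hn _ _) (hn _ _)) Λ.powerset Λ.powerset
  rw [Finset.powerset_infs_powerset_self, Finset.powerset_sups_powerset_self] at this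
  simpa only [zs, zg, Finset.sum_filter, mul_one] using this

lemma zg_holley (ht : 0 < t) (ht1 : t ≤ 1) {q₁ q₂ : Finset (ℤ × ℤ) → Prop}
    (h : ∀ A B, q₁ A → q₂ B → q₁ (A ∩ B) ∧ q₂ (A ∪ B)) {g : Finset (ℤ × ℤ) → ℝ} (hg : 0 ≤ g)
    (hm : Monotone g) :
    zg t Λ q₁ g * zs t Λ q₂ ≤ zs t Λ q₁ * zg t Λ q₂ g := by
  classical
  have hn : ∀ (q : Finset (ℤ × ℤ) → Prop) (g : Finset (ℤ × ℤ) → ℝ), 0 ≤ g →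
      (0 : Finset (ℤ × ℤ) → ℝ) ≤ fun A => if q A then bw t A * g A else 0 := by
    intro q g hg A
    simp only [Pi.zero_apply]
    split_ifs
    exacts [mul_nonneg (bw_pos ht A).le (hg A), le_rfl]
  have hone : (0 : Finset (ℤ × ℤ) → ℝ) ≤ fun _ => 1 := fun _ => zero_le_one
  have := four_functions_theorem (fun A => if q₁ A then bw t A * g A else 0)
    (fun A => if q₂ A then bw t A * 1 else 0) (fun A => if q₁ A then bw t A * 1 else 0)
    (fun A => if q₂ A then bw t A * g A else 0) (hn _ g hg) (hn _ _ hone) (hn _ _ hone) (hn _ g hg)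
    (fun A B => by
      by_cases h1 : q₁ A
      · by_cases h2 : q₂ B
        · have := h A B h1 h2
          simp only [Finset.inf_eq_inter, Finset.sup_eq_union, h1, h2, this.1, this.2, if_true, mul_one]
          have h3 := bw_submodular ht ht1 A B
          have h4 : g A ≤ g (A ∪ B) := hm Finset.subset_union_left
          calc bw t A * g A * bw t B = (bw t A * bw t B) * g A := by ring
            _ ≤ (bw t (A ∩ B) * bw t (A ∪ B)) * g (A ∪ B) :=
                mul_le_mul h3 h4 (hg A) (mul_pos (bw_pos ht _) (bw_pos ht _)).le
            _ = _ := by ring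
        · simp only [h2, if_false, mul_zero]
          exact mul_nonneg (hn _ _ hone _) (hn _ _ hg _)
      · simp only [h1, if_false, zero_mul]
        exact mul_nonneg (hn _ _ hone _) (hn _ _ hg _))
    Λ.powerset Λ.powerset
  rw [Finset.powerset_infs_powerset_self, Finset.powerset_sups_powerset_self] at this
  simpa only [zs, zg, Finset.sum_filter] using this

/-- Conditional expectation of `g` given `q`. -/
def ce (t : ℝ) (Λ : Finset (ℤ × ℤ)) (q : Finset (ℤ × ℤ) → Prop) (g : Finset (ℤ × ℤ) → ℝ) : ℝ :=
  zg t Λ q g / zs t Λ q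

/-- The probability that `x` is minus given that `L` is minus, minus the same probability given
that `L` is plus. -/
def dmg (t : ℝ) (Λ L : Finset (ℤ × ℤ)) (x : ℤ × ℤ) : ℝ :=
  zs t Λ (fun A => L ⊆ A ∧ x ∈ A) / zs t Λ (fun A => L ⊆ A) -
    zs t Λ (fun A => Disjoint A L ∧ x ∈ A) / zs t Λ (fun A => Disjoint A L)

lemma ce_holley (ht : 0 < t) (ht1 : t ≤ 1) {q₁ q₂ : Finset (ℤ × ℤ) → Prop}
    (h : ∀ A B, q₁ A → q₂ B → q₁ (A ∩ B) ∧ q₂ (A ∪ B)) {g : Finset (ℤ × ℤ) → ℝ} (hg : 0 ≤ g)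
    (hm : Monotone g) (h1 : 0 < zs t Λ q₁) (h2 : 0 < zs t Λ q₂) :
    ce t Λ q₁ g ≤ ce t Λ q₂ g := by
  rw [ce, ce, div_le_div_iff₀ h1 h2, mul_comm (zg t Λ q₂ g)]
  exact zg_holley ht ht1 h hg hm

lemma monotone_card_add {S : Finset (ℤ × ℤ)} {r : Finset (ℤ × ℤ) → Prop} [DecidablePred r]
    (hr : ∀ A B, A ∩ S = B ∩ S → (r A ↔ r B)) :
    Monotone fun A : Finset (ℤ × ℤ) => ((A ∩ S).card : ℝ) + if r A then 1 else 0 := by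
  intro A B hAB
  simp only
  have hsub : A ∩ S ⊆ B ∩ S := Finset.inter_subset_inter_right hAB
  by_cases h : A ∩ S = B ∩ S
  · rw [h]; simp [hr A B h]
  · have : (A ∩ S).card < (B ∩ S).card := Finset.card_lt_card ⟨hsub, fun h' => h (hsub.antisymm h')⟩
    have h' : ((A ∩ S).card : ℝ) + 1 ≤ (B ∩ S).card := by exact_mod_cast this
    split_ifs <;> linarith

/-- Covariance bound: an event on `L` and an event on `S` are nearly independent if the sites of `S`
are nearly insensitive to the spins in `L`. -/
theorem covariance_bound (ht : 0 < t) (ht1 : t ≤ 1) {L S : Finset (ℤ × ℤ)} (hL : L ⊆ Λ)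
    {q r : Finset (ℤ × ℤ) → Prop} (hq : ∀ A B, A ∩ L = B ∩ L → (q A ↔ q B))
    (hr : ∀ A B, A ∩ S = B ∩ S → (r A ↔ r B)) :
    |zs t Λ (fun A => q A ∧ r A) / zs t Λ (fun _ => True) -
      zs t Λ q / zs t Λ (fun _ => True) * (zs t Λ r / zs t Λ (fun _ => True))| ≤
      zs t Λ q / zs t Λ (fun _ => True) * (2 * ∑ x ∈ S, dmg t Λ L x) := by
  classical
  have hZ : 0 < zs t Λ (fun _ => True) := zs_pos ht (Finset.empty_subset _) trivial
  have hm : 0 < zs t Λ (fun A => L ⊆ A) := zs_pos ht hL subset_rfl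
  have hz : 0 < zs t Λ (fun A => Disjoint A L) :=
    zs_pos ht (Finset.empty_subset _) (Finset.disjoint_empty_left _)
  rcases (zs_nonneg ht Λ q).eq_or_lt with h0 | h0
  · have : zs t Λ (fun A => q A ∧ r A) = 0 :=
      le_antisymm ((zs_mono ht fun A _ h => h.1).trans h0.ge) (zs_nonneg ht _ _)
    rw [this, ← h0]; simp
  have hcard : ∀ q, ce t Λ q (fun A => ((A ∩ S).card : ℝ)) =
      ∑ x ∈ S, zs t Λ (fun A => q A ∧ x ∈ A) / zs t Λ q := by
    intro q; rw [ce, zg_card, Finset.sum_div]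
  have key : ∀ q' : Finset (ℤ × ℤ) → Prop, (∀ A B, A ∩ L = B ∩ L → (q' A ↔ q' B)) →
      0 < zs t Λ q' →
      |zs t Λ (fun A => q' A ∧ r A) / zs t Λ q' - zs t Λ (fun A => L ⊆ A ∧ r A) / zs t Λ (fun A => L ⊆ A)|
        ≤ ∑ x ∈ S, dmg t Λ L x := by
    intro q' hq' h0'
    have hu : ∀ A B, q' A → L ⊆ B → q' (A ∩ B) ∧ L ⊆ A ∪ B := by
      intro A B hA hB
      refine ⟨(hq' _ _ ?_).1 hA, hB.trans Finset.subset_union_right⟩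
      rw [Finset.inter_assoc, Finset.inter_eq_right.2 hB]
    have hd : ∀ A B, Disjoint A L → q' B → Disjoint (A ∩ B) L ∧ q' (A ∪ B) := by
      intro A B hA hB
      refine ⟨hA.mono_left Finset.inter_subset_left, (hq' _ _ ?_).1 hB⟩
      rw [Finset.union_inter_distrib_right, Finset.disjoint_iff_inter_eq_empty.1 hA,
        Finset.empty_union]
    have e1 := ce_holley ht ht1 hu (g := fun A => ((A ∩ S).card : ℝ) + if r A then 1 else 0)
      (fun A => by simp only [Pi.zero_apply]; split_ifs <;> positivity) (monotone_card_add hr) h0' hm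
    have e2 := ce_holley ht ht1 hu (g := fun A => ((A ∩ S).card : ℝ) + if ¬ r A then 1 else 0)
      (fun A => by simp only [Pi.zero_apply]; split_ifs <;> positivity)
      (monotone_card_add fun A B h => not_congr (hr A B h)) h0' hm
    have e3 := ce_holley ht ht1 hd (g := fun A => ((A ∩ S).card : ℝ) + if False then 1 else 0)
      (fun A => by simp) (monotone_card_add fun A B _ => Iff.rfl) hz h0'
    have hsplit : ∀ (p r : Finset (ℤ × ℤ) → Prop) [DecidablePred r],
        ce t Λ p (fun A => ((A ∩ S).card : ℝ) + if r A then 1 else 0) =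
        ce t Λ p (fun A => ((A ∩ S).card : ℝ)) + zs t Λ (fun A => p A ∧ r A) / zs t Λ p := by
      intro p r _
      rw [ce, zg_add, zg_ite, add_div, ce]
    have hneg : ∀ p : Finset (ℤ × ℤ) → Prop, 0 < zs t Λ p →
        zs t Λ (fun A => p A ∧ ¬ r A) / zs t Λ p = 1 - zs t Λ (fun A => p A ∧ r A) / zs t Λ p := by
      intro p hp
      rw [eq_sub_iff_add_eq, ← add_div, div_eq_one_iff_eq hp.ne', ← zg_ite, ← zg_ite, ← zg_add, zs]
      congr 1
      funext A
      by_cases h : r A <;> simp [h]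
    rw [hsplit, hsplit] at e1
    rw [hsplit, hsplit, hneg _ h0', hneg _ hm] at e2
    simp only [if_false, add_zero] at e3
    have e4 : ∑ x ∈ S, dmg t Λ L x = ce t Λ (fun A => L ⊆ A) (fun A => ((A ∩ S).card : ℝ)) -
        ce t Λ (fun A => Disjoint A L) (fun A => ((A ∩ S).card : ℝ)) := by
      rw [hcard, hcard, ← Finset.sum_sub_distrib]; rfl
    rw [e4, abs_le]
    constructor <;> linarith
  have k1 := key q hq h0
  have k2 := key (fun _ => True) (fun _ _ _ => Iff.rfl) hZ
  simp only [true_and] at k2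
  have hfac : zs t Λ (fun A => q A ∧ r A) / zs t Λ (fun _ => True) -
      zs t Λ q / zs t Λ (fun _ => True) * (zs t Λ r / zs t Λ (fun _ => True)) =
      zs t Λ q / zs t Λ (fun _ => True) *
        (zs t Λ (fun A => q A ∧ r A) / zs t Λ q - zs t Λ r / zs t Λ (fun _ => True)) := by
    field_simp
  rw [hfac, abs_mul, abs_of_pos (div_pos h0 hZ)]
  refine mul_le_mul_of_nonneg_left ?_ (div_pos h0 hZ).le
  rw [abs_le] at k1 k2 ⊢
  constructor <;> linarith

lemma dmg_mono (ht : 0 < t) (ht1 : t ≤ 1) {L K : Finset (ℤ × ℤ)} (hLK : L ⊆ K) (hK : K ⊆ Λ)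
    (x : ℤ × ℤ) : dmg t Λ L x ≤ dmg t Λ K x := by
  have hpos : ∀ L ⊆ Λ, 0 < zs t Λ (fun A => L ⊆ A) := fun L hL => zs_pos ht hL subset_rfl
  have hpos' : ∀ L, 0 < zs t Λ (fun A => Disjoint A L) := fun L =>
    zs_pos ht (Finset.empty_subset _) (Finset.disjoint_empty_left _)
  refine sub_le_sub ?_ ?_
  · rw [div_le_div_iff₀ (hpos L (hLK.trans hK)) (hpos K hK), mul_comm (zs t Λ fun A => K ⊆ A ∧ x ∈ A)]
    exact zs_four ht ht1 fun A B hA hB => ⟨Finset.subset_inter hA.1 (hLK.trans hB),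
      hB.trans Finset.subset_union_right, Finset.mem_union_left _ hA.2⟩
  · rw [div_le_div_iff₀ (hpos' K) (hpos' L), mul_comm (zs t Λ fun A => Disjoint A L ∧ x ∈ A)]
    refine zs_four ht ht1 fun A B hA hB => ⟨hA.1.mono_left Finset.inter_subset_left, ?_,
      Finset.mem_union_left _ hA.2⟩
    exact Finset.disjoint_union_left.2 ⟨hA.1.mono_right hLK, hB⟩

end

noncomputable section
set_option linter.unusedSectionVars false

/-! ### Sensitivity in terms of dual correlations -/

variable {t : ℝ} {Λ : Finset (ℤ × ℤ)}

lemma zs_minus_plus {K Y : Finset (ℤ × ℤ)} (hK : K ⊆ Λ) (hY : Disjoint K Y) :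
    zs t Λ (fun A => K ⊆ A ∧ Disjoint A Y) = ∑ A ∈ (Λ \ (K ∪ Y)).powerset, bw t (K ∪ A) := by
  classical
  rw [zs, zg]
  symm
  refine Finset.sum_bij (fun A _ => K ∪ A) ?_ ?_ ?_ ?_
  · intro A hA
    rw [Finset.mem_powerset, Finset.subset_sdiff, Finset.disjoint_union_right] at hA
    simp only [Finset.mem_filter, Finset.mem_powerset]
    exact ⟨Finset.union_subset hK hA.1, Finset.subset_union_left,
      Finset.disjoint_union_left.2 ⟨hY, hA.2.2⟩⟩
  · intro A hA B hB h
    rw [Finset.mem_powerset, Finset.subset_sdiff, Finset.disjoint_union_right] at hA hB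
    have h5 : ∀ A, Disjoint A K → A = (K ∪ A) \ K := by
      intro A hA
      rw [Finset.union_sdiff_left, Finset.sdiff_eq_self_of_disjoint hA]
    rw [h5 A hA.2.1, h5 B hB.2.1, h]
  · intro A hA
    simp only [Finset.mem_filter, Finset.mem_powerset] at hA
    refine ⟨A \ K, ?_, Finset.union_sdiff_of_subset hA.2.1⟩
    rw [Finset.mem_powerset, Finset.subset_sdiff, Finset.disjoint_union_right]
    exact ⟨Finset.sdiff_subset.trans hA.1, Finset.sdiff_disjoint,
      hA.2.2.mono_left Finset.sdiff_subset⟩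
  · intro A _
    rw [mul_one]

lemma zs_not (q r : Finset (ℤ × ℤ) → Prop) :
    zs t Λ (fun A => q A ∧ ¬ r A) = zs t Λ q - zs t Λ (fun A => q A ∧ r A) := by
  classical
  rw [eq_sub_iff_add_eq, ← zg_ite, ← zg_ite, ← zg_add, zs]
  congr 1
  funext A
  by_cases h : r A <;> simp [h]

theorem dmg_le_one_sub (ht : 0 < t) (ht1 : t ≤ 1) {K Y : Finset (ℤ × ℤ)} (hK : K ⊆ Λ)
    (hY : Disjoint K Y) {x : ℤ × ℤ} (hx : x ∈ Y) (hE : RayOut (Λ \ K)) (hS : RayOut (Λ \ (K ∪ Y)))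
    (hF : bd K \ touchE (Λ \ (K ∪ Y)) = bd K \ touchE (Λ \ K)) {a b : ℤ × ℤ}
    (hp : par (bd K \ touchE (Λ \ K)) = pr a b) :
    0 < corr t (touchE (Λ \ K)) a b ∧ dmg t Λ K x ≤
      1 - corr t (touchE (Λ \ (K ∪ Y))) a b / corr t (touchE (Λ \ K)) a b := by
  classical
  have hminus : ∀ Y, Disjoint K Y → RayOut (Λ \ (K ∪ Y)) →
      zs t Λ (fun A => K ⊆ A ∧ Disjoint A Y) = t ^ (bd K \ touchE (Λ \ (K ∪ Y))).card *
        hw t (touchE (Λ \ (K ∪ Y))) (par (bd K \ touchE (Λ \ (K ∪ Y)))) := by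
    intro Y hY hR
    rw [zs_minus_plus hK hY, duality t hR]
    exact Finset.disjoint_of_subset_left Finset.subset_union_left Finset.disjoint_sdiff
  have hplus : ∀ Y, RayOut (Λ \ Y) →
      zs t Λ (fun A => Disjoint A Y) = hw t (touchE (Λ \ Y)) 0 := by
    intro Y hR
    have := zs_minus_plus (t := t) (Λ := Λ) (K := ∅) (Y := Y) (by simp) (by simp)
    simp only [Finset.empty_subset, true_and, Finset.empty_union] at this
    have h2 := duality t hR (K := ∅) (by simp)
    have h3 : bd (∅ : Finset (ℤ × ℤ)) = ∅ := by simp [bd]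
    simp only [Finset.empty_union] at h2
    rw [this, h2, h3]
    simp [par]
  have e1 := hminus Y hY hS
  have e2 := hminus ∅ (by simp) (by simpa using hE)
  have e3 := hplus (K ∪ Y) hS
  have e4 := hplus K hE
  rw [hF, hp] at e1
  simp only [Finset.disjoint_empty_right, and_true, Finset.union_empty] at e2
  rw [hp] at e2
  have p1 : 0 < zs t Λ (fun A => K ⊆ A) := zs_pos ht hK subset_rfl
  have p2 : 0 < zs t Λ (fun A => Disjoint A K) :=
    zs_pos ht (Finset.empty_subset _) (Finset.disjoint_empty_left _)
  have p3 : 0 < zs t Λ (fun A => Disjoint A (K ∪ Y)) :=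
    zs_pos ht (Finset.empty_subset _) (Finset.disjoint_empty_left _)
  have hfkg : zs t Λ (fun A => K ⊆ A ∧ Disjoint A Y) * zs t Λ (fun A => Disjoint A K ∧ ¬ x ∈ A) ≤
      zs t Λ (fun A => Disjoint A (K ∪ Y)) * zs t Λ (fun A => K ⊆ A ∧ ¬ x ∈ A) := by
    refine zs_four ht ht1 fun A B hA hB => ⟨?_, hA.1.trans Finset.subset_union_left, ?_⟩
    · exact Finset.disjoint_union_right.2 ⟨hB.1.mono_left Finset.inter_subset_right,
        hA.2.mono_left Finset.inter_subset_left⟩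
    · rw [Finset.mem_union]
      rintro (h | h)
      · exact Finset.disjoint_left.1 hA.2 h hx
      · exact hB.2 h
  rw [zs_not, zs_not] at hfkg
  have hle : zs t Λ (fun A => Disjoint A K ∧ x ∈ A) ≤ zs t Λ (fun A => Disjoint A K) :=
    zs_mono ht fun A _ h => h.1
  have hn := zs_nonneg ht Λ (fun A => Disjoint A K ∧ x ∈ A)
  have hmono := corr_mono ht.le ht1 (S := touchE (Λ \ (K ∪ Y))) (E := touchE (Λ \ K))
    (by
      intro e he
      rw [mem_touchE] at he ⊢
      simp only [Finset.mem_sdiff, Finset.mem_union] at he ⊢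
      tauto) a b
  set f := t ^ (bd K \ touchE (Λ \ K)).card
  have hf : 0 < f := pow_pos ht _
  have hw1 : 0 < hw t (touchE (Λ \ K)) (pr a b) := by
    rw [e2] at p1; exact (mul_pos_iff_of_pos_left hf).1 p1
  rw [e4] at p2
  rw [e3] at p3
  have hcE : 0 < corr t (touchE (Λ \ K)) a b := div_pos hw1 p2
  refine ⟨hcE, ?_⟩
  set cS := corr t (touchE (Λ \ (K ∪ Y))) a b with hcS
  set cE := corr t (touchE (Λ \ K)) a b with hcE'
  have q1 : hw t (touchE (Λ \ (K ∪ Y))) (pr a b) = cS * hw t (touchE (Λ \ (K ∪ Y))) 0 := by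
    rw [hcS, corr, div_mul_cancel₀ _ p3.ne']
  have q2 : hw t (touchE (Λ \ K)) (pr a b) = cE * hw t (touchE (Λ \ K)) 0 := by
    rw [hcE', corr, div_mul_cancel₀ _ p2.ne']
  rw [dmg, e2, e4, q2]
  rw [e1, e2, e3, e4, q1, q2] at hfkg
  rw [e4] at hle
  set u := zs t Λ (fun A => K ⊆ A ∧ x ∈ A)
  set v := zs t Λ (fun A => Disjoint A K ∧ x ∈ A)
  set Z := hw t (touchE (Λ \ K)) 0
  set ZS := hw t (touchE (Λ \ (K ∪ Y))) 0
  have h1 : f * cS * (Z - v) ≤ f * (cE * Z) - u := by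
    have : ZS * (f * cS * (Z - v)) ≤ ZS * (f * (cE * Z) - u) := by linarith
    exact le_of_mul_le_mul_left this p3
  have h2 : u / (f * (cE * Z)) ≤ 1 - cS / cE * (1 - v / Z) := by
    rw [div_le_iff₀ (by positivity)]
    have : (1 - cS / cE * (1 - v / Z)) * (f * (cE * Z)) = f * (cE * Z) - f * cS * (Z - v) := by
      field_simp
    rw [this]; linarith
  have h3 : 0 ≤ v / Z := div_nonneg hn p2.le
  have h4 : cS / cE ≤ 1 := (div_le_one hcE).2 hmono
  nlinarith [mul_nonneg h3 (sub_nonneg.2 h4)]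

end

noncomputable section
set_option linter.unusedSectionVars false

/-! ### The main estimate -/

variable {t : ℝ}

/-- A form of the Simon–Lieb inequality with the boundary sum majorised along a parametrisation. -/
lemma simon_lieb_le {V ι : Type*} [DecidableEq V] (ht : 0 ≤ t) (ht1 : t ≤ 1)
    {E S : Finset (V × V)} (h : S ⊆ E) (a b : V) (C : Finset ι) (f : ι → V × V) (w : ι → ℝ)
    (h1 : ∀ e ∈ E, e ∉ S → (∃ c ∈ C, f c = e) ∨ corr t S a e.1 = 0 ∧ corr t S a e.2 = 0)
    (h2 : ∀ c ∈ C, corr t S a (f c).1 * corr t E (f c).2 b +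
      corr t S a (f c).2 * corr t E (f c).1 b ≤ w c) :
    corr t E a b ≤ corr t S a b + t * ∑ c ∈ C, w c := by
  classical
  have hsl := simon_lieb ht ht1 h a b
  set g : V × V → ℝ := fun e => corr t S a e.1 * corr t E e.2 b + corr t S a e.2 * corr t E e.1 b
    with hg
  have hg0 : ∀ e, 0 ≤ g e := fun e => add_nonneg
    (mul_nonneg (corr_nonneg ht _ _ _) (corr_nonneg ht _ _ _))
    (mul_nonneg (corr_nonneg ht _ _ _) (corr_nonneg ht _ _ _))
  have h3 : ∑ e ∈ E \ S, g e ≤ ∑ c ∈ C, w c := by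
    calc ∑ e ∈ E \ S, g e = ∑ e ∈ (E \ S).filter (fun e => g e ≠ 0), g e :=
          (Finset.sum_filter_ne_zero _).symm
      _ ≤ ∑ e ∈ C.image f, g e := by
          refine Finset.sum_le_sum_of_subset_of_nonneg (fun e he => ?_) fun e _ _ => hg0 e
          rw [Finset.mem_filter, Finset.mem_sdiff] at he
          rcases h1 e he.1.1 he.1.2 with h4 | h4
          · exact Finset.mem_image.2 h4
          · exact absurd (by simp [hg, h4.1, h4.2]) he.2
      _ ≤ ∑ c ∈ C, g (f c) := by
          have := Finset.sum_fiberwise_of_maps_to (s := C) (t := C.image f) (g := f)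
            (fun c hc => Finset.mem_image_of_mem f hc) (fun c => g (f c))
          rw [← this]
          refine Finset.sum_le_sum fun e he => ?_
          obtain ⟨c, hc, rfl⟩ := Finset.mem_image.1 he
          exact Finset.single_le_sum (f := fun c => g (f c)) (fun i _ => hg0 _)
            (Finset.mem_filter.2 ⟨hc, rfl⟩)
      _ ≤ ∑ c ∈ C, w c := Finset.sum_le_sum h2
  have := mul_le_mul_of_nonneg_left h3 ht
  linarith

/-- Record times: an exponentially decaying positive sequence has arbitrarily late indices after
which it decays at a prescribed slower rate. -/
lemma exists_record {g : ℕ → ℝ} {ρ τ : ℝ} (hg : ∀ k, 0 < g k) (hgρ : ∀ k, g k ≤ ρ ^ k)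
    (hρ : 0 < ρ) (hτ : ρ < τ) (M : ℕ) :
    ∃ m ≥ M, ∀ k, g (m + k) ≤ τ ^ k * g m := by
  have hτ0 : 0 < τ := hρ.trans hτ
  have hlim : Tendsto (fun k => (ρ / τ) ^ k) atTop (𝓝 0) :=
    tendsto_pow_atTop_nhds_zero_of_lt_one (by positivity) ((div_lt_one hτ0).2 hτ)
  obtain ⟨K, hK⟩ := (hlim.eventually_lt_const (show 0 < g M / τ ^ M by have := hg M; positivity)).exists_forall_of_atTop
  obtain ⟨m, hm, hmax⟩ := (Finset.Icc M (max M K)).exists_max_image (fun k => g k / τ ^ k)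
    ⟨M, by simp⟩
  rw [Finset.mem_Icc] at hm
  have key : ∀ k ≥ M, g k / τ ^ k ≤ g m / τ ^ m := by
    intro k hk
    by_cases hkK : k ≤ max M K
    · exact hmax k (Finset.mem_Icc.2 ⟨hk, hkK⟩)
    · have h1 := hK k (by omega)
      have h2 : g k / τ ^ k ≤ (ρ / τ) ^ k := by
        rw [div_pow]; gcongr; exact hgρ k
      have h3 := hmax M (by simp)
      linarith
  refine ⟨m, hm.1, fun k => ?_⟩
  have := key (m + k) (by omega)
  rw [div_le_div_iff₀ (by positivity) (by positivity), pow_add] at this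
  have h4 : 0 < τ ^ m := by positivity
  nlinarith

/-! #### Geometry -/

variable {N N₁ N₂ H n : ℕ}

/-- The rectangle `[-N₁,N₂] × [-N,N+H]`. -/
def slab (N N₁ N₂ H : ℕ) : Finset (ℤ × ℤ) :=
  Finset.Icc (-(N₁ : ℤ)) N₂ ×ˢ Finset.Icc (-(N : ℤ)) (N + H)

/-- Two horizontal slits at heights `0` and `H`, joined along the left side. -/
def fork (N N₁ N₂ H : ℕ) : Finset (ℤ × ℤ) :=
  (slab N N₁ N₂ H).filter fun p =>
    0 ≤ p.2 ∧ p.2 ≤ H ∧ ((p.1 < 0 ∧ (p.2 = 0 ∨ p.2 = H)) ∨ p.1 = -(N₁ : ℤ))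

/-- The segment of height `H` to the right of abscissa `n`. -/
def prong (N N₁ N₂ H n : ℕ) : Finset (ℤ × ℤ) :=
  (slab N N₁ N₂ H).filter fun p => p.2 = H ∧ (n : ℤ) ≤ p.1

/-- The dual edges left free outside the fork. -/
def forkE (N N₁ N₂ H : ℕ) : Finset ((ℤ × ℤ) × (ℤ × ℤ)) := touchE (slab N N₁ N₂ H \ fork N N₁ N₂ H)

/-- The dual edges left free outside the fork and the prong. -/
def prongE (N N₁ N₂ H n : ℕ) : Finset ((ℤ × ℤ) × (ℤ × ℤ)) :=
  touchE (slab N N₁ N₂ H \ (fork N N₁ N₂ H ∪ prong N N₁ N₂ H n))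

/-- The dual edges above the fork. -/
def upE (N N₁ N₂ H : ℕ) : Finset ((ℤ × ℤ) × (ℤ × ℤ)) :=
  gE (Finset.Icc (-(N₁ : ℤ) - 1) N₂ ×ˢ Finset.Icc (H : ℤ) (N + H))

/-- The dual edges below the fork. -/
def downE (N N₁ N₂ : ℕ) : Finset ((ℤ × ℤ) × (ℤ × ℤ)) :=
  gE (Finset.Icc (-(N₁ : ℤ) - 1) N₂ ×ˢ Finset.Icc (-(N : ℤ) - 1) (-1))

lemma mem_forkE {e : (ℤ × ℤ) × (ℤ × ℤ)} : e ∈ forkE N N₁ N₂ H ↔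
    (e.2 = (e.1.1 + 1, e.1.2) ∨ e.2 = (e.1.1, e.1.2 + 1)) ∧
      (e.2 ∈ slab N N₁ N₂ H \ fork N N₁ N₂ H ∨
        (e.1.1 + 1, e.1.2 + 1) ∈ slab N N₁ N₂ H \ fork N N₁ N₂ H) := mem_touchE

lemma mem_slab {p : ℤ × ℤ} : p ∈ slab N N₁ N₂ H ↔
    (-(N₁ : ℤ) ≤ p.1 ∧ p.1 ≤ N₂) ∧ -(N : ℤ) ≤ p.2 ∧ p.2 ≤ N + H := by
  simp [slab, Finset.mem_product]

lemma mem_slab_sdiff_fork {p : ℤ × ℤ} : p ∈ slab N N₁ N₂ H \ fork N N₁ N₂ H ↔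
    ((-(N₁ : ℤ) ≤ p.1 ∧ p.1 ≤ N₂) ∧ -(N : ℤ) ≤ p.2 ∧ p.2 ≤ N + H) ∧
    ¬ (0 ≤ p.2 ∧ p.2 ≤ H ∧ ((p.1 < 0 ∧ (p.2 = 0 ∨ p.2 = H)) ∨ p.1 = -(N₁ : ℤ))) := by
  rw [Finset.mem_sdiff, fork, Finset.mem_filter, mem_slab]
  tauto

lemma mem_slab_sdiff_prong {p : ℤ × ℤ} :
    p ∈ slab N N₁ N₂ H \ (fork N N₁ N₂ H ∪ prong N N₁ N₂ H n) ↔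
    p ∈ slab N N₁ N₂ H \ fork N N₁ N₂ H ∧ ¬ (p.2 = H ∧ (n : ℤ) ≤ p.1) := by
  simp only [Finset.mem_sdiff, Finset.mem_union, prong, Finset.mem_filter]
  tauto

lemma mem_upE {e : (ℤ × ℤ) × (ℤ × ℤ)} : e ∈ upE N N₁ N₂ H ↔
    ((-(N₁ : ℤ) - 1 ≤ e.1.1 ∧ e.1.1 ≤ N₂) ∧ (H : ℤ) ≤ e.1.2 ∧ e.1.2 ≤ N + H) ∧
    ((-(N₁ : ℤ) - 1 ≤ e.2.1 ∧ e.2.1 ≤ N₂) ∧ (H : ℤ) ≤ e.2.2 ∧ e.2.2 ≤ N + H) ∧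
    (e.2 = (e.1.1 + 1, e.1.2) ∨ e.2 = (e.1.1, e.1.2 + 1)) := by
  simp only [upE, mem_gE, Finset.mem_product, Finset.mem_Icc]

lemma mem_downE {e : (ℤ × ℤ) × (ℤ × ℤ)} : e ∈ downE N N₁ N₂ ↔
    ((-(N₁ : ℤ) - 1 ≤ e.1.1 ∧ e.1.1 ≤ N₂) ∧ -(N : ℤ) - 1 ≤ e.1.2 ∧ e.1.2 ≤ -1) ∧
    ((-(N₁ : ℤ) - 1 ≤ e.2.1 ∧ e.2.1 ≤ N₂) ∧ -(N : ℤ) - 1 ≤ e.2.2 ∧ e.2.2 ≤ -1) ∧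
    (e.2 = (e.1.1 + 1, e.1.2) ∨ e.2 = (e.1.1, e.1.2 + 1)) := by
  simp only [downE, mem_gE, Finset.mem_product, Finset.mem_Icc]

lemma upE_subset (hN : 1 ≤ N) : upE N N₁ N₂ H ⊆ forkE N N₁ N₂ H := by
  rintro ⟨⟨a, b⟩, c, d⟩ he
  rw [mem_upE] at he
  rw [mem_forkE, mem_slab_sdiff_fork, mem_slab_sdiff_fork]
  obtain ⟨h1, h2, h3⟩ := he
  refine ⟨h3, ?_⟩
  simp only [Prod.mk.injEq] at h1 h2 h3 ⊢
  omega

lemma downE_subset (hN : 1 ≤ N) : downE N N₁ N₂ ⊆ forkE N N₁ N₂ H := by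
  rintro ⟨⟨a, b⟩, c, d⟩ he
  rw [mem_downE] at he
  rw [mem_forkE, mem_slab_sdiff_fork, mem_slab_sdiff_fork]
  obtain ⟨h1, h2, h3⟩ := he
  refine ⟨h3, ?_⟩
  simp only [Prod.mk.injEq] at h1 h2 h3 ⊢
  omega

lemma prongE_subset : prongE N N₁ N₂ H n ⊆ forkE N N₁ N₂ H := by
  intro e he
  rw [prongE, mem_touchE, mem_slab_sdiff_prong, mem_slab_sdiff_prong] at he
  rw [forkE, mem_touchE]
  tauto

lemma forkE_sdiff_upE (hN₁ : 1 ≤ N₁) {e : (ℤ × ℤ) × (ℤ × ℤ)}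
    (he : e ∈ forkE N N₁ N₂ H) (he' : e ∉ upE N N₁ N₂ H) :
    (∃ c ∈ Finset.range (N₂ + 2), ((((c : ℤ) - 1, (H : ℤ) - 1), ((c : ℤ) - 1, (H : ℤ))) = e)) ∨
      e.1.2 < H ∧ e.2.2 < H := by
  obtain ⟨⟨a, b⟩, c, d⟩ := e
  rw [mem_upE] at he'
  rw [mem_forkE, mem_slab_sdiff_fork, mem_slab_sdiff_fork] at he
  obtain ⟨h3, h4⟩ := he
  simp only [Prod.mk.injEq, Finset.mem_range] at he' h3 h4 ⊢
  by_cases hb : b < H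
  · by_cases hd : d < H
    · exact Or.inr ⟨hb, hd⟩
    · refine Or.inl ⟨(a + 1).toNat, ?_, ?_⟩ <;> omega
  · exfalso; omega

lemma forkE_sdiff_downE (hN₁ : 1 ≤ N₁) {e : (ℤ × ℤ) × (ℤ × ℤ)}
    (he : e ∈ forkE N N₁ N₂ H) (he' : e ∉ downE N N₁ N₂) :
    (∃ c ∈ Finset.range (N₂ + 2), ((((c : ℤ) - 1, (-1 : ℤ)), ((c : ℤ) - 1, (0 : ℤ))) = e)) ∨
      -1 < e.1.2 ∧ -1 < e.2.2 := by
  obtain ⟨⟨a, b⟩, c, d⟩ := e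
  rw [mem_downE] at he'
  rw [mem_forkE, mem_slab_sdiff_fork, mem_slab_sdiff_fork] at he
  obtain ⟨h3, h4⟩ := he
  simp only [Prod.mk.injEq, Finset.mem_range] at he' h3 h4 ⊢
  by_cases hb : -1 < b
  · by_cases hd : -1 < d
    · exact Or.inr ⟨hb, hd⟩
    · exfalso; omega
  · refine Or.inl ⟨(a + 1).toNat, ?_, ?_⟩ <;> omega

lemma forkE_sdiff_prongE (hN : 1 ≤ N) (hH : 1 ≤ H) (hn : 1 ≤ n) (hN₁ : 1 ≤ N₁)
    {e : (ℤ × ℤ) × (ℤ × ℤ)}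
    (he : e ∈ forkE N N₁ N₂ H) (he' : e ∉ prongE N N₁ N₂ H n) :
    ∃ b ∈ Finset.Icc n N₂, (((b : ℤ), (H : ℤ) - 1), ((b : ℤ), (H : ℤ))) = e := by
  obtain ⟨⟨a, b⟩, c, d⟩ := e
  rw [prongE, mem_touchE, mem_slab_sdiff_prong, mem_slab_sdiff_prong, mem_slab_sdiff_fork,
    mem_slab_sdiff_fork] at he'
  rw [mem_forkE, mem_slab_sdiff_fork, mem_slab_sdiff_fork] at he
  obtain ⟨h3, h4⟩ := he
  simp only [Prod.mk.injEq, Finset.mem_Icc, opp] at he' h3 h4 ⊢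
  refine ⟨a.toNat, ?_⟩
  rcases h3 with ⟨rfl, rfl⟩ | ⟨rfl, rfl⟩
  · exfalso; omega
  · omega

lemma mem_fork {p : ℤ × ℤ} : p ∈ fork N N₁ N₂ H ↔
    ((-(N₁ : ℤ) ≤ p.1 ∧ p.1 ≤ N₂) ∧ -(N : ℤ) ≤ p.2 ∧ p.2 ≤ N + H) ∧
    0 ≤ p.2 ∧ p.2 ≤ H ∧ ((p.1 < 0 ∧ (p.2 = 0 ∨ p.2 = H)) ∨ p.1 = -(N₁ : ℤ)) := by
  rw [fork, Finset.mem_filter, mem_slab]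

lemma vertical_mem_forkE (hN₁ : 1 ≤ N₁) {b : ℤ} (h1 : 0 ≤ b) (h2 : b ≤ N₂) :
    ((b, (H : ℤ) - 1), (b, (H : ℤ))) ∈ forkE N N₁ N₂ H := by
  rw [mem_forkE, mem_slab_sdiff_fork, mem_slab_sdiff_fork]
  simp only [Prod.mk.injEq, or_true, true_and, and_true]
  omega

lemma fork_bd (hN : 1 ≤ N) (hN₁ : 1 ≤ N₁) (hn : 1 ≤ n) :
    bd (fork N N₁ N₂ H) \ prongE N N₁ N₂ H n = bd (fork N N₁ N₂ H) \ forkE N N₁ N₂ H ∧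
    bd (fork N N₁ N₂ H) \ forkE N N₁ N₂ H = (Finset.range (H + 1)).image
      fun u : ℕ => ((-(N₁ : ℤ) - 1, (u : ℤ) - 1), (-(N₁ : ℤ) - 1, (u : ℤ))) := by
  constructor
  · ext ⟨⟨a, b⟩, c, d⟩
    rw [Finset.mem_sdiff, Finset.mem_sdiff]
    refine and_congr_right fun h => not_congr ⟨fun h' => prongE_subset h', fun h' => ?_⟩
    rw [mem_bd] at h
    rw [prongE, mem_touchE]
    rw [mem_forkE] at h'
    refine ⟨h.1, ?_⟩
    replace h := h.2
    obtain ⟨h1, h'⟩ := h'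
    simp only [mem_slab_sdiff_prong, mem_slab_sdiff_fork, mem_fork, Prod.mk.injEq, opp] at h h1 h' ⊢
    rcases h1 with ⟨rfl, rfl⟩ | ⟨rfl, rfl⟩ <;> omega
  · ext ⟨⟨a, b⟩, c, d⟩
    rw [Finset.mem_sdiff, mem_bd, mem_forkE]
    simp only [mem_slab_sdiff_fork, mem_fork, Prod.mk.injEq, opp, Finset.mem_image,
      Finset.mem_range]
    constructor
    · rintro ⟨⟨h1 | h1, h2⟩, h3⟩
      · obtain ⟨rfl, rfl⟩ := h1; exfalso; omega
      · obtain ⟨rfl, rfl⟩ := h1; exact ⟨(b + 1).toNat, by omega⟩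
    · rintro ⟨u, hu, ⟨rfl, rfl⟩, rfl, rfl⟩
      omega

lemma par_column (x : ℤ) (m : ℕ) : par ((Finset.range (m + 1)).image
    fun u : ℕ => ((x, (u : ℤ) - 1), (x, (u : ℤ)))) = pr (x, (m : ℤ)) (x, -1) := by
  rw [par, Finset.sum_image (by intro a _ b _ h; simpa using h)]
  induction m with
  | zero => simp [pr_comm]
  | succ k ih =>
    rw [Finset.sum_range_succ, ih, add_comm, pr_comm]
    push_cast
    rw [add_sub_cancel_right, pr_add]

lemma rayOut_fork (hN₁ : 1 ≤ N₁) : RayOut (slab N N₁ N₂ H \ fork N N₁ N₂ H) := by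
  intro x u h
  simp only [mem_slab_sdiff_fork] at h ⊢
  by_cases hx : x < 0
  · exact Or.inl fun y hy => by omega
  · by_cases hu : u < -N ∨ N + H < u
    · exact Or.inl fun y hy => by omega
    · exact Or.inr fun y hy => by omega

lemma rayOut_prong (hN₁ : 1 ≤ N₁) :
    RayOut (slab N N₁ N₂ H \ (fork N N₁ N₂ H ∪ prong N N₁ N₂ H n)) := by
  intro x u h
  simp only [mem_slab_sdiff_prong, mem_slab_sdiff_fork] at h ⊢
  by_cases hx : x < 0
  · exact Or.inl fun y hy => by omega
  · by_cases hu : u < -N ∨ N + H < u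
    · exact Or.inl fun y hy => by omega
    · exact Or.inr fun y hy => by omega

end

noncomputable section
set_option linter.unusedSectionVars false

/-! #### Correlations near the fork -/

variable {t : ℝ} {N N₁ N₂ H n : ℕ}

lemma hw_reorient {V : Type*} [DecidableEq V] (t : ℝ) {E : Finset (V × V)} {ψ : V × V → V × V}
    (hψ : Set.InjOn ψ E) (hp : ∀ e ∈ E, pr (ψ e).1 (ψ e).2 = pr e.1 e.2) (d : V → ZMod 2) :
    hw t (E.image ψ) d = hw t E d := by
  classical
  have hinj : ∀ F ∈ E.powerset, Set.InjOn ψ F := fun F hF =>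
    hψ.mono (Finset.coe_subset.2 (Finset.mem_powerset.1 hF))
  rw [hw, hw, Finset.powerset_image, Finset.sum_filter, Finset.sum_filter, Finset.sum_image]
  · refine Finset.sum_congr rfl fun F hF => ?_
    rw [Finset.card_image_of_injOn (hinj F hF)]
    have : par (F.image ψ) = par F := by
      rw [par, Finset.sum_image (fun x hx y hy h => hinj F hF hx hy h), par]
      exact Finset.sum_congr rfl fun e he => hp e (Finset.mem_powerset.1 hF he)
    rw [this]
  · intro F hF F' hF' h
    ext e
    have key : ∀ F ∈ E.powerset, ∀ F' ∈ E.powerset, F.image ψ = F'.image ψ → e ∈ F → e ∈ F' := by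
      intro F hF F' hF' h he
      have h1 : ψ e ∈ F'.image ψ := h ▸ Finset.mem_image_of_mem ψ he
      obtain ⟨e', he', h2⟩ := Finset.mem_image.1 h1
      rw [← hψ (Finset.mem_powerset.1 hF' he') (Finset.mem_powerset.1 hF he) h2]
      exact he'
    exact ⟨key F hF F' hF' h, key F' hF' F hF h.symm⟩

lemma corr_reorient {V : Type*} [DecidableEq V] (t : ℝ) {E : Finset (V × V)} {ψ : V × V → V × V}
    (hψ : Set.InjOn ψ E) (hp : ∀ e ∈ E, pr (ψ e).1 (ψ e).2 = pr e.1 e.2) (a b : V) :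
    corr t (E.image ψ) a b = corr t E a b := by
  rw [corr, corr, hw_reorient t hψ hp, hw_reorient t hψ hp]

/-- The correlation along the bottom side of the rectangle `[0,k+N₂+1] × [0,N]`. -/
def sideCorr (t : ℝ) (N N₂ k : ℕ) : ℝ :=
  corr t (gE (Finset.Icc (0 : ℤ) (k + N₂ + 1) ×ˢ Finset.Icc (0 : ℤ) N)) (0, 0) ((k : ℤ), 0)

lemma sideCorr_pos (ht : 0 < t) (ht1 : t ≤ 1) (k : ℕ) : 0 < sideCorr t N N₂ k := by
  have := pow_le_corr_aux ht.le ht1 (gE (Finset.Icc (0 : ℤ) (k + N₂ + 1) ×ˢ Finset.Icc (0 : ℤ) N))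
    (0, 0) k (by
      intro i hi
      simp only [mem_gE, Finset.mem_product, Finset.mem_Icc]
      refine ⟨?_, ?_, Or.inl trivial⟩ <;> omega)
  simp only [zero_add] at this
  exact (pow_pos ht k).trans_le this

lemma sideCorr_le_pow (ht : 0 < t) (ht1 : t < 1) (hrho : Transfer.rho t < 1) (k : ℕ) :
    sideCorr t N N₂ k ≤ Transfer.rho t ^ k := by
  have := corr_le_pow ht ht1 hrho (isGrid_gE (Finset.Icc (0 : ℤ) (k + N₂ + 1) ×ˢ
    Finset.Icc (0 : ℤ) N)) (0, 0) ((k : ℤ), 0)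
  simpa [sideCorr] using this

lemma upE_eq : upE N N₁ N₂ H = (gE (Finset.Icc (0 : ℤ) (N₁ + N₂ + 1) ×ˢ Finset.Icc (0 : ℤ) N)).image
    (Prod.map (fun v : ℤ × ℤ => (v.1 - N₁ - 1, v.2 + H)) fun v : ℤ × ℤ => (v.1 - N₁ - 1, v.2 + H)) := by
  ext ⟨⟨a, b⟩, c, d⟩
  simp only [mem_upE, Finset.mem_image, mem_gE, Finset.mem_product, Finset.mem_Icc, Prod.exists,
    Prod.map_apply, Prod.mk.injEq]
  constructor
  · intro h
    exact ⟨a + N₁ + 1, b - H, c + N₁ + 1, d - H, by omega, by omega⟩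
  · rintro ⟨a', b', c', d', h, h'⟩
    omega

lemma corr_upE (t : ℝ) (N N₁ N₂ H : ℕ) (c : ℕ) :
    corr t (upE N N₁ N₂ H) (-(N₁ : ℤ) - 1, (H : ℤ)) ((c : ℤ) - 1, (H : ℤ)) =
    corr t (gE (Finset.Icc (0 : ℤ) (N₁ + N₂ + 1) ×ˢ Finset.Icc (0 : ℤ) N)) (0, 0)
      (((N₁ + c : ℕ) : ℤ), 0) := by
  have hinj : Function.Injective (fun v : ℤ × ℤ => ((v.1 - N₁ - 1, v.2 + H) : ℤ × ℤ)) := by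
    rintro ⟨a, b⟩ ⟨c, d⟩ h
    simp only [Prod.mk.injEq] at h ⊢
    omega
  rw [upE_eq, ← corr_image t hinj _ (0, 0)]
  congr 1 <;> ext <;> simp

lemma downE_eq : downE N N₁ N₂ =
    ((gE (Finset.Icc (0 : ℤ) (N₁ + N₂ + 1) ×ˢ Finset.Icc (0 : ℤ) N)).image
    (Prod.map (fun v : ℤ × ℤ => (v.1 - N₁ - 1, -1 - v.2)) fun v : ℤ × ℤ => (v.1 - N₁ - 1, -1 - v.2))).image
    (fun e => if e.1.1 = e.2.1 then (e.2, e.1) else e) := by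
  ext ⟨⟨a, b⟩, c, d⟩
  simp only [mem_downE, Finset.mem_image, mem_gE, Finset.mem_product, Finset.mem_Icc, Prod.exists,
    Prod.map_apply]
  constructor
  · intro h
    simp only [Prod.mk.injEq] at h
    by_cases hac : a = c
    · refine ⟨c, d, a, b, ⟨c + N₁ + 1, -1 - d, a + N₁ + 1, -1 - b, ?_, ?_⟩, ?_⟩
      · simp only [Prod.mk.injEq]; omega
      · simp only [Prod.mk.injEq]; omega
      · simp [hac]
    · refine ⟨a, b, c, d, ⟨a + N₁ + 1, -1 - b, c + N₁ + 1, -1 - d, ?_, ?_⟩, ?_⟩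
      · simp only [Prod.mk.injEq]; omega
      · simp only [Prod.mk.injEq]; omega
      · simp [hac]
  · rintro ⟨a₁, b₁, c₁, d₁, ⟨a', b', c', d', h, h'⟩, h''⟩
    split_ifs at h'' with h3 <;> simp only [Prod.mk.injEq] at h h' h'' ⊢ <;> omega

lemma corr_downE (t : ℝ) (N N₁ N₂ : ℕ) (c : ℕ) :
    corr t (downE N N₁ N₂) (-(N₁ : ℤ) - 1, -1) ((c : ℤ) - 1, -1) =
    corr t (gE (Finset.Icc (0 : ℤ) (N₁ + N₂ + 1) ×ˢ Finset.Icc (0 : ℤ) N)) (0, 0)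
      (((N₁ + c : ℕ) : ℤ), 0) := by
  have hinj : Function.Injective (fun v : ℤ × ℤ => ((v.1 - N₁ - 1, -1 - v.2) : ℤ × ℤ)) := by
    rintro ⟨a, b⟩ ⟨c, d⟩ h
    simp only [Prod.mk.injEq] at h ⊢
    omega
  rw [downE_eq, corr_reorient, ← corr_image t hinj _ (0, 0)]
  · congr 1 <;> ext <;> simp
  · rintro ⟨⟨a, b⟩, c, d⟩ he ⟨⟨a₁, b₁⟩, c₁, d₁⟩ he₁ h
    simp only [Finset.coe_image, Set.mem_image, Finset.mem_coe, mem_gE, Prod.exists,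
      Prod.map_apply, Prod.mk.injEq] at he he₁
    obtain ⟨p, q, r, s, h1, h2⟩ := he
    obtain ⟨p', q', r', s', h1', h2'⟩ := he₁
    replace h1 := h1.2.2
    replace h1' := h1'.2.2
    dsimp only at h
    split_ifs at h <;> simp only [Prod.mk.injEq] at h ⊢ <;> omega
  · rintro e -
    split_ifs
    · exact pr_comm _ _
    · rfl

/-- Correlations along the fork decay once `N₁` is a record time. -/
lemma rect_le_record (ht : 0 ≤ t) (ht1 : t ≤ 1) {τ : ℝ}
    (hrec : ∀ k, sideCorr t N N₂ (N₁ + k) ≤ τ ^ k * sideCorr t N N₂ N₁) (c : ℕ) :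
    corr t (gE (Finset.Icc (0 : ℤ) (N₁ + N₂ + 1) ×ˢ Finset.Icc (0 : ℤ) N)) (0, 0)
      (((N₁ + c : ℕ) : ℤ), 0) ≤ τ ^ c * sideCorr t N N₂ N₁ := by
  refine le_trans (corr_mono ht ht1 ?_ _ _) (hrec c)
  intro e he
  simp only [mem_gE, Finset.mem_product, Finset.mem_Icc] at he ⊢
  push_cast
  refine ⟨?_, ?_, he.2.2⟩ <;> omega

/-- Spreading from the tip of the fork. -/
lemma corr_forkE_up_le (ht : 0 ≤ t) (ht1 : t ≤ 1) (hN : 1 ≤ N) (hN₁ : 1 ≤ N₁) {τ : ℝ}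
    (hrec : ∀ k, sideCorr t N N₂ (N₁ + k) ≤ τ ^ k * sideCorr t N N₂ N₁)
    {z : ℤ × ℤ} (hz : z.2 < H) :
    corr t (forkE N N₁ N₂ H) (-(N₁ : ℤ) - 1, (H : ℤ)) z ≤
      t * ∑ c ∈ Finset.range (N₂ + 2), τ ^ c * sideCorr t N N₂ N₁ *
        corr t (forkE N N₁ N₂ H) ((c : ℤ) - 1, (H : ℤ) - 1) z := by
  have h0 : ∀ w : ℤ × ℤ, w.2 < H → corr t (upE N N₁ N₂ H) (-(N₁ : ℤ) - 1, (H : ℤ)) w = 0 := by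
    intro w hw
    refine corr_eq_zero _ (fun v => (H : ℤ) ≤ v.2) (fun e he => ?_) le_rfl (not_le.2 hw)
    rw [mem_upE] at he
    exact iff_of_true he.1.2.1 he.2.1.2.1
  have := simon_lieb_le ht ht1 (upE_subset (N₁ := N₁) (N₂ := N₂) (H := H) hN)
    (-(N₁ : ℤ) - 1, (H : ℤ)) z (Finset.range (N₂ + 2))
    (fun c => (((c : ℤ) - 1, (H : ℤ) - 1), ((c : ℤ) - 1, (H : ℤ))))
    (fun c => τ ^ c * sideCorr t N N₂ N₁ *
        corr t (forkE N N₁ N₂ H) ((c : ℤ) - 1, (H : ℤ) - 1) z) (fun e he he' => ?_) (fun c _ => ?_)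
  · rwa [h0 z hz, zero_add] at this
  · rcases forkE_sdiff_upE hN₁ he he' with h | h
    · exact Or.inl h
    · exact Or.inr ⟨h0 _ h.1, h0 _ h.2⟩
  · rw [h0 _ (by simp), zero_mul, zero_add]
    refine mul_le_mul_of_nonneg_right ?_ (corr_nonneg ht _ _ _)
    rw [corr_upE]
    exact rect_le_record ht ht1 hrec c

lemma corr_forkE_down_le (ht : 0 ≤ t) (ht1 : t ≤ 1) (hN : 1 ≤ N) (hN₁ : 1 ≤ N₁) {τ : ℝ}
    (hrec : ∀ k, sideCorr t N N₂ (N₁ + k) ≤ τ ^ k * sideCorr t N N₂ N₁)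
    {z : ℤ × ℤ} (hz : -1 < z.2) :
    corr t (forkE N N₁ N₂ H) (-(N₁ : ℤ) - 1, -1) z ≤
      t * ∑ c ∈ Finset.range (N₂ + 2), τ ^ c * sideCorr t N N₂ N₁ *
        corr t (forkE N N₁ N₂ H) ((c : ℤ) - 1, 0) z := by
  have h0 : ∀ w : ℤ × ℤ, -1 < w.2 → corr t (downE N N₁ N₂) (-(N₁ : ℤ) - 1, -1) w = 0 := by
    intro w hw
    refine corr_eq_zero _ (fun v => v.2 ≤ -1) (fun e he => ?_) le_rfl (not_le.2 hw)
    rw [mem_downE] at he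
    exact iff_of_true he.1.2.2 he.2.1.2.2
  have := simon_lieb_le ht ht1 (downE_subset (N₁ := N₁) (N₂ := N₂) (H := H) hN)
    (-(N₁ : ℤ) - 1, -1) z (Finset.range (N₂ + 2))
    (fun c => (((c : ℤ) - 1, -1), ((c : ℤ) - 1, 0)))
    (fun c => τ ^ c * sideCorr t N N₂ N₁ *
        corr t (forkE N N₁ N₂ H) ((c : ℤ) - 1, 0) z) (fun e he he' => ?_) (fun c _ => ?_)
  · rwa [h0 z hz, zero_add] at this
  · rcases forkE_sdiff_downE hN₁ he he' with h | h
    · exact Or.inl h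
    · exact Or.inr ⟨h0 _ h.1, h0 _ h.2⟩
  · rw [h0 ((c : ℤ) - 1, 0) (by simp), zero_mul, add_zero]
    refine mul_le_mul_of_nonneg_right ?_ (corr_nonneg ht _ _ _)
    rw [corr_downE]
    exact rect_le_record ht ht1 hrec c

end

noncomputable section
set_option linter.unusedSectionVars false

variable {t σ : ℝ} {N N₁ N₂ H n : ℕ}

lemma geom_sum_le_inv (h0 : 0 ≤ σ) (h1 : σ < 1) (m : ℕ) :
    ∑ c ∈ Finset.range m, σ ^ c ≤ (1 - σ)⁻¹ := by
  rw [← tsum_geometric_of_lt_one h0 h1]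
  exact (summable_geometric_of_lt_one h0 h1).sum_le_tsum _ fun i _ => pow_nonneg h0 i

lemma geom_sum_Icc_le (h0 : 0 ≤ σ) (h1 : σ < 1) (n m : ℕ) :
    ∑ c ∈ Finset.Icc n m, σ ^ c ≤ σ ^ n * (1 - σ)⁻¹ := by
  have : Finset.Icc n m = Finset.Ico n (m + 1) := by ext; simp
  rw [this, Finset.sum_Ico_eq_sum_range]
  simp_rw [pow_add]
  rw [← Finset.mul_sum]
  exact mul_le_mul_of_nonneg_left (geom_sum_le_inv h0 h1 _) (pow_nonneg h0 _)

lemma isGrid_forkE : IsGrid (forkE N N₁ N₂ H) := isGrid_touchE _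

lemma axisG_nonneg (ht : 0 ≤ t) (ht1 : t ≤ 1) (k : ℕ) : 0 ≤ axisG t k :=
  (pow_nonneg ht k).trans (pow_le_axisG ht ht1 k)

attribute [local irreducible] corr sideCorr

lemma corr_tip_below_le (ht : 0 < t) (ht1 : t < 1) (hrho : Transfer.rho t < 1) (hN : 1 ≤ N)
    (hN₁ : 1 ≤ N₁) (h0 : 0 < σ) (h1 : σ < 1) (hσ : Transfer.rho t ≤ σ ^ 2)
    (hrec : ∀ k, sideCorr t N N₂ (N₁ + k) ≤ (σ ^ 2) ^ k * sideCorr t N N₂ N₁) (b : ℕ) :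
    corr t (forkE N N₁ N₂ H) (-(N₁ : ℤ) - 1, (H : ℤ)) ((b : ℤ), (H : ℤ) - 1) ≤
      t * (sideCorr t N N₂ N₁ * σ ^ b * (1 - σ)⁻¹) := by
  have hs := (sideCorr_pos (N := N) (N₂ := N₂) ht ht1.le N₁).le
  refine (corr_forkE_up_le ht.le ht1.le hN hN₁ hrec (by simp)).trans ?_
  refine mul_le_mul_of_nonneg_left ?_ ht.le
  calc _ ≤ ∑ c ∈ Finset.range (N₂ + 2), sideCorr t N N₂ N₁ * σ ^ b * σ ^ c := by
        refine Finset.sum_le_sum fun c _ => ?_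
        have h2 := corr_le_pow ht ht1 hrho (isGrid_forkE (N := N) (N₁ := N₁) (N₂ := N₂) (H := H))
          ((c : ℤ) - 1, (H : ℤ) - 1) ((b : ℤ), (H : ℤ) - 1)
        have h3 := pow_le_pow_left₀ (Transfer.rho_pos ht ht1).le hσ ((b : ℤ) - ((c : ℤ) - 1)).natAbs
        have h4 : (σ ^ 2) ^ c * (σ ^ 2) ^ ((b : ℤ) - ((c : ℤ) - 1)).natAbs ≤ σ ^ b * σ ^ c := by
          rw [← pow_mul, ← pow_mul, ← pow_add, ← pow_add]
          exact pow_le_pow_of_le_one h0.le h1.le (by omega)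
        have h5 : (0 : ℝ) ≤ (σ ^ 2) ^ c := by positivity
        calc _ = sideCorr t N N₂ N₁ * ((σ ^ 2) ^ c * corr t (forkE N N₁ N₂ H)
              ((c : ℤ) - 1, (H : ℤ) - 1) ((b : ℤ), (H : ℤ) - 1)) := by ring
          _ ≤ sideCorr t N N₂ N₁ * (σ ^ b * σ ^ c) := by
              refine mul_le_mul_of_nonneg_left (le_trans ?_ h4) hs
              exact mul_le_mul_of_nonneg_left (h2.trans h3) h5
          _ = _ := by ring
    _ ≤ _ := by
        rw [← Finset.mul_sum]
        exact mul_le_mul_of_nonneg_left (geom_sum_le_inv h0.le h1 _) (by positivity)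

lemma corr_tip_above_le (ht : 0 < t) (ht1 : t < 1) (hrho : Transfer.rho t < 1) (hN : 1 ≤ N)
    (hN₁ : 1 ≤ N₁) (h0 : 0 < σ) (h1 : σ < 1) (hσ : Transfer.rho t ≤ σ ^ 2)
    (hrec : ∀ k, sideCorr t N N₂ (N₁ + k) ≤ (σ ^ 2) ^ k * sideCorr t N N₂ N₁) {b : ℕ}
    (hb : b ≤ N₂) :
    corr t (forkE N N₁ N₂ H) (-(N₁ : ℤ) - 1, (H : ℤ)) ((b : ℤ), (H : ℤ)) ≤
      sideCorr t N N₂ N₁ * σ ^ b * (1 - σ)⁻¹ := by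
  have h := corr_tip_below_le (H := H) ht ht1 hrho hN hN₁ h0 h1 hσ hrec b
  have h2 := corr_mul_le ht.le ht1.le (forkE N N₁ N₂ H) (-(N₁ : ℤ) - 1, (H : ℤ)) ((b : ℤ), (H : ℤ))
    ((b : ℤ), (H : ℤ) - 1)
  have h3 := le_corr_of_mem ht.le ht1.le
    (vertical_mem_forkE (N := N) (H := H) hN₁ (b := b) (by omega) (by exact_mod_cast hb))
  rw [corr_comm] at h3
  have h4 := mul_le_mul_of_nonneg_left h3 (corr_nonneg ht.le (forkE N N₁ N₂ H)
    (-(N₁ : ℤ) - 1, (H : ℤ)) ((b : ℤ), (H : ℤ)))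
  have h5 := (h4.trans h2).trans h
  rw [mul_comm] at h5
  exact le_of_mul_le_mul_left h5 ht

lemma corr_far_le (ht : 0 < t) (ht1 : t < 1) (hN : 1 ≤ N)
    (hN₁ : 1 ≤ N₁) (hH : 1 ≤ H) (h0 : 0 < σ) (h1 : σ < 1)
    (hrec : ∀ k, sideCorr t N N₂ (N₁ + k) ≤ (σ ^ 2) ^ k * sideCorr t N N₂ N₁) {z : ℤ × ℤ}
    (hz : z.2 = H ∨ z.2 = H - 1) :
    corr t (forkE N N₁ N₂ H) (-(N₁ : ℤ) - 1, -1) z ≤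
      sideCorr t N N₂ N₁ * axisG t H * (1 - σ)⁻¹ := by
  have hs := (sideCorr_pos (N := N) (N₂ := N₂) ht ht1.le N₁).le
  have hG := axisG_nonneg ht.le ht1.le H
  refine (corr_forkE_down_le ht.le ht1.le hN hN₁ hrec (by omega)).trans ?_
  have hG' : t * axisG t z.2.natAbs ≤ axisG t H := by
    rcases hz with hz | hz
    · rw [hz, Int.natAbs_natCast]
      exact mul_le_of_le_one_left hG ht1.le
    · have := mul_axisG_le ht ht1 (H - 1)
      rw [Nat.sub_add_cancel hH] at this
      convert this using 3
      omega
  rw [Finset.mul_sum]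
  calc _ ≤ ∑ c ∈ Finset.range (N₂ + 2), sideCorr t N N₂ N₁ * axisG t H * σ ^ c := by
        refine Finset.sum_le_sum fun c _ => ?_
        have h2 := corr_le_axisG_abs' ht ht1
          (isGrid_forkE (N := N) (N₁ := N₁) (N₂ := N₂) (H := H)) ((c : ℤ) - 1, 0) z
        simp only [sub_zero] at h2
        have h4 : (σ ^ 2) ^ c ≤ σ ^ c := by
          rw [← pow_mul]
          exact pow_le_pow_of_le_one h0.le h1.le (by omega)
        have h6 := (mul_le_mul_of_nonneg_left h2 ht.le).trans hG'
        have h7 := mul_le_mul h4 h6 (mul_nonneg ht.le (corr_nonneg ht.le _ _ _))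
          (pow_nonneg h0.le c)
        have h8 := mul_le_mul_of_nonneg_left h7 hs
        linarith
    _ ≤ _ := by
        rw [← Finset.mul_sum]
        exact mul_le_mul_of_nonneg_left (geom_sum_le_inv h0.le h1 _) (by positivity)

lemma corr_forkE_sub_prongE (ht : 0 < t) (ht1 : t < 1) (hrho : Transfer.rho t < 1) (hN : 1 ≤ N)
    (hN₁ : 1 ≤ N₁) (hH : 1 ≤ H) (hn : 1 ≤ n) (h0 : 0 < σ) (h1 : σ < 1)
    (hσ : Transfer.rho t ≤ σ ^ 2)
    (hrec : ∀ k, sideCorr t N N₂ (N₁ + k) ≤ (σ ^ 2) ^ k * sideCorr t N N₂ N₁) :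
    corr t (forkE N N₁ N₂ H) (-(N₁ : ℤ) - 1, (H : ℤ)) (-(N₁ : ℤ) - 1, -1) ≤
      corr t (prongE N N₁ N₂ H n) (-(N₁ : ℤ) - 1, (H : ℤ)) (-(N₁ : ℤ) - 1, -1) +
      2 * sideCorr t N N₂ N₁ ^ 2 * axisG t H * (1 - σ)⁻¹ ^ 3 * σ ^ n := by
  have hs := (sideCorr_pos (N := N) (N₂ := N₂) ht ht1.le N₁).le
  have hG := axisG_nonneg ht.le ht1.le H
  have hi : 0 ≤ (1 - σ)⁻¹ := inv_nonneg.2 (by linarith)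
  have key := simon_lieb_le ht.le ht1.le (prongE_subset (N := N) (N₁ := N₁) (N₂ := N₂) (H := H)
    (n := n)) (-(N₁ : ℤ) - 1, (H : ℤ)) (-(N₁ : ℤ) - 1, -1) (Finset.Icc n N₂)
    (fun b => (((b : ℤ), (H : ℤ) - 1), ((b : ℤ), (H : ℤ))))
    (fun b => 2 * sideCorr t N N₂ N₁ ^ 2 * axisG t H * (1 - σ)⁻¹ ^ 2 * σ ^ b)
    (fun e he he' => Or.inl (forkE_sdiff_prongE hN hH hn hN₁ he he')) (fun b hb => ?_)
  · refine key.trans (add_le_add_right ?_ _)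
    have h2 := geom_sum_Icc_le h0.le h1 n N₂
    rw [← Finset.mul_sum]
    refine (mul_le_of_le_one_left (mul_nonneg (by positivity)
      (Finset.sum_nonneg fun i _ => pow_nonneg h0.le i)) ht1.le).trans ?_
    calc _ ≤ 2 * sideCorr t N N₂ N₁ ^ 2 * axisG t H * (1 - σ)⁻¹ ^ 2 * (σ ^ n * (1 - σ)⁻¹) :=
          mul_le_mul_of_nonneg_left h2 (by positivity)
      _ = _ := by ring
  · rw [Finset.mem_Icc] at hb
    have e1 := corr_tip_below_le (H := H) ht ht1 hrho hN hN₁ h0 h1 hσ hrec b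
    have e2 := corr_tip_above_le (H := H) ht ht1 hrho hN hN₁ h0 h1 hσ hrec hb.2
    have e3 := corr_far_le ht ht1 hN hN₁ hH h0 h1 hrec (z := ((b : ℤ), (H : ℤ))) (Or.inl rfl)
    have e4 := corr_far_le ht ht1 hN hN₁ hH h0 h1 hrec (z := ((b : ℤ), (H : ℤ) - 1)) (Or.inr rfl)
    rw [corr_comm] at e3 e4
    have m1 := corr_mono ht.le ht1.le (prongE_subset (N := N) (N₁ := N₁) (N₂ := N₂) (H := H)
      (n := n)) (-(N₁ : ℤ) - 1, (H : ℤ)) ((b : ℤ), (H : ℤ) - 1)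
    have m2 := corr_mono ht.le ht1.le (prongE_subset (N := N) (N₁ := N₁) (N₂ := N₂) (H := H)
      (n := n)) (-(N₁ : ℤ) - 1, (H : ℤ)) ((b : ℤ), (H : ℤ))
    have hA0 : 0 ≤ sideCorr t N N₂ N₁ * σ ^ b * (1 - σ)⁻¹ := by positivity
    have e1' := e1.trans (mul_le_of_le_one_left hA0 ht1.le)
    have f1 := mul_le_mul (m1.trans e1') e3 (corr_nonneg ht.le _ _ _) hA0
    have f2 := mul_le_mul (m2.trans e2) e4 (corr_nonneg ht.le _ _ _) hA0
    refine (add_le_add f1 f2).trans (le_of_eq ?_)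
    ring

/-- Going around the fork. -/
lemma le_corr_forkE (ht : 0 < t) (ht1 : t < 1) (hN : 1 ≤ N) {s : ℕ} (hs : s ≤ N₂) :
    (sideCorr t N N₂ N₁ * t ^ (s + 1)) ^ 2 *
      corr t (forkE N N₁ N₂ H) ((s : ℤ), (H : ℤ)) ((s : ℤ), -1) ≤
    corr t (forkE N N₁ N₂ H) (-(N₁ : ℤ) - 1, (H : ℤ)) (-(N₁ : ℤ) - 1, -1) := by
  obtain ⟨E, hE⟩ : ∃ E, E = forkE N N₁ N₂ H := ⟨_, rfl⟩
  rw [← hE]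
  have hsd := (sideCorr_pos (N := N) (N₂ := N₂) ht ht1.le N₁).le
  have u1 : sideCorr t N N₂ N₁ ≤ corr t E (-(N₁ : ℤ) - 1, (H : ℤ)) (-1, (H : ℤ)) := by
    refine le_trans (le_of_eq ?_) (corr_mono ht.le ht1.le (hE ▸ upE_subset hN) _ _)
    have := corr_upE t N N₁ N₂ H 0
    simp only [Nat.cast_zero, zero_sub, add_zero] at this
    rw [this, sideCorr]
  have u2 : sideCorr t N N₂ N₁ ≤ corr t E (-(N₁ : ℤ) - 1, -1) (-1, -1) := by
    refine le_trans (le_of_eq ?_) (corr_mono ht.le ht1.le (hE ▸ downE_subset hN) _ _)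
    have := corr_downE t N N₁ N₂ 0
    simp only [Nat.cast_zero, zero_sub, add_zero] at this
    rw [this, sideCorr]
  have v1 : t ^ (s + 1) ≤ corr t E (-1, (H : ℤ)) ((s : ℤ), (H : ℤ)) := by
    have := pow_le_corr_aux ht.le ht1.le E (-1, (H : ℤ)) (s + 1) (by
      intro i hi
      rw [hE]
      refine upE_subset hN ?_
      rw [mem_upE]
      refine ⟨?_, ?_, Or.inl rfl⟩ <;> dsimp only <;> omega)
    rwa [show (-1 : ℤ) + ((s + 1 : ℕ) : ℤ) = s by push_cast; ring] at this
  have v2 : t ^ (s + 1) ≤ corr t E (-1, -1) ((s : ℤ), -1) := by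
    have := pow_le_corr_aux ht.le ht1.le E (-1, -1) (s + 1) (by
      intro i hi
      rw [hE]
      refine downE_subset hN ?_
      rw [mem_downE]
      refine ⟨?_, ?_, Or.inl rfl⟩ <;> dsimp only <;> omega)
    rwa [show (-1 : ℤ) + ((s + 1 : ℕ) : ℤ) = s by push_cast; ring] at this
  have hp : (0 : ℝ) ≤ t ^ (s + 1) := by positivity
  have w1 := (mul_le_mul u1 v1 hp (corr_nonneg ht.le _ _ _)).trans
    (corr_mul_le ht.le ht1.le E _ _ _)
  have w2 := (mul_le_mul u2 v2 hp (corr_nonneg ht.le _ _ _)).trans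
    (corr_mul_le ht.le ht1.le E _ _ _)
  rw [corr_comm t E (-(N₁ : ℤ) - 1, -1)] at w2
  have w3 := (mul_le_mul_of_nonneg_right (corr_mul_le ht.le ht1.le E (-(N₁ : ℤ) - 1, (H : ℤ))
    ((s : ℤ), (H : ℤ)) ((s : ℤ), -1)) (corr_nonneg ht.le E ((s : ℤ), -1) (-(N₁ : ℤ) - 1, -1))).trans
    (corr_mul_le ht.le ht1.le E _ _ _)
  refine le_trans ?_ w3
  have hX : 0 ≤ sideCorr t N N₂ N₁ * t ^ (s + 1) := mul_nonneg hsd hp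
  have hc := corr_nonneg ht.le E ((s : ℤ), (H : ℤ)) ((s : ℤ), -1)
  have hw := mul_le_mul_of_nonneg_right (mul_le_mul w1 w2 hX (corr_nonneg ht.le _ _ _)) hc
  refine (le_of_eq ?_).trans (hw.trans (le_of_eq ?_)) <;> ring

end

noncomputable section
set_option linter.unusedSectionVars false

variable {t σ : ℝ} {N N₁ N₂ H n s : ℕ}

/-- The dual edges crossed by the two slits (left summand) and by the left side (right summand) of
the fork. -/
def slitEdge (N₁ H : ℕ) : (ℕ × ℕ) ⊕ (ℕ × ℕ) → (ℤ × ℤ) × (ℤ × ℤ)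
  | .inl (0, k) => ((-1 - (k : ℤ), (H : ℤ) - 1), (-1 - (k : ℤ), (H : ℤ)))
  | .inl (1, k) => ((-1 - (k : ℤ), -1), (-1 - (k : ℤ), 0))
  | .inl (_, k) => ((-2 - (k : ℤ), 0), (-1 - (k : ℤ), 0))
  | .inr (0, k) => ((-(N₁ : ℤ) - 1, (k : ℤ)), (-(N₁ : ℤ), (k : ℤ)))
  | .inr (_, k) => ((-(N₁ : ℤ) - 1, (k : ℤ) - 1), (-(N₁ : ℤ) - 1, (k : ℤ)))

lemma exists_slitEdge (hN : 1 ≤ N) (hN₁ : 1 ≤ N₁) (hH : 1 ≤ H) {e : (ℤ × ℤ) × (ℤ × ℤ)}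
    (he : e ∈ touchE (slab N N₁ N₂ H)) (he' : e ∉ forkE N N₁ N₂ H) :
    ∃ c ∈ (Finset.range 3 ×ˢ Finset.range (N₁ + 2)).disjSum
      (Finset.range 2 ×ˢ Finset.range (H + 2)), slitEdge N₁ H c = e := by
  obtain ⟨⟨a, b⟩, c, d⟩ := e
  rw [mem_touchE] at he
  rw [mem_forkE] at he'
  simp only [opp, mem_slab, mem_slab_sdiff_fork, Prod.mk.injEq] at he he'
  rcases he with ⟨⟨rfl, rfl⟩ | ⟨rfl, rfl⟩, h⟩
  · simp only [true_and, and_true, true_or] at he' h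
    by_cases h3 : a = -(N₁ : ℤ) - 1
    · refine ⟨.inr (0, d.toNat), ?_, ?_⟩
      · simp; omega
      · simp [slitEdge]; omega
    · refine ⟨.inl (2, (-2 - a).toNat), ?_, ?_⟩
      · simp; omega
      · simp [slitEdge]; omega
  · simp only [true_and, and_true, or_true] at he' h
    by_cases h3 : c = -(N₁ : ℤ) - 1
    · refine ⟨.inr (1, (b + 1).toNat), ?_, ?_⟩
      · simp; omega
      · simp [slitEdge]; omega
    · by_cases h4 : b = -1
      · refine ⟨.inl (1, (-1 - c).toNat), ?_, ?_⟩
        · simp; omega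
        · simp [slitEdge]; omega
      · refine ⟨.inl (0, (-1 - c).toNat), ?_, ?_⟩
        · simp; omega
        · simp [slitEdge]; omega

attribute [local irreducible] corr

lemma slit_term_le (ht : 0 < t) (ht1 : t < 1) (hrho : Transfer.rho t < 1)
    {E F : Finset ((ℤ × ℤ) × (ℤ × ℤ))} (hE : IsGrid E) (hF : IsGrid F) {u v : ℤ × ℤ} {k : ℕ}
    (hu : u.1 ≤ -1 - k) (hv : v.1 ≤ -1 - k) (hH : 1 ≤ H)
    (h : (v.2 = H - 1 ∨ v.2 = H) ∨ u.2 = -1 ∨ u.2 = 0) :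
    corr t E ((s : ℤ), (H : ℤ)) u * corr t F v ((s : ℤ), -1) ≤
      Transfer.rho t ^ (s + 1 + k) * (axisG t (H + 1) / t) := by
  have hρ := (Transfer.rho_pos ht ht1).le
  have hG : ∀ m : ℕ, m = H ∨ m = H + 1 → axisG t m ≤ axisG t (H + 1) / t := by
    rintro m (rfl | rfl)
    · rw [le_div_iff₀ ht, mul_comm]
      exact mul_axisG_le ht ht1 _
    · rw [le_div_iff₀ ht]
      exact mul_le_of_le_one_right (axisG_nonneg ht.le ht1.le _) ht1.le
  have a1 := (corr_le_pow ht ht1 hrho hE ((s : ℤ), (H : ℤ)) u).trans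
    (pow_le_pow_of_le_one (m := s + 1 + k) hρ hrho.le (by dsimp only; omega))
  have b1 := (corr_le_pow ht ht1 hrho hF v ((s : ℤ), -1)).trans
    (pow_le_pow_of_le_one (m := s + 1 + k) hρ hrho.le (by dsimp only; omega))
  have a2 := corr_le_axisG_abs' ht ht1 hE ((s : ℤ), (H : ℤ)) u
  have b2 := corr_le_axisG_abs' ht ht1 hF v ((s : ℤ), -1)
  rcases h with h | h
  · exact mul_le_mul a1 (b2.trans (hG _ (by dsimp only; omega))) (corr_nonneg ht.le _ _ _)
      (pow_nonneg hρ _)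
  · rw [mul_comm]
    exact mul_le_mul b1 (a2.trans (hG _ (by dsimp only; omega))) (corr_nonneg ht.le _ _ _)
      (pow_nonneg hρ _)

lemma side_term_le (ht : 0 < t) (ht1 : t < 1) (hrho : Transfer.rho t < 1)
    {E F : Finset ((ℤ × ℤ) × (ℤ × ℤ))} (hE : IsGrid E) {u v w : ℤ × ℤ}
    (hu : u.1 ≤ -N₁) {y : ℤ} :
    corr t E ((s : ℤ), y) u * corr t F v w ≤ Transfer.rho t ^ N₁ := by
  have a1 := (corr_le_pow ht ht1 hrho hE ((s : ℤ), y) u).trans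
    (pow_le_pow_of_le_one (m := N₁) (Transfer.rho_pos ht ht1).le hrho.le (by dsimp only; omega))
  have := mul_le_mul a1 (corr_le_one ht.le ht1.le F v w) (corr_nonneg ht.le _ _ _)
    (pow_nonneg (Transfer.rho_pos ht ht1).le _)
  rwa [mul_one] at this

/-- Removing the fork hardly changes correlations far to the right of it. -/
lemma corr_slab_le (ht : 0 < t) (ht1 : t < 1) (hrho : Transfer.rho t < 1) (hN : 1 ≤ N)
    (hN₁ : 1 ≤ N₁) (hH : 1 ≤ H) :
    corr t (touchE (slab N N₁ N₂ H)) ((s : ℤ), (H : ℤ)) ((s : ℤ), -1) ≤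
      corr t (forkE N N₁ N₂ H) ((s : ℤ), (H : ℤ)) ((s : ℤ), -1) +
      (6 * Transfer.rho t ^ (s + 1) * (1 - Transfer.rho t)⁻¹ / t * axisG t (H + 1) +
        4 * (H + 2) * Transfer.rho t ^ N₁) := by
  have hρ := Transfer.rho_pos ht ht1
  have hS : forkE N N₁ N₂ H ⊆ touchE (slab N N₁ N₂ H) := by
    intro e he
    rw [forkE, mem_touchE] at he
    rw [mem_touchE]
    exact ⟨he.1, he.2.imp (fun h => (Finset.mem_sdiff.1 h).1) fun h => (Finset.mem_sdiff.1 h).1⟩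
  have hF := isGrid_touchE (slab N N₁ N₂ H)
  have hE := isGrid_forkE (N := N) (N₁ := N₁) (N₂ := N₂) (H := H)
  have hG := axisG_nonneg ht.le ht1.le (H + 1)
  have key := simon_lieb_le ht.le ht1.le hS ((s : ℤ), (H : ℤ)) ((s : ℤ), -1)
    ((Finset.range 3 ×ˢ Finset.range (N₁ + 2)).disjSum (Finset.range 2 ×ˢ Finset.range (H + 2)))
    (slitEdge N₁ H)
    (Sum.elim (fun c => 2 * (Transfer.rho t ^ (s + 1 + c.2) * (axisG t (H + 1) / t)))
      fun _ => 2 * Transfer.rho t ^ N₁)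
    (fun e he he' => Or.inl (exists_slitEdge hN hN₁ hH he he')) (fun c _ => ?_)
  · refine key.trans (add_le_add_right ?_ _)
    rw [Finset.sum_disjSum]
    simp only [Sum.elim_inl, Sum.elim_inr, Finset.sum_product, Finset.sum_const, Finset.card_range,
      Finset.card_product, nsmul_eq_mul]
    have hsum : ∑ k ∈ Finset.range (N₁ + 2),
        2 * (Transfer.rho t ^ (s + 1 + k) * (axisG t (H + 1) / t)) ≤
        2 * (axisG t (H + 1) / t) * Transfer.rho t ^ (s + 1) * (1 - Transfer.rho t)⁻¹ := by
      have h := geom_sum_le_inv hρ.le hrho (N₁ + 2)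
      have h0 : 0 ≤ 2 * (axisG t (H + 1) / t) * Transfer.rho t ^ (s + 1) := by positivity
      refine le_trans (le_of_eq ?_) (mul_le_mul_of_nonneg_left h h0)
      rw [Finset.mul_sum]
      exact Finset.sum_congr rfl fun k _ => by rw [pow_add]; ring
    have h3 : 0 ≤ ∑ k ∈ Finset.range (N₁ + 2),
        2 * (Transfer.rho t ^ (s + 1 + k) * (axisG t (H + 1) / t)) :=
      Finset.sum_nonneg fun _ _ => by positivity
    refine (mul_le_of_le_one_left (by positivity) ht1.le).trans ?_
    push_cast
    have : 6 * Transfer.rho t ^ (s + 1) * (1 - Transfer.rho t)⁻¹ / t * axisG t (H + 1) =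
      3 * (2 * (axisG t (H + 1) / t) * Transfer.rho t ^ (s + 1) * (1 - Transfer.rho t)⁻¹) := by ring
    linarith
  · rcases c with ⟨_ | _ | j, k⟩ | ⟨_ | j, k⟩
    iterate 3
      exact (add_le_add
        (slit_term_le ht ht1 hrho hE hF (by simp [slitEdge]) (by simp [slitEdge]) hH
          (by simp [slitEdge]))
        (slit_term_le ht ht1 hrho hE hF (by simp [slitEdge]) (by simp [slitEdge]) hH
          (by simp [slitEdge]))).trans_eq (two_mul _).symm
    iterate 2
      exact (add_le_add (side_term_le ht ht1 hrho hE (by simp [slitEdge]))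
        (side_term_le ht ht1 hrho hE (by simp [slitEdge]))).trans_eq (two_mul _).symm

/-- In large slabs the correlation approaches its infinite-volume value. -/
lemma exists_le_corr_slab (ht : 0 < t) (ht1 : t < 1) (H s : ℕ) :
    ∃ M : ℕ, ∀ N ≥ M, ∀ N₁ ≥ M, ∀ N₂ ≥ M,
      axisG t (H + 1) / 2 ≤ corr t (touchE (slab N N₁ N₂ H)) ((s : ℤ), (H : ℤ)) ((s : ℤ), -1) := by
  have hG : 0 < axisG t (H + 1) := (pow_pos ht _).trans_le (pow_le_axisG ht.le ht1.le _)
  obtain ⟨_, ⟨E, hE, rfl⟩, hlt⟩ := exists_lt_of_lt_csSup (s := {r | ∃ E, IsGrid E ∧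
      r = corr t E (0, 0) (((H + 1 : ℕ) : ℤ), 0)}) ⟨_, ∅, by simp [IsGrid], rfl⟩
      (half_lt_self hG)
  obtain ⟨M, hM⟩ := exists_coord_bound (ends E)
  refine ⟨M + s + 2, fun N hN N₁ hN₁ N₂ hN₂ => ?_⟩
  have hinj : Function.Injective fun v : ℤ × ℤ => (v.2 + s, v.1 - 1) := by
    rintro ⟨a, b⟩ ⟨c, d⟩ h
    simp only [Prod.mk.injEq] at h ⊢
    omega
  have := corr_image t hinj E (((H + 1 : ℕ) : ℤ), 0) (0, 0)
  rw [corr_comm] at hlt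
  rw [← this] at hlt
  simp only [Nat.cast_add, Nat.cast_one, add_sub_cancel_right, zero_add, zero_sub] at hlt
  refine hlt.le.trans (corr_mono ht.le ht1.le ?_ _ _)
  intro e he
  obtain ⟨⟨⟨a, b⟩, c, d⟩, hmem, rfl⟩ := Finset.mem_image.1 he
  have h1 := hM _ (fst_mem_ends hmem)
  have h2 := hM _ (snd_mem_ends hmem)
  have h3 := hE _ hmem
  simp only [Prod.map, mem_touchE, mem_slab, opp, Prod.mk.injEq] at h1 h2 h3 ⊢
  omega

end

noncomputable section
set_option linter.unusedSectionVars false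

variable {t : ℝ}

lemma one_sub_div_le {D W g G I p u X : ℝ} (hD : 0 < D) (hI : 0 ≤ I) (hp : 0 < p)
    (ht : 0 < t) (hu : 0 ≤ u) (h1 : D ≤ W + 2 * g ^ 2 * G * I * u) (h2 : (g * p) ^ 2 * X ≤ D)
    (h3 : t * G / 4 ≤ X) : 1 - W / D ≤ 8 * I / (p ^ 2 * t) * u := by
  have h4 : (g * p) ^ 2 * (t * G / 4) ≤ D :=
    (mul_le_mul_of_nonneg_left h3 (by positivity)).trans h2
  have h5 : 2 * g ^ 2 * G * I * u ≤ 8 * I / (p ^ 2 * t) * u * D := by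
    refine le_trans (le_of_eq ?_) (mul_le_mul_of_nonneg_left h4
      (by positivity : 0 ≤ 8 * I / (p ^ 2 * t) * u))
    field_simp
    ring
  rw [sub_le_iff_le_add, ← sub_le_iff_le_add', le_div_iff₀ hD]
  linarith

attribute [local irreducible] corr sideCorr in
/-- Damage from the fork decays exponentially along the upper prong. -/
theorem exists_dmg_fork_le (ht : 0 < t) (hrho2 : t ^ 2 + 2 * t < 1) :
    ∃ C σ : ℝ, 0 ≤ C ∧ 0 < σ ∧ σ < 1 ∧ ∀ N₀ H n : ℕ, 1 ≤ H → 1 ≤ n → ∃ N N₁ N₂ : ℕ,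
      N₀ ≤ N ∧ N₀ ≤ N₁ ∧ N₀ ≤ N₂ ∧
        dmg t (slab N N₁ N₂ H) (fork N N₁ N₂ H) ((n : ℤ), (H : ℤ)) ≤ C * σ ^ n := by
  have hrho := Transfer.rho_lt_one ht hrho2
  have ht1 : t < 1 := by nlinarith
  have hρ := Transfer.rho_pos ht ht1
  obtain ⟨ρ, hρdef⟩ : ∃ ρ, ρ = Transfer.rho t := ⟨_, rfl⟩
  rw [← hρdef] at hρ hrho
  have hpow := tendsto_pow_atTop_nhds_zero_of_lt_one hρ.le hrho
  obtain ⟨s, hs⟩ : ∃ s : ℕ, 6 * ρ ^ (s + 1) * (1 - ρ)⁻¹ / t ≤ 1 / 8 := by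
    have : Tendsto (fun s : ℕ => 6 * ρ ^ (s + 1) * (1 - ρ)⁻¹ / t) atTop
        (𝓝 (6 * 0 * (1 - ρ)⁻¹ / t)) :=
      (((hpow.comp (tendsto_add_atTop_nat 1)).const_mul 6).mul_const _).div_const _
    rw [mul_zero, zero_mul, zero_div] at this
    exact (this.eventually_le_const (by norm_num)).exists
  refine ⟨8 * (1 - (1 + ρ) / 2)⁻¹ ^ 3 / ((t ^ (s + 1)) ^ 2 * t), (1 + ρ) / 2, ?_, by linarith,
    by linarith, fun N₀ H n hH hn => ?_⟩
  · have : 0 < 1 - (1 + ρ) / 2 := by linarith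
    positivity
  obtain ⟨σ, hσ⟩ : ∃ σ, σ = (1 + ρ) / 2 := ⟨_, rfl⟩
  rw [← hσ]
  have h0 : 0 < σ := by linarith
  have h1 : σ < 1 := by linarith
  have hρσ : ρ < σ ^ 2 := by rw [hσ]; nlinarith [sq_pos_of_pos (sub_pos.2 hrho)]
  have hGpow := pow_le_axisG ht.le ht1.le (H + 1)
  have hG := axisG_nonneg ht.le ht1.le H
  obtain ⟨M, hM⟩ := exists_le_corr_slab ht ht1 H s
  obtain ⟨M', hM'⟩ : ∃ M' : ℕ, ∀ m ≥ M', 4 * (H + 2) * ρ ^ m ≤ t ^ (H + 1) / 8 := by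
    have : Tendsto (fun m : ℕ => 4 * ((H : ℝ) + 2) * ρ ^ m) atTop (𝓝 (4 * ((H : ℝ) + 2) * 0)) :=
      hpow.const_mul _
    rw [mul_zero] at this
    exact (this.eventually_le_const (by positivity)).exists_forall_of_atTop
  obtain ⟨N₁, hN₁, hrec⟩ := exists_record (g := sideCorr t (M + N₀ + 1) (M + N₀ + n + s))
    (fun k => sideCorr_pos ht ht1.le k)
    (fun k => hρdef ▸ sideCorr_le_pow ht ht1 (hρdef ▸ hrho) k) hρ hρσ (M + M' + N₀ + 1)
  obtain ⟨N, hN⟩ : ∃ N, N = M + N₀ + 1 := ⟨_, rfl⟩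
  obtain ⟨N₂, hN₂⟩ : ∃ N₂, N₂ = M + N₀ + n + s := ⟨_, rfl⟩
  rw [← hN, ← hN₂] at hrec
  refine ⟨N, N₁, N₂, by omega, by omega, by omega, ?_⟩
  have hgeo := fork_bd (N := N) (N₁ := N₁) (N₂ := N₂) (H := H) (n := n) (by omega) (by omega) hn
  have hx : ((n : ℤ), (H : ℤ)) ∈ prong N N₁ N₂ H n := by
    rw [prong, Finset.mem_filter, mem_slab]
    dsimp only
    omega
  have hdisj : Disjoint (fork N N₁ N₂ H) (prong N N₁ N₂ H n) := by
    rw [Finset.disjoint_left]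
    intro p hp hp'
    simp only [fork, prong, Finset.mem_filter] at hp hp'
    omega
  obtain ⟨hpos, hd⟩ := dmg_le_one_sub (t := t) ht ht1.le (Finset.filter_subset _ _) hdisj hx
    (rayOut_fork (N := N) (N₁ := N₁) (N₂ := N₂) (H := H) (by omega))
    (rayOut_prong (N := N) (N₁ := N₁) (N₂ := N₂) (H := H) (by omega))
    hgeo.1 (hgeo.2 ▸ par_column _ _)
  refine hd.trans ?_
  have key := corr_slab_le (s := s) (N₂ := N₂) ht ht1 (hρdef ▸ hrho) (N := N) (N₁ := N₁) (by omega)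
    (by omega) hH
  rw [← hρdef] at key
  have key2 := hM N (by omega) N₁ (by omega) N₂ (by omega)
  have key3 := mul_le_mul_of_nonneg_right hs (axisG_nonneg ht.le ht1.le (H + 1))
  have key4 := hM' N₁ (by omega)
  have key5 := mul_axisG_le ht ht1 H
  refine one_sub_div_le (t := t) hpos (pow_nonneg (inv_nonneg.2 (by linarith)) 3) (pow_pos ht _) ht
    (pow_nonneg h0.le n) (corr_forkE_sub_prongE ht ht1 (hρdef ▸ hrho) (by omega) (by omega) hH hn
      h0 h1 (hρdef ▸ hρσ.le) hrec) (le_corr_forkE ht ht1 (by omega) (s := s) (by omega)) ?_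
  linarith

end

noncomputable section
set_option linter.unusedSectionVars false

variable {t : ℝ} {Λ : Finset (ℤ × ℤ)}

lemma mem_nbrs {x y : ℤ × ℤ} : y ∈ nbrs x ↔
    y = (x.1 + 1, x.2) ∨ y = (x.1 - 1, x.2) ∨ y = (x.1, x.2 + 1) ∨ y = (x.1, x.2 - 1) := by
  simp [nbrs]

lemma mem_nbrs_comm {x y : ℤ × ℤ} : y ∈ nbrs x ↔ x ∈ nbrs y := by
  obtain ⟨a, b⟩ := x
  obtain ⟨c, d⟩ := y
  simp only [mem_nbrs, Prod.mk.injEq]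
  omega

/-- The boundary of `A` counts the neighbour pairs separated by `A`. -/
lemma card_bd (A : Finset (ℤ × ℤ)) :
    (bd A).card = ∑ x ∈ A, ((nbrs x).filter fun y => y ∉ A).card := by
  rw [← Finset.card_sigma]
  refine Finset.card_bij (fun e _ => if e.2 ∈ A then ⟨e.2, opp e⟩ else ⟨opp e, e.2⟩) ?_ ?_ ?_
  · rintro ⟨⟨a, b⟩, c, d⟩ h
    rw [mem_bd] at h
    simp only [opp, Prod.mk.injEq] at h ⊢
    have h1 : ((a + 1, b + 1) : ℤ × ℤ) ∈ nbrs (c, d) := by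
      simp only [mem_nbrs, Prod.mk.injEq]
      omega
    split_ifs with h2
    · simp only [h2, true_iff] at h
      simp [h1, h2, h.2]
    · simp only [h2, false_iff, not_not] at h
      simp [mem_nbrs_comm.1 h1, h2, h.2]
  · rintro ⟨⟨a, b⟩, c, d⟩ h ⟨⟨a', b'⟩, c', d'⟩ h' heq
    rw [mem_bd] at h h'
    simp only [opp, Prod.mk.injEq] at h h' heq ⊢
    split_ifs at heq <;> simp only [Sigma.mk.injEq, heq_eq_eq, Prod.mk.injEq] at heq <;> omega
  · rintro ⟨⟨a, b⟩, c, d⟩ h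
    simp only [Finset.mem_sigma, Finset.mem_filter, mem_nbrs] at h
    obtain ⟨ha, hc, hn⟩ := h
    rcases hc with hc | hc | hc | hc <;> rw [Prod.mk.injEq] at hc <;> obtain ⟨rfl, rfl⟩ := hc
    · exact ⟨((a, d - 1), (a, d)), by simp [mem_bd, opp, ha, hn], by simp [opp, ha]⟩
    · exact ⟨((a - 1, d - 1), (a - 1, d)), by simp [mem_bd, opp, ha, hn], by simp [opp, hn]⟩
    · exact ⟨((c - 1, b), (c, b)), by simp [mem_bd, opp, ha, hn], by simp [opp, ha]⟩
    · exact ⟨((c - 1, b - 1), (c, b - 1)), by simp [mem_bd, opp, ha, hn], by simp [opp, hn]⟩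

/-! #### Lattice symmetries -/

section Symmetry

variable {φ : ℤ × ℤ ≃ ℤ × ℤ} (hφ : ∀ x, nbrs (φ x) = (nbrs x).image φ)
include hφ

lemma card_bd_image (A : Finset (ℤ × ℤ)) : (bd (A.image φ)).card = (bd A).card := by
  rw [card_bd, card_bd, Finset.sum_image φ.injective.injOn]
  refine Finset.sum_congr rfl fun x _ => ?_
  rw [hφ, Finset.filter_image, Finset.card_image_of_injective _ φ.injective]
  simp [φ.injective.mem_finset_image]

lemma zs_image (q : Finset (ℤ × ℤ) → Prop) :
    zs t (Λ.image φ) q = zs t Λ fun A => q (A.image φ) := by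
  classical
  unfold zs zg
  rw [Finset.sum_filter, Finset.sum_filter, Finset.powerset_image,
    Finset.sum_image (Finset.image_injective φ.injective).injOn]
  refine Finset.sum_congr rfl fun A _ => ?_
  rw [bw, bw, card_bd_image hφ]

lemma dmg_image (L : Finset (ℤ × ℤ)) (x : ℤ × ℤ) :
    dmg t (Λ.image φ) (L.image φ) (φ x) = dmg t Λ L x := by
  rw [dmg, dmg, zs_image hφ, zs_image hφ, zs_image hφ, zs_image hφ]
  simp only [Finset.image_subset_image_iff φ.injective, φ.injective.mem_finset_image,
    Finset.disjoint_image φ.injective]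

end Symmetry

lemma nbrs_translate (h : ℤ) (x : ℤ × ℤ) :
    nbrs (Equiv.prodCongr (Equiv.refl ℤ) (Equiv.addRight h) x) =
      (nbrs x).image (Equiv.prodCongr (Equiv.refl ℤ) (Equiv.addRight h)) := by
  simp [nbrs, Finset.image_insert, add_right_comm, sub_add_eq_add_sub]

lemma nbrs_reflect (x : ℤ × ℤ) :
    nbrs (Equiv.prodCongr (Equiv.refl ℤ) (Equiv.neg ℤ) x) =
      (nbrs x).image (Equiv.prodCongr (Equiv.refl ℤ) (Equiv.neg ℤ)) := by
  ext ⟨a, b⟩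
  simp only [mem_nbrs, Finset.mem_image, Prod.exists, Equiv.prodCongr_apply, Prod.map,
    Equiv.refl_apply, Equiv.neg_apply, Prod.mk.injEq]
  constructor
  · intro h
    exact ⟨a, -b, by omega, rfl, by omega⟩
  · rintro ⟨c, d, h, rfl, rfl⟩
    omega

/-! #### Damage seen from the negative half line -/

/-- The sites `-m, …, -1` of the line. -/
def halfLine (m : ℕ) : Finset (ℤ × ℤ) := Finset.Icc (-(m : ℤ)) (-1) ×ˢ {0}

lemma mem_halfLine {m : ℕ} {p : ℤ × ℤ} : p ∈ halfLine m ↔ (-(m : ℤ) ≤ p.1 ∧ p.1 ≤ -1) ∧ p.2 = 0 := by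
  rw [halfLine, Finset.mem_product, Finset.mem_Icc, Finset.mem_singleton]

lemma exists_dmg_halfLine_of_nonneg (ht : 0 < t) (ht1 : t < 1) {C σ : ℝ}
    (h : ∀ N₀ H n : ℕ, 1 ≤ H → 1 ≤ n → ∃ N N₁ N₂ : ℕ, N₀ ≤ N ∧ N₀ ≤ N₁ ∧ N₀ ≤ N₂ ∧
      dmg t (slab N N₁ N₂ H) (fork N N₁ N₂ H) ((n : ℤ), (H : ℤ)) ≤ C * σ ^ n)
    (m N₀ n y : ℕ) (hn : 1 ≤ n) :
    ∃ Λ : Finset (ℤ × ℤ), (∀ p : ℤ × ℤ, |p.1| ≤ N₀ → |p.2| ≤ N₀ → p ∈ Λ) ∧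
      dmg t Λ (halfLine m) ((n : ℤ), (y : ℤ)) ≤ C * σ ^ n := by
  rcases Nat.eq_zero_or_pos y with rfl | hy
  · obtain ⟨N, N₁, N₂, h1, h2, h3, hd⟩ := h (N₀ + m + 1) 1 n le_rfl hn
    refine ⟨(slab N N₁ N₂ 1).image (Equiv.prodCongr (Equiv.refl ℤ) (Equiv.addRight (-1))), ?_, ?_⟩
    · rintro ⟨a, b⟩ ha hb
      simp only [Finset.mem_image, mem_slab, abs_le] at ha hb ⊢
      exact ⟨(a, b + 1), by dsimp only; push_cast; omega, by simp⟩
    · refine le_trans ?_ hd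
      have himg := dmg_image (t := t) (Λ := slab N N₁ N₂ 1) (nbrs_translate (-1)) (fork N N₁ N₂ 1)
        ((n : ℤ), ((1 : ℕ) : ℤ))
      rw [← himg]
      have hsub : halfLine m ⊆
          (fork N N₁ N₂ 1).image (Equiv.prodCongr (Equiv.refl ℤ) (Equiv.addRight (-1))) := by
        rintro ⟨a, b⟩ h
        simp only [mem_halfLine, Finset.mem_image, mem_fork] at h ⊢
        exact ⟨(a, ((1 : ℕ) : ℤ)), by dsimp only; omega, by simp [h.2]⟩
      have := dmg_mono ht ht1.le hsub (Finset.image_subset_image (Finset.filter_subset _ _))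
        ((n : ℤ), 0)
      simpa using this
  · obtain ⟨N, N₁, N₂, h1, h2, h3, hd⟩ := h (N₀ + m + 1) y n hy hn
    refine ⟨slab N N₁ N₂ y, ?_, ?_⟩
    · rintro ⟨a, b⟩ ha hb
      simp only [mem_slab, abs_le] at ha hb ⊢
      omega
    · refine (dmg_mono (K := fork N N₁ N₂ y) ht ht1.le ?_ (Finset.filter_subset _ _) _).trans hd
      rintro ⟨a, b⟩ h
      simp only [mem_halfLine, mem_fork] at h ⊢
      omega

/-- Exponential decay of the damage in arbitrarily large volumes. -/
theorem exists_dmg_halfLine_le (ht : 0 < t) (hrho : t ^ 2 + 2 * t < 1) :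
    ∃ C σ : ℝ, 0 ≤ C ∧ 0 < σ ∧ σ < 1 ∧ ∀ (m n : ℕ) (y : ℤ) (Δ : Finset (ℤ × ℤ)), 1 ≤ n →
      ∃ Λ, Δ ⊆ Λ ∧ dmg t Λ (halfLine m) ((n : ℤ), y) ≤ C * σ ^ n := by
  have ht1 : t < 1 := by nlinarith
  obtain ⟨C, σ, hC, h0, h1, h⟩ := exists_dmg_fork_le ht hrho
  refine ⟨C, σ, hC, h0, h1, fun m n y Δ hn => ?_⟩
  obtain ⟨N₀, hN₀⟩ := exists_coord_bound Δ
  obtain ⟨Λ, hΛ, hd⟩ := exists_dmg_halfLine_of_nonneg ht ht1 h m N₀ n y.natAbs hn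
  rcases Int.natAbs_eq y with hy | hy
  · refine ⟨Λ, fun p hp => hΛ p ?_ ?_, hy ▸ hd⟩ <;> have := hN₀ p hp <;> rw [abs_le] <;> omega
  · refine ⟨Λ.image (Equiv.prodCongr (Equiv.refl ℤ) (Equiv.neg ℤ)), fun p hp => ?_, ?_⟩
    · refine Finset.mem_image.2 ⟨(p.1, -p.2), hΛ _ ?_ ?_, by simp⟩ <;> have := hN₀ p hp <;>
        rw [abs_le] <;> dsimp only <;> omega
    · rw [← dmg_image nbrs_reflect] at hd
      convert hd using 2
      · ext ⟨a, b⟩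
        simp only [mem_halfLine, Finset.mem_image, Prod.exists, Equiv.prodCongr_apply, Prod.map,
          Equiv.refl_apply, Equiv.neg_apply, Prod.mk.injEq]
        constructor
        · intro h
          exact ⟨a, 0, by omega, rfl, by omega⟩
        · rintro ⟨c, d, h, rfl, rfl⟩
          omega
      · exact Prod.ext rfl hy

end

noncomputable section
set_option linter.unusedSectionVars false

/-! #### Infinite-volume limits -/

variable {t : ℝ} {Λ Λ' : Finset (ℤ × ℤ)}

/-- The probability of `q` for the set of minus spins in `Λ` with plus boundary conditions. -/
def zp (t : ℝ) (Λ : Finset (ℤ × ℤ)) (q : Finset (ℤ × ℤ) → Prop) : ℝ :=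
  zs t Λ q / zs t Λ fun _ => True

lemma zs_true_pos (ht : 0 < t) (Λ : Finset (ℤ × ℤ)) : 0 < zs t Λ fun _ => True :=
  zs_pos ht (Finset.empty_subset _) trivial

lemma zs_restrict (h : Λ ⊆ Λ') (q : Finset (ℤ × ℤ) → Prop) :
    zs t Λ' (fun A => q A ∧ Disjoint A (Λ' \ Λ)) = zs t Λ q := by
  classical
  unfold zs zg
  refine Finset.sum_congr (Finset.ext fun A => ?_) fun _ _ => rfl
  simp only [Finset.mem_filter, Finset.mem_powerset]
  constructor
  · rintro ⟨h1, h2, h3⟩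
    refine ⟨fun x hx => ?_, h2⟩
    by_contra hx'
    exact Finset.disjoint_left.1 h3 hx (Finset.mem_sdiff.2 ⟨h1 hx, hx'⟩)
  · rintro ⟨h1, h2⟩
    exact ⟨h1.trans h, h2, Finset.disjoint_of_subset_left h1 Finset.disjoint_sdiff⟩

lemma zp_minus_mono (ht : 0 < t) (ht1 : t ≤ 1) (S : Finset (ℤ × ℤ)) :
    Monotone fun Λ => zp t Λ fun A => S ⊆ A := by
  intro Λ Λ' h
  simp only [zp]
  rw [div_le_div_iff₀ (zs_true_pos ht _) (zs_true_pos ht _), ← zs_restrict h, ← zs_restrict h,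
    mul_comm (zs t Λ' fun A => S ⊆ A)]
  refine zs_four ht ht1 fun A B hA _ => ⟨⟨trivial, ?_⟩, hA.1.trans Finset.subset_union_left⟩
  exact Finset.disjoint_of_subset_left Finset.inter_subset_left hA.2

lemma zp_plus_anti (ht : 0 < t) (ht1 : t ≤ 1) (S : Finset (ℤ × ℤ)) :
    Antitone fun Λ => zp t Λ fun A => Disjoint A S := by
  intro Λ Λ' h
  simp only [zp]
  rw [div_le_div_iff₀ (zs_true_pos ht _) (zs_true_pos ht _),
    ← zs_restrict h, ← zs_restrict h]
  refine zs_four ht ht1 fun A B hA hB => ⟨⟨?_, ?_⟩, trivial⟩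
  · exact Finset.disjoint_of_subset_left Finset.inter_subset_left hA
  · exact Finset.disjoint_of_subset_left Finset.inter_subset_right hB.2

lemma zp_nonneg (ht : 0 < t) (Λ : Finset (ℤ × ℤ)) (q : Finset (ℤ × ℤ) → Prop) : 0 ≤ zp t Λ q :=
  div_nonneg (zs_nonneg ht _ _) (zs_true_pos ht _).le

lemma zp_le_one (ht : 0 < t) (Λ : Finset (ℤ × ℤ)) (q : Finset (ℤ × ℤ) → Prop) : zp t Λ q ≤ 1 :=
  (div_le_one (zs_true_pos ht _)).2 (zs_mono ht fun _ _ _ => trivial)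

/-- Turning minus spins on `S` into plus spins costs at most a constant factor. -/
lemma zs_minus_le_plus (ht : 0 < t) (ht1 : t ≤ 1) (S : Finset (ℤ × ℤ)) :
    t ^ (bd S).card * zs t Λ (fun A => S ⊆ A) ≤ zs t Λ (fun A => Disjoint A S) := by
  classical
  simp only [zs, zg, mul_one, Finset.mul_sum]
  have hinj : Set.InjOn (fun A => A \ S) (Λ.powerset.filter fun A => S ⊆ A) := by
    intro A hA B hB h
    simp only [Finset.coe_filter, Set.mem_ofPred_eq] at hA hB
    rw [← Finset.sdiff_union_of_subset hA.2, ← Finset.sdiff_union_of_subset hB.2]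
    exact congrArg (· ∪ S) h
  calc _ ≤ ∑ A ∈ Λ.powerset with S ⊆ A, bw t (A \ S) := by
        refine Finset.sum_le_sum fun A hA => ?_
        rw [Finset.mem_filter] at hA
        rw [bw, bw, ← pow_add]
        refine pow_le_pow_of_le_one ht.le ht1 ?_
        have : A \ S = symmDiff S A := by
          rw [symmDiff_of_le (show S ≤ A from hA.2)]
        rw [this, bd_symmDiff]
        refine (Finset.card_le_card ?_).trans (Finset.card_union_le _ _)
        exact symmDiff_le_sup
    _ = ∑ B ∈ (Λ.powerset.filter fun A => S ⊆ A).image (fun A => A \ S), bw t B :=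
        (Finset.sum_image hinj).symm
    _ ≤ _ := by
        refine Finset.sum_le_sum_of_subset_of_nonneg (fun B hB => ?_) fun B _ _ => (bw_pos ht B).le
        obtain ⟨A, hA, rfl⟩ := Finset.mem_image.1 hB
        rw [Finset.mem_filter, Finset.mem_powerset] at hA ⊢
        exact ⟨Finset.sdiff_subset.trans hA.1, Finset.sdiff_disjoint⟩

lemma exists_tendsto_zp_minus (ht : 0 < t) (ht1 : t ≤ 1) (S : Finset (ℤ × ℤ)) :
    ∃ p : ℝ, 0 < p ∧ Tendsto (fun Λ => zp t Λ fun A => S ⊆ A) atTop (𝓝 p) ∧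
      ∀ᶠ Λ in atTop, p / 2 ≤ zp t Λ fun A => S ⊆ A := by
  have hb : BddAbove (Set.range fun Λ => zp t Λ fun A => S ⊆ A) := by
    refine ⟨1, ?_⟩
    rintro _ ⟨Λ, rfl⟩
    exact zp_le_one ht _ _
  have hlim := tendsto_atTop_ciSup (zp_minus_mono ht ht1 S) hb
  have hpos : 0 < ⨆ Λ, zp t Λ fun A => S ⊆ A :=
    (div_pos (zs_pos ht subset_rfl subset_rfl) (zs_true_pos ht S)).trans_le (le_ciSup hb S)
  exact ⟨_, hpos, hlim, hlim.eventually_const_le (half_lt_self hpos)⟩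

lemma exists_tendsto_zp_plus (ht : 0 < t) (ht1 : t ≤ 1) (S : Finset (ℤ × ℤ)) :
    ∃ p : ℝ, 0 < p ∧ Tendsto (fun Λ => zp t Λ fun A => Disjoint A S) atTop (𝓝 p) := by
  have hb : BddBelow (Set.range fun Λ => zp t Λ fun A => Disjoint A S) := by
    refine ⟨0, ?_⟩
    rintro _ ⟨Λ, rfl⟩
    exact zp_nonneg ht _ _
  have hlim := tendsto_atTop_ciInf (zp_plus_anti ht ht1 S) hb
  obtain ⟨p, hp, -, hev⟩ := exists_tendsto_zp_minus ht ht1 S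
  refine ⟨_, ?_, hlim⟩
  have : t ^ (bd S).card * (p / 2) ≤ ⨅ Λ, zp t Λ fun A => Disjoint A S := by
    refine ge_of_tendsto hlim (hev.mono fun Λ hΛ => ?_)
    refine (mul_le_mul_of_nonneg_left hΛ (by positivity)).trans ?_
    rw [zp, zp, ← mul_div_assoc]
    exact div_le_div_of_nonneg_right (zs_minus_le_plus ht ht1 S) (zs_true_pos ht _).le
  exact (by positivity : 0 < t ^ (bd S).card * (p / 2)).trans_le this

lemma dmg_eq_zp (ht : 0 < t) (L : Finset (ℤ × ℤ)) (x : ℤ × ℤ) :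
    dmg t Λ L x = (zp t Λ fun A => insert x L ⊆ A) / (zp t Λ fun A => L ⊆ A) -
      (1 - (zp t Λ fun A => Disjoint A (insert x L)) / zp t Λ fun A => Disjoint A L) := by
  have hp : 0 < zs t Λ fun A => Disjoint A L :=
    zs_pos ht (Finset.empty_subset _) (Finset.disjoint_empty_left _)
  have h1 : zs t Λ (fun A => Disjoint A L ∧ x ∈ A) =
      zs t Λ (fun A => Disjoint A L) - zs t Λ (fun A => Disjoint A (insert x L)) := by
    rw [eq_sub_iff_add_eq', ← eq_sub_iff_add_eq, ← zs_not]
    exact zs_congr fun A _ => by rw [Finset.disjoint_insert_right]; tauto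
  have h2 : zs t Λ (fun A => L ⊆ A ∧ x ∈ A) = zs t Λ (fun A => insert x L ⊆ A) :=
    zs_congr fun A _ => by rw [Finset.insert_subset_iff]; tauto
  rw [dmg, h1, h2, zp, zp, zp, zp, div_div_div_cancel_right₀ (zs_true_pos ht _).ne',
    div_div_div_cancel_right₀ (zs_true_pos ht _).ne', sub_div, div_self hp.ne']

lemma exists_tendsto_dmg (ht : 0 < t) (ht1 : t ≤ 1) (L : Finset (ℤ × ℤ)) (x : ℤ × ℤ) :
    ∃ D : ℝ, Tendsto (fun Λ => dmg t Λ L x) atTop (𝓝 D) := by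
  obtain ⟨a, -, ha, -⟩ := exists_tendsto_zp_minus ht ht1 (insert x L)
  obtain ⟨b, hb0, hb, -⟩ := exists_tendsto_zp_minus ht ht1 L
  obtain ⟨c, -, hc⟩ := exists_tendsto_zp_plus ht ht1 (insert x L)
  obtain ⟨d, hd0, hd⟩ := exists_tendsto_zp_plus ht ht1 L
  refine ⟨a / b - (1 - c / d), ?_⟩
  simp only [dmg_eq_zp ht]
  exact (ha.div hb hb0.ne').sub ((hc.div hd hd0.ne').const_sub 1)

/-- In the infinite-volume limit the damage decays exponentially. -/
theorem exists_tendsto_dmg_le (ht : 0 < t) (hrho : t ^ 2 + 2 * t < 1) :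
    ∃ C σ : ℝ, 0 ≤ C ∧ 0 < σ ∧ σ < 1 ∧ ∀ (m n : ℕ) (y : ℤ), 1 ≤ n →
      ∃ D ≤ C * σ ^ n, Tendsto (fun Λ => dmg t Λ (halfLine m) ((n : ℤ), y)) atTop (𝓝 D) := by
  obtain ⟨C, σ, hC, h0, h1, h⟩ := exists_dmg_halfLine_le ht hrho
  refine ⟨C, σ, hC, h0, h1, fun m n y hn => ?_⟩
  obtain ⟨D, hD⟩ := exists_tendsto_dmg ht (by nlinarith) (halfLine m) ((n : ℤ), y)
  refine ⟨D, le_of_tendsto_of_frequently hD ?_, hD⟩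
  rw [frequently_atTop]
  exact fun Δ => h m n y Δ hn

end

noncomputable section
set_option linter.unusedSectionVars false

/-! ### The Ising measure in terms of its set of minus spins -/

variable {β : ℝ} {Λ : Finset (ℤ × ℤ)}

/-- The configuration whose minus spins are exactly the sites of `A`. -/
def minusCfg (A : Finset (ℤ × ℤ)) : Cfg2 := fun x => !decide (x ∈ A)

lemma sval_minusCfg (A : Finset (ℤ × ℤ)) (x : ℤ × ℤ) :
    sval (minusCfg A x) = if x ∈ A then -1 else 1 := by
  by_cases h : x ∈ A <;> simp [sval, minusCfg, h]

lemma energy_minusCfg {A : Finset (ℤ × ℤ)} (hA : A ⊆ Λ) :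
    (∑ x ∈ Λ, ∑ y ∈ Λ.filter (fun y => y ∈ nbrs x),
        sval (minusCfg A x) * sval (minusCfg A y)) / 2
      + ∑ x ∈ Λ, ∑ _y ∈ (nbrs x).filter (fun y => y ∉ Λ), sval (minusCfg A x) * sval true =
    ((∑ x ∈ Λ, ((Λ.filter fun y => y ∈ nbrs x).card : ℝ)) / 2
      + ∑ x ∈ Λ, (((nbrs x).filter fun y => y ∉ Λ).card : ℝ)) - 2 * (bd A).card := by
  set d : ℤ × ℤ → ℤ × ℤ → ℝ := fun x y => if x ∈ A ∧ y ∉ A then 1 else 0 with hd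
  have hs : ∀ x y, sval (minusCfg A x) * sval (minusCfg A y) = 1 - 2 * d x y - 2 * d y x := by
    intro x y
    rw [sval_minusCfg, sval_minusCfg]
    by_cases h1 : x ∈ A <;> by_cases h2 : y ∈ A <;> norm_num [hd, h1, h2]
  have hb : ∀ x, ∀ y ∈ (nbrs x).filter (fun y => y ∉ Λ),
      sval (minusCfg A x) * sval true = 1 - 2 * d x y := by
    intro x y hy
    have : y ∉ A := fun h => (Finset.mem_filter.1 hy).2 (hA h)
    rw [sval_minusCfg]
    by_cases h1 : x ∈ A <;> norm_num [hd, h1, this, sval]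
  have hsymm : ∑ x ∈ Λ, ∑ y ∈ Λ.filter (fun y => y ∈ nbrs x), d y x =
      ∑ x ∈ Λ, ∑ y ∈ Λ.filter (fun y => y ∈ nbrs x), d x y := by
    simp only [Finset.sum_filter]
    rw [Finset.sum_comm]
    simp only [mem_nbrs_comm]
  have hcard : ((bd A).card : ℝ) = ∑ x ∈ Λ, ∑ y ∈ Λ.filter (fun y => y ∈ nbrs x), d x y +
      ∑ x ∈ Λ, ∑ y ∈ (nbrs x).filter (fun y => y ∉ Λ), d x y := by
    rw [card_bd, ← Finset.sum_add_distrib, Nat.cast_sum, ← Finset.sum_subset hA]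
    · refine Finset.sum_congr rfl fun x hx => ?_
      have : Λ.filter (fun y => y ∈ nbrs x) = (nbrs x).filter fun y => y ∈ Λ := by
        ext y; simp [and_comm]
      rw [this, Finset.sum_filter_add_sum_filter_not, Finset.card_filter, Nat.cast_sum]
      refine Finset.sum_congr rfl fun y _ => ?_
      simp [hd, hx]
    · intro x _ hx
      simp [hd, hx]
  rw [Finset.sum_congr rfl fun x _ => Finset.sum_congr rfl fun y _ => hs x y,
    Finset.sum_congr rfl fun x _ => Finset.sum_congr rfl (hb x), hcard]
  simp only [Finset.sum_sub_distrib, ← Finset.mul_sum, hsymm, Finset.sum_const, nsmul_eq_mul, mul_one]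
  ring

lemma exists_isingWeight_eq (β : ℝ) (Λ : Finset (ℤ × ℤ)) :
    ∃ c : ℝ, 0 < c ∧ ∀ A ⊆ Λ,
      isingWeight β 0 Λ (fun _ => true) (minusCfg A) = c * bw (Real.exp (-2 * β)) A := by
  refine ⟨Real.exp (β * ((∑ x ∈ Λ, ((Λ.filter fun y => y ∈ nbrs x).card : ℝ)) / 2
      + ∑ x ∈ Λ, (((nbrs x).filter fun y => y ∉ Λ).card : ℝ))), Real.exp_pos _, fun A hA => ?_⟩
  rw [isingWeight, energy_minusCfg hA, bw, ← Real.exp_nat_mul, ← Real.exp_add]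
  congr 1
  ring

lemma sum_fill (Λ : Finset (ℤ × ℤ)) (f : Cfg2 → ENNReal) :
    ∑ τ : ↥Λ → Bool, f (fill Λ (fun _ => true) τ) = ∑ A ∈ Λ.powerset, f (minusCfg A) := by
  symm
  refine Finset.sum_bij' (fun A _ => fun x : Λ => !decide ((x : ℤ × ℤ) ∈ A))
    (fun τ _ => Λ.filter fun x => fill Λ (fun _ => true) τ x = false) ?_ ?_ ?_ ?_ ?_
  · simp
  · simp
  · intro A hA
    rw [Finset.mem_powerset] at hA
    ext x
    by_cases h : x ∈ Λ
    · simp [fill, h]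
    · simp [h, show x ∉ A from fun h' => h (hA h')]
  · intro τ _
    ext ⟨x, hx⟩
    simp [fill, hx]
  · intro A hA
    rw [Finset.mem_powerset] at hA
    congr 1
    ext x
    by_cases h : x ∈ Λ
    · simp [fill, h, minusCfg]
    · simp [fill, h, minusCfg, show x ∉ A from fun h' => h (hA h')]

lemma isingFV_toReal (β : ℝ) (Λ : Finset (ℤ × ℤ)) (E : Set Cfg2) :
    (isingFV β 0 Λ (fun _ => true) E).toReal =
      zp (Real.exp (-2 * β)) Λ fun A => minusCfg A ∈ E := by
  classical
  obtain ⟨c, hc, hw⟩ := exists_isingWeight_eq β Λ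
  have ht := Real.exp_pos (-2 * β)
  have hterm : ∀ q : Finset (ℤ × ℤ) → Prop,
      ∑ A ∈ Λ.powerset, (if q A then
        ENNReal.ofReal (isingWeight β 0 Λ (fun _ => true) (minusCfg A)) else 0) =
      ENNReal.ofReal (c * zs (Real.exp (-2 * β)) Λ q) := by
    intro q
    rw [← Finset.sum_filter, zs, zg, Finset.mul_sum, ENNReal.ofReal_sum_of_nonneg]
    · refine Finset.sum_congr (by congr) fun A hA => ?_
      rw [hw A (Finset.mem_powerset.1 (Finset.mem_filter.1 hA).1), mul_one]
    · intro A _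
      rw [mul_one]
      exact (mul_pos hc (bw_pos ht A)).le
  have hden := hterm fun _ => True
  simp only [if_true] at hden
  rw [isingFV, Measure.smul_apply, sum_fill Λ fun η =>
    ENNReal.ofReal (isingWeight β 0 Λ (fun _ => true) η), hden, Measure.finsetSum_apply]
  simp only [Measure.smul_apply, Measure.dirac_apply, smul_eq_mul]
  rw [sum_fill Λ fun η => ENNReal.ofReal (isingWeight β 0 Λ (fun _ => true) η) *
    E.indicator 1 η]
  simp only [Set.indicator_apply, Pi.one_apply, mul_ite, mul_one, mul_zero]
  rw [hterm, ENNReal.toReal_mul, ENNReal.toReal_inv,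
    ENNReal.toReal_ofReal (mul_pos hc (zs_true_pos ht Λ)).le,
    ENNReal.toReal_ofReal (mul_nonneg hc.le (zs_nonneg ht _ _)), zp, ← div_eq_inv_mul,
    mul_div_mul_left _ _ (ne_of_gt hc)]

/-! ### Local events -/

/-- The events which depend only on finitely many spins in `S`. -/
def localEvents (S : Set (ℤ × ℤ)) : Set (Set Cfg2) :=
  {E | ∃ s : Finset (ℤ × ℤ), ↑s ⊆ S ∧ ∀ η η' : Cfg2, (∀ i ∈ s, η i = η' i) → η ∈ E → η' ∈ E}

lemma eq_biUnion_cylinder {s : Finset (ℤ × ℤ)} {E : Set Cfg2}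
    (h : ∀ η η' : Cfg2, (∀ i ∈ s, η i = η' i) → η ∈ E → η' ∈ E) [DecidablePred fun A => minusCfg A ∈ E] :
    E = ⋃ A ∈ s.powerset.filter fun A => minusCfg A ∈ E, {η : Cfg2 | ∀ i ∈ s, η i = minusCfg A i} := by
  ext η
  simp only [Set.mem_iUnion, Finset.mem_filter, Finset.mem_powerset, Set.mem_ofPred_eq, exists_prop]
  constructor
  · intro hη
    have heq : ∀ i ∈ s, η i = minusCfg (s.filter fun x => η x = false) i := by
      intro i hi
      simp [minusCfg, hi]
    exact ⟨_, ⟨Finset.filter_subset _ _, h _ _ heq hη⟩, heq⟩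
  · rintro ⟨A, ⟨_, hA⟩, heq⟩
    exact h _ _ (fun i hi => (heq i hi).symm) hA

lemma measurableSet_cylinder (s : Finset (ℤ × ℤ)) (f : Cfg2) :
    MeasurableSet {η : Cfg2 | ∀ i ∈ s, η i = f i} := by
  have : {η : Cfg2 | ∀ i ∈ s, η i = f i} = ⋂ i ∈ s, (fun η : Cfg2 => η i) ⁻¹' {f i} := by
    ext; simp
  rw [this]
  exact Finset.measurableSet_biInter _ fun i _ => measurable_pi_apply i (measurableSet_singleton _)

lemma measurableSet_of_mem_localEvents {S : Set (ℤ × ℤ)} {E : Set Cfg2} (hE : E ∈ localEvents S) :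
    MeasurableSet E := by
  classical
  obtain ⟨s, -, h⟩ := hE
  rw [eq_biUnion_cylinder h]
  exact Finset.measurableSet_biUnion _ fun A _ => measurableSet_cylinder s _

/-- Finite volume probabilities of local events converge. -/
lemma IsPlusPhase.tendsto_zp {μ : Measure Cfg2} (hμ : IsPlusPhase β 0 μ) {s : Finset (ℤ × ℤ)}
    {E : Set Cfg2} (h : ∀ η η' : Cfg2, (∀ i ∈ s, η i = η' i) → η ∈ E → η' ∈ E) :
    Tendsto (fun n => zp (Real.exp (-2 * β)) (box n) fun A => minusCfg A ∈ E) atTop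
      (𝓝 (μ.real E)) := by
  classical
  have := hμ.1
  have hsum : ∀ ν : Measure Cfg2, ν E = ∑ A ∈ s.powerset.filter fun A => minusCfg A ∈ E,
      ν {η : Cfg2 | ∀ i ∈ s, η i = minusCfg A i} := by
    intro ν
    conv_lhs => rw [eq_biUnion_cylinder h]
    refine measure_biUnion_finset ?_ fun A _ => measurableSet_cylinder s _
    intro A hA B hB hAB
    simp only [Finset.coe_filter, Finset.mem_powerset, Set.mem_ofPred_eq] at hA hB
    refine Set.disjoint_left.2 fun η h1 h2 => hAB ?_
    ext x
    by_cases hx : x ∈ s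
    · have := (h1 x hx).symm.trans (h2 x hx)
      simpa [minusCfg] using this
    · exact iff_of_false (fun h => hx (hA.1 h)) fun h => hx (hB.1 h)
  have hlim : Tendsto (fun n => isingFV β 0 (box n) (fun _ => true) E) atTop (𝓝 (μ E)) := by
    rw [hsum μ]
    simp only [hsum (isingFV _ _ _ _)]
    exact tendsto_finsetSum _ fun A _ => hμ.2 s (minusCfg A)
  have := (ENNReal.tendsto_toReal (measure_ne_top μ E)).comp hlim
  simpa only [Function.comp_def, isingFV_toReal, Measure.real] using this

lemma tendsto_box : Tendsto box atTop atTop := by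
  refine tendsto_atTop.2 fun Δ => ?_
  obtain ⟨N, hN⟩ := exists_coord_bound Δ
  filter_upwards [eventually_ge_atTop N] with n hn p hp
  have := hN p hp
  simp only [box, Finset.mem_product, Finset.mem_Icc]
  omega
end

noncomputable section
set_option linter.unusedSectionVars false

/-! ### Decay of correlations in the plus phase -/

variable {β : ℝ}

lemma isSetAlgebra_localEvents (S : Set (ℤ × ℤ)) : IsSetAlgebra (localEvents S) where
  empty_mem := ⟨∅, by simp, fun _ _ _ h => h⟩
  compl_mem := by
    rintro E ⟨s, hs, h⟩
    exact ⟨s, hs, fun η η' heq hη hη' => hη (h η' η (fun i hi => (heq i hi).symm) hη')⟩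
  union_mem := by
    rintro E F ⟨s, hs, h⟩ ⟨s', hs', h'⟩
    refine ⟨s ∪ s', by simp [hs, hs'], fun η η' heq hη => ?_⟩
    rcases hη with hη | hη
    · exact Or.inl (h η η' (fun i hi => heq i (Finset.mem_union_left _ hi)) hη)
    · exact Or.inr (h' η η' (fun i hi => heq i (Finset.mem_union_right _ hi)) hη)

lemma sigmaOn_le_generateFrom_localEvents (S : Set (ℤ × ℤ)) :
    sigmaOn (A := Bool) S ≤ MeasurableSpace.generateFrom (localEvents S) := by
  rw [sigmaOn, ← measurable_iff_comap_le]
  refine (@measurable_pi_iff _ _ _ (MeasurableSpace.generateFrom (localEvents S)) _ _).2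
    fun i => ?_
  refine @measurable_to_bool _ (MeasurableSpace.generateFrom (localEvents S)) _
    (MeasurableSpace.measurableSet_generateFrom ⟨{i.1}, by simp, fun η η' heq hη => ?_⟩)
  have h1 : η i = true := hη
  exact (heq i (Finset.mem_singleton_self _)).symm.trans h1

lemma generateFrom_localEvents_le (S : Set (ℤ × ℤ)) :
    MeasurableSpace.generateFrom (localEvents S) ≤ MeasurableSpace.pi :=
  MeasurableSpace.generateFrom_le fun _ h => measurableSet_of_mem_localEvents h

/-- Events in the σ-algebra generated by the spins in `S` are approximated by local ones. -/
lemma exists_localEvents_approx {μ : Measure Cfg2} [IsProbabilityMeasure μ] {S : Set (ℤ × ℤ)}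
    {E : Set Cfg2} (hE : MeasurableSet[sigmaOn S] E) {δ : ℝ} (hδ : 0 < δ) :
    ∃ F ∈ localEvents S, μ.real (symmDiff E F) < δ := by
  have hle := generateFrom_localEvents_le S
  have hE' := sigmaOn_le_generateFrom_localEvents S E hE
  have hfin := isFiniteMeasure_trim (μ := μ) hle
  have hdense := @Measure.MeasureDense.of_generateFrom_isSetAlgebra_finite _
    (MeasurableSpace.generateFrom (localEvents S)) (μ.trim hle) (localEvents S) hfin
    (isSetAlgebra_localEvents S) rfl
  obtain ⟨F, hF, hFE⟩ := @Measure.MeasureDense.approx _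
    (MeasurableSpace.generateFrom (localEvents S)) (μ.trim hle) (localEvents S) hdense E hE'
    (@measure_ne_top _ (MeasurableSpace.generateFrom (localEvents S)) (μ.trim hle) hfin E) δ hδ
  refine ⟨F, hF, ?_⟩
  rw [trim_measurableSet_eq hle (@MeasurableSet.symmDiff _ (MeasurableSpace.generateFrom (localEvents S))
    _ _ hE' (MeasurableSpace.measurableSet_generateFrom hF))] at hFE
  exact (ENNReal.lt_ofReal_iff_toReal_lt (measure_ne_top _ _)).1 hFE

lemma abs_covariance_le_of_localEvents {μ : Measure Cfg2} [IsProbabilityMeasure μ]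
    {S T : Set (ℤ × ℤ)} {ε : ℝ}
    (h : ∀ A ∈ localEvents S, ∀ B ∈ localEvents T,
      |μ.real (A ∩ B) - μ.real A * μ.real B| ≤ μ.real A * ε)
    {A B : Set Cfg2} (hA : MeasurableSet[sigmaOn S] A) (hB : MeasurableSet[sigmaOn T] B) :
    |μ.real (A ∩ B) - μ.real A * μ.real B| ≤ μ.real A * ε := by
  have key : ∀ δ > 0, |μ.real (A ∩ B) - μ.real A * μ.real B| ≤ μ.real A * ε + (4 + |ε|) * δ := by
    intro δ hδ
    have hAm := generateFrom_localEvents_le S A (sigmaOn_le_generateFrom_localEvents S A hA)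
    have hBm := generateFrom_localEvents_le T B (sigmaOn_le_generateFrom_localEvents T B hB)
    obtain ⟨A', hA', hAA⟩ := exists_localEvents_approx (μ := μ) hA hδ
    obtain ⟨B', hB', hBB⟩ := exists_localEvents_approx (μ := μ) hB hδ
    have hAm' := measurableSet_of_mem_localEvents hA'
    have hBm' := measurableSet_of_mem_localEvents hB'
    have h1 := (abs_measureReal_sub_le_measureReal_symmDiff (μ := μ) hAm.nullMeasurableSet
      hAm'.nullMeasurableSet).trans hAA.le
    have h2 := (abs_measureReal_sub_le_measureReal_symmDiff (μ := μ) hBm.nullMeasurableSet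
      hBm'.nullMeasurableSet).trans hBB.le
    have h3 : |μ.real (A ∩ B) - μ.real (A' ∩ B')| ≤ 2 * δ := by
      refine (abs_measureReal_sub_le_measureReal_symmDiff (hAm.inter hBm).nullMeasurableSet
        (hAm'.inter hBm').nullMeasurableSet).trans ?_
      have hsub : symmDiff (A ∩ B) (A' ∩ B') ⊆ symmDiff A A' ∪ symmDiff B B' := by
        intro x
        simp only [Set.mem_symmDiff, Set.mem_inter_iff, Set.mem_union]
        tauto
      have := (measureReal_mono (μ := μ) hsub).trans (measureReal_union_le _ _)
      linarith
    have h4 := h A' hA' B' hB'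
    have a1 : 0 ≤ μ.real A' := measureReal_nonneg
    have a2 : μ.real A' ≤ 1 := measureReal_le_one
    have a3 : 0 ≤ μ.real B := measureReal_nonneg
    have a4 : μ.real B ≤ 1 := measureReal_le_one
    have h5 : |μ.real A * μ.real B - μ.real A' * μ.real B'| ≤ 2 * δ := by
      have : μ.real A * μ.real B - μ.real A' * μ.real B' =
        (μ.real A - μ.real A') * μ.real B + μ.real A' * (μ.real B - μ.real B') := by ring
      rw [this]
      refine (abs_add_le _ _).trans ?_
      rw [abs_mul, abs_mul, abs_of_nonneg a3, abs_of_nonneg a1]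
      nlinarith [abs_nonneg (μ.real A - μ.real A'), abs_nonneg (μ.real B - μ.real B')]
    have h6 : (μ.real A' - μ.real A) * ε ≤ |ε| * δ := by
      refine (le_abs_self _).trans ?_
      rw [abs_mul, abs_sub_comm, mul_comm]
      exact mul_le_mul_of_nonneg_left h1 (abs_nonneg _)
    rw [abs_le] at h3 h4 h5 ⊢
    constructor <;> nlinarith
  refine le_of_forall_pos_le_add fun η hη => ?_
  have hpos : 0 < 4 + |ε| := by positivity
  refine (key (η / (4 + |ε|)) (by positivity)).trans (le_of_eq ?_)
  field_simp

lemma minusCfg_mem_iff {s : Finset (ℤ × ℤ)} {E : Set Cfg2}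
    (h : ∀ η η' : Cfg2, (∀ i ∈ s, η i = η' i) → η ∈ E → η' ∈ E) {A B : Finset (ℤ × ℤ)}
    (hAB : A ∩ s = B ∩ s) : minusCfg A ∈ E ↔ minusCfg B ∈ E := by
  have : ∀ i ∈ s, minusCfg A i = minusCfg B i := by
    intro i hi
    have := Finset.ext_iff.1 hAB i
    simp only [Finset.mem_inter, hi, and_true] at this
    simp [minusCfg, this]
  exact ⟨h _ _ this, h _ _ fun i hi => (this i hi).symm⟩

/-- Exponential decay of correlations between the negative half line and local events on its
right. -/
theorem IsPlusPhase.exists_abs_covariance_le {μ : Measure Cfg2} (hμ : IsPlusPhase β 0 μ)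
    (hrho : Real.exp (-2 * β) ^ 2 + 2 * Real.exp (-2 * β) < 1) :
    ∃ C σ : ℝ, 0 ≤ C ∧ 0 < σ ∧ σ < 1 ∧ ∀ A ∈ localEvents {p : ℤ × ℤ | p.1 < 0 ∧ p.2 = 0},
      ∀ (s : Finset (ℤ × ℤ)) (B : Set Cfg2),
        (∀ η η' : Cfg2, (∀ i ∈ s, η i = η' i) → η ∈ B → η' ∈ B) → (∀ x ∈ s, 1 ≤ x.1) →
        |μ.real (A ∩ B) - μ.real A * μ.real B| ≤
          μ.real A * (2 * ∑ x ∈ s, C * σ ^ x.1.toNat) := by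
  have ht := Real.exp_pos (-2 * β)
  obtain ⟨C, σ, hC, h0, h1, hD⟩ := exists_tendsto_dmg_le ht hrho
  refine ⟨C, σ, hC, h0, h1, ?_⟩
  rintro A ⟨l, hl, hA⟩ s B hB hs
  obtain ⟨m, hm⟩ := exists_coord_bound l
  have hlm : l ⊆ halfLine m := by
    intro p hp
    have h1 := hm p hp
    have h2 : p.1 < 0 ∧ p.2 = 0 := hl hp
    rw [mem_halfLine]
    omega
  have hA' : ∀ η η' : Cfg2, (∀ i ∈ halfLine m, η i = η' i) → η ∈ A → η' ∈ A :=
    fun η η' h => hA η η' fun i hi => h i (hlm hi)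
  have hAB : ∀ η η' : Cfg2, (∀ i ∈ halfLine m ∪ s, η i = η' i) → η ∈ A ∩ B → η' ∈ A ∩ B :=
    fun η η' h hη => ⟨hA' η η' (fun i hi => h i (Finset.mem_union_left _ hi)) hη.1,
      hB η η' (fun i hi => h i (Finset.mem_union_right _ hi)) hη.2⟩
  have hx : ∀ x ∈ s, ∃ D ≤ C * σ ^ x.1.toNat,
      Tendsto (fun n => dmg (Real.exp (-2 * β)) (box n) (halfLine m) x) atTop (𝓝 D) := by
    intro x hx
    have h1 := hs x hx
    obtain ⟨D, hle, hlim⟩ := hD m x.1.toNat x.2 (by omega)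
    refine ⟨D, hle, ?_⟩
    rw [Int.toNat_of_nonneg (by omega)] at hlim
    exact hlim.comp tendsto_box
  choose! D hDle hDlim using hx
  refine (le_of_tendsto_of_tendsto (((hμ.tendsto_zp hAB).sub
    ((hμ.tendsto_zp hA').mul (hμ.tendsto_zp hB))).abs) ((hμ.tendsto_zp hA').mul
    ((tendsto_finsetSum s hDlim).const_mul 2)) ?_).trans ?_
  · filter_upwards [tendsto_box.eventually_ge_atTop (halfLine m)] with n hn
    exact covariance_bound ht (by nlinarith) hn (fun _ _ => minusCfg_mem_iff hA')
      (fun _ _ => minusCfg_mem_iff hB)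
  · exact mul_le_mul_of_nonneg_left (mul_le_mul_of_nonneg_left (Finset.sum_le_sum hDle) zero_le_two)
      measureReal_nonneg

lemma sum_cone_le {r : ℝ} (h0 : 0 < r) (h1 : r < 1) (n : ℕ) {s : Finset (ℤ × ℤ)}
    (hs : ∀ x ∈ s, (n : ℤ) ≤ x.1 ∧ ((|x.2| : ℤ) : ℝ) ≤ r⁻¹ ^ x.1.toNat) :
    ∑ x ∈ s, (r ^ 2) ^ x.1.toNat ≤ 3 * (r ^ n / (1 - r)) := by
  obtain ⟨N, hN⟩ := exists_coord_bound s
  have hmaps : ∀ x ∈ s, x.1.toNat ∈ Finset.Ico n (N + 1) := by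
    intro x hx
    have h1 := hN x hx
    have h2 := (hs x hx).1
    rw [Finset.mem_Ico]
    omega
  rw [← Finset.sum_fiberwise_of_maps_to hmaps]
  have hfib : ∀ k ∈ Finset.Ico n (N + 1),
      ∑ x ∈ s with x.1.toNat = k, (r ^ 2) ^ x.1.toNat ≤ 3 * r ^ k := by
    intro k _
    have hM : 1 ≤ r⁻¹ ^ k := one_le_pow₀ ((one_le_inv₀ h0).2 h1.le)
    have hcard : (s.filter fun x => x.1.toNat = k).card ≤
        (Finset.Icc (-⌊r⁻¹ ^ k⌋) ⌊r⁻¹ ^ k⌋).card := by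
      refine Finset.card_le_card_of_injOn Prod.snd ?_ ?_
      · intro x hx
        obtain ⟨hxs, rfl⟩ := Finset.mem_filter.1 hx
        have := Int.le_floor.2 (hs x hxs).2
        rw [Finset.mem_coe, Finset.mem_Icc]
        exact abs_le.1 this
      · intro x hx y hy hxy
        obtain ⟨hx, hxk⟩ := Finset.mem_filter.1 hx
        obtain ⟨hy, hyk⟩ := Finset.mem_filter.1 hy
        have := (hs x hx).1
        have := (hs y hy).1
        exact Prod.ext (by omega) hxy
    have hcard' : ((s.filter fun x => x.1.toNat = k).card : ℝ) ≤ 3 * r⁻¹ ^ k := by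
      have h3 : (1 : ℤ) ≤ ⌊r⁻¹ ^ k⌋ := Int.le_floor.2 (by exact_mod_cast hM)
      have h4 := Int.floor_le (r⁻¹ ^ k)
      rw [Int.card_Icc] at hcard
      have h5 : ((s.filter fun x => x.1.toNat = k).card : ℤ) ≤ 3 * ⌊r⁻¹ ^ k⌋ := by omega
      have h6 : ((s.filter fun x => x.1.toNat = k).card : ℝ) ≤ 3 * (⌊r⁻¹ ^ k⌋ : ℝ) := by
        exact_mod_cast h5
      linarith
    calc ∑ x ∈ s with x.1.toNat = k, (r ^ 2) ^ x.1.toNat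
        = (s.filter fun x => x.1.toNat = k).card * (r ^ 2) ^ k := by
          rw [Finset.sum_congr rfl fun x hx => by rw [(Finset.mem_filter.1 hx).2],
            Finset.sum_const, nsmul_eq_mul]
      _ ≤ 3 * r⁻¹ ^ k * (r ^ 2) ^ k := mul_le_mul_of_nonneg_right hcard' (by positivity)
      _ = 3 * r ^ k := by
          rw [mul_assoc, ← mul_pow]
          congr 2
          field_simp
  refine (Finset.sum_le_sum hfib).trans ?_
  rw [← Finset.mul_sum]
  exact mul_le_mul_of_nonneg_left (geom_sum_Ico_le_of_lt_one h0.le h1) (by norm_num)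

lemma exp_neg_two_mul_lt_of_betaCrit_lt (hβ : betaCrit < β) :
    Real.exp (-2 * β) ^ 2 + 2 * Real.exp (-2 * β) < 1 := by
  have h2 : (1 : ℝ) ≤ √2 := Real.one_le_sqrt.2 one_le_two
  have hsq : √2 ^ 2 = (2 : ℝ) := Real.sq_sqrt zero_le_two
  have hlt : Real.exp (-2 * β) < √2 - 1 := by
    have h3 : -2 * β < -Real.log (1 + √2) := by
      rw [betaCrit] at hβ
      linarith
    refine (Real.exp_lt_exp.2 h3).trans_eq ?_
    rw [Real.exp_neg, Real.exp_log (by positivity)]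
    exact inv_eq_of_mul_eq_one_right (by nlinarith)
  nlinarith [Real.exp_pos (-2 * β)]

end

lemma tendsto_sSup_of_forall_le {D : ℕ → Set ℝ} {u : ℕ → ℝ} (hu : Tendsto u atTop (𝓝 0))
    (h0 : ∀ n, ∀ d ∈ D n, 0 ≤ d) (hun : ∀ n, 0 ≤ u n) (h : ∀ᶠ n in atTop, ∀ d ∈ D n, d ≤ u n) :
    Tendsto (fun n => sSup (D n)) atTop (𝓝 0) :=
  tendsto_of_tendsto_of_tendsto_of_le_of_le' tendsto_const_nhds hu
    (Eventually.of_forall fun n => Real.sSup_nonneg (h0 n))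
    (h.mono fun n hn => Real.sSup_le hn (hun n))

lemma abs_condProbR_sub_le {X : Type*} [MeasurableSpace X] {μ : Measure X} [IsProbabilityMeasure μ]
    {A B : Set X} {ε : ℝ} (hA : MeasurableSet A) (hpos : 0 < μ A)
    (h : |μ.real (A ∩ B) - μ.real A * μ.real B| ≤ μ.real A * ε) :
    |condProbR μ B A - (μ B).toReal| ≤ ε := by
  have hA0 : 0 < μ.real A := ENNReal.toReal_pos hpos.ne' (measure_ne_top _ _)
  rw [condProbR, cond_apply hA, ENNReal.toReal_mul, ENNReal.toReal_inv]
  change |(μ.real A)⁻¹ * μ.real (A ∩ B) - μ.real B| ≤ ε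
  have : (μ.real A)⁻¹ * μ.real (A ∩ B) - μ.real B =
      (μ.real A)⁻¹ * (μ.real (A ∩ B) - μ.real A * μ.real B) := by
    field_simp
  rw [this, abs_mul, abs_of_pos (inv_pos.2 hA0), inv_mul_le_iff₀ hA0]
  exact h

/-- For `h = 0` and `β > β_c` there is `θ ∈ (0,∞)` such that
`sup_{B ∈ ℱ̃_{C_{θ,n}}} sup_{A ∈ ℱ̃_{<0}, μ⁺(A)>0} |μ⁺(B|A) − μ⁺(B)| → 0` as `n → ∞`,
where `C_θ = {(x,y) : x ≥ 0, |y| ≤ e^{θx}}` and `C_{θ,n} = C_θ ∩ ([n,∞) × ℤ)`. -/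
theorem ising_one_sided_mixing_in_cone
    (β : ℝ) (hβ : betaCrit < β) (μp : Measure Cfg2) (hμp : IsPlusPhase β 0 μp) :
    ∃ θ : ℝ, 0 < θ ∧
      Tendsto (fun n : ℕ => sSup {d : ℝ | ∃ A B : Set Cfg2,
          MeasurableSet[sigmaOn {p : ℤ × ℤ | p.1 < 0 ∧ p.2 = 0}] A ∧
          MeasurableSet[sigmaOn ({p : ℤ × ℤ | 0 ≤ p.1 ∧ ((|p.2| : ℤ) : ℝ) ≤ Real.exp (θ * (p.1 : ℝ))}
            ∩ {p : ℤ × ℤ | (n : ℤ) ≤ p.1})] B ∧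
          0 < μp A ∧ d = |condProbR μp B A - (μp B).toReal|})
        atTop (𝓝 0) := by
  have hprob := hμp.1
  obtain ⟨C, σ, hC, hσ0, hσ1, hcov⟩ :=
    hμp.exists_abs_covariance_le (exp_neg_two_mul_lt_of_betaCrit_lt hβ)
  set r := √σ with hr
  have hr0 : 0 < r := Real.sqrt_pos.2 hσ0
  have hr1 : r < 1 := (Real.sqrt_lt' one_pos).2 (by rwa [one_pow])
  have hr2 : r ^ 2 = σ := Real.sq_sqrt hσ0.le
  refine ⟨-Real.log r, neg_pos.2 (Real.log_neg hr0 hr1), ?_⟩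
  have h1r : 0 < 1 - r := sub_pos.2 hr1
  refine tendsto_sSup_of_forall_le (u := fun n => 2 * (C * (3 * (r ^ n / (1 - r))))) ?_ ?_
    (fun n => by positivity) ?_
  · simpa using ((((tendsto_pow_atTop_nhds_zero_of_lt_one hr0.le hr1).div_const
      (1 - r)).const_mul 3).const_mul C).const_mul 2
  · rintro n d ⟨A, B, -, -, -, rfl⟩
    exact abs_nonneg _
  · filter_upwards [eventually_ge_atTop 1] with n hn
    rintro d ⟨A, B, hA, hB, hpos, rfl⟩
    refine abs_condProbR_sub_le
      (generateFrom_localEvents_le _ A (sigmaOn_le_generateFrom_localEvents _ A hA)) hpos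
      (abs_covariance_le_of_localEvents ?_ hA hB)
    rintro A hA B ⟨s, hs, hB⟩
    have hs' : ∀ x ∈ s, (n : ℤ) ≤ x.1 ∧ ((|x.2| : ℤ) : ℝ) ≤ r⁻¹ ^ x.1.toNat := by
      intro x hx
      obtain ⟨⟨h0, h1⟩, h2⟩ := hs hx
      refine ⟨h2, h1.trans_eq ?_⟩
      rw [← Real.exp_log (inv_pos.2 hr0), ← Real.exp_nat_mul, Real.log_inv, mul_comm]
      congr 2
      exact_mod_cast (Int.toNat_of_nonneg h0).symm
    refine (hcov A hA s B hB fun x hx => le_trans (by exact_mod_cast hn) (hs' x hx).1).trans ?_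
    rw [← Finset.mul_sum]
    have := sum_cone_le hr0 hr1 n hs'
    rw [hr2] at this
    gcongr
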